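/- arXiv:2602.06199 — 2 statements merged into one kernel-verified Lean document; each statement's English description precedes it below -/
import Mathlib

section
/- Assume the Riemann hypothesis. Then for all real x > 1 one has Σ_{n ≤ x} (Λ(n)/n) · (1 − n/x) ≤ log x − (1 + γ) + (log 2π)/x + 2|B|/√x − 1/(6x³), where B = (log 4π)/2 − 1 − γ/2. -/
/-- The constant `B = (log 4π)/2 − 1 − γ/2 = −0.02309…`. -/
noncomputable def Bconst : ℝ :=
  Real.log (4 * Real.pi) / 2 - 1 - Real.eulerMascheroniConstant / 2

section

open Complex MeasureTheory Set Filter Topology Asymptotics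

namespace Cesaro

/-- fractional part beyond one -/
noncomputable def frc (t : ℝ) : ℂ := (Ioi (1:ℝ)).indicator (fun t => ((Int.fract t : ℝ) : ℂ)) t

lemma frc_norm_le (t : ℝ) : ‖frc t‖ ≤ 1 := by
  unfold frc
  by_cases h : t ∈ Ioi (1:ℝ)
  · rw [indicator_of_mem h, norm_real, Real.norm_eq_abs, abs_of_nonneg (Int.fract_nonneg t)]
    exact (Int.fract_lt_one t).le
  · rw [indicator_of_notMem h]; simp

lemma frc_meas : Measurable frc := by
  unfold frc
  exact (measurable_ofReal.comp measurable_fract).indicator measurableSet_Ioi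

lemma J_diff {w : ℂ} (hw : w.re < 0) : DifferentiableAt ℂ (mellin frc) w := by
  apply mellin_differentiableAt_of_isBigO_rpow (a := 0) (b := w.re - 1)
  · apply LocallyIntegrable.locallyIntegrableOn
    apply (locallyIntegrable_const (1:ℝ)).mono frc_meas.aestronglyMeasurable
    filter_upwards with t
    simpa using frc_norm_le t
  · apply IsBigO.of_bound 1
    filter_upwards with t
    simpa using frc_norm_le t
  · simpa using hw
  · apply IsBigO.of_bound 0
    have : ∀ᶠ t:ℝ in 𝓝[>] 0, t < 1 := by
      apply mem_nhdsWithin_of_mem_nhds (Iio_mem_nhds one_pos)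
    filter_upwards [this] with t ht
    simp [frc, not_lt.mpr ht.le]
  · linarith

lemma J_eq (s : ℂ) : mellin frc (-s) = ∫ t in Ioi (1:ℝ), (t:ℂ) ^ (-s - 1) * ((Int.fract t : ℝ) : ℂ) := by
  rw [mellin]
  have : ∀ t : ℝ, (t:ℂ)^(-s-1) • frc t = (Ioi (1:ℝ)).indicator (fun t : ℝ => (t:ℂ)^(-s-1) * ((Int.fract t : ℝ) : ℂ)) t := by
    intro t
    unfold frc
    by_cases h : t ∈ Ioi (1:ℝ)
    · rw [indicator_of_mem h, indicator_of_mem h, smul_eq_mul]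
    · rw [indicator_of_notMem h, indicator_of_notMem h, smul_zero]
  simp_rw [this]
  rw [setIntegral_indicator measurableSet_Ioi]
  congr 2
  exact inter_eq_right.mpr (Ioi_subset_Ioi zero_le_one)

lemma J_bound {s : ℂ} (hs : 0 < s.re) : ‖mellin frc (-s)‖ ≤ 1 / s.re := by
  rw [J_eq]
  have h1 : ∫ t in Ioi (1:ℝ), t ^ (-s.re - 1) = 1 / s.re := by
    rw [integral_Ioi_rpow_of_lt (by linarith) one_pos]
    simp
  rw [← h1]
  apply norm_integral_le_of_norm_le (integrableOn_Ioi_rpow_of_lt (by linarith) one_pos)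
  filter_upwards [ae_restrict_mem measurableSet_Ioi] with t ht
  have ht0 : (0:ℝ) < t := lt_trans one_pos ht
  rw [norm_mul, norm_cpow_eq_rpow_re_of_pos ht0, norm_real, Real.norm_eq_abs, abs_of_nonneg (Int.fract_nonneg t)]
  simp only [sub_re, neg_re, one_re]
  exact mul_le_of_le_one_right (by positivity) (Int.fract_lt_one t).le

lemma zeta_int {s : ℂ} (hs : 1 < s.re) :
    riemannZeta₁ s = s - s * (s - 1) * mellin frc (-s) := by
  have hs1 : s ≠ 1 := by rintro rfl; simp at hs
  have hs10 : s - 1 ≠ 0 := sub_ne_zero.mpr hs1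
  have h0 : riemannZeta₁ s = (s - 1) * riemannZeta s := by
    rw [riemannZeta_eq_inv_sub_mul hs1]; field_simp
  have h1 := LSeries_eq_mul_integral' (1 : ℕ → ℂ) (r := 1) zero_le_one hs (by
    simp only [Pi.one_apply, norm_one, Finset.sum_const, Nat.card_Icc, Real.rpow_one]
    simp only [add_tsub_cancel_right, nsmul_eq_mul, mul_one]
    exact isBigO_refl _ _)
  rw [LSeries_one_eq_riemannZeta hs] at h1
  have h2 : ∫ (t : ℝ) in Set.Ioi 1, (∑ k ∈ Finset.Icc 1 ⌊t⌋₊, (1 : ℕ → ℂ) k) * ↑t ^ (-(s + 1))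
     = 1 / (s - 1) - mellin frc (-s) := by
    have e1 : ∫ t in Ioi (1:ℝ), (t:ℂ) ^ (-s) = 1 / (s - 1) := by
      rw [integral_Ioi_cpow_of_lt (by simpa using hs) one_pos]
      have : -s + 1 ≠ 0 := by intro h; apply hs10; linear_combination -h
      simp
      field_simp
      ring
    rw [← e1, J_eq, ← integral_sub]
    · apply setIntegral_congr_fun measurableSet_Ioi
      intro t ht
      have ht0 : (0:ℝ) < t := lt_trans one_pos ht
      simp only [Pi.one_apply, Finset.sum_const, Nat.card_Icc, add_tsub_cancel_right, nsmul_eq_mul, mul_one]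
      have : ((⌊t⌋₊ : ℕ) : ℂ) = (t:ℂ) - ((Int.fract t : ℝ) : ℂ) := by
        rw [← ofReal_sub, Int.self_sub_fract, ← natCast_floor_eq_intCast_floor ht0.le]
        simp
      rw [this, show -(s+1) = -s - 1 by ring, cpow_sub _ _ (by exact_mod_cast ht0.ne'), cpow_one]
      have : (t:ℂ) ≠ 0 := by exact_mod_cast ht0.ne'
      field_simp
    · exact integrableOn_Ioi_cpow_of_lt (by simpa using hs) one_pos
    · have h3 : IntegrableOn (fun t : ℝ => (t:ℂ) ^ (-s - 1)) (Ioi 1) :=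
        integrableOn_Ioi_cpow_of_lt (by simp; linarith) one_pos
      apply h3.mul_bdd (c := 1)
      · exact (measurable_ofReal.comp measurable_fract).aestronglyMeasurable
      · filter_upwards with t
        rw [norm_real, Real.norm_eq_abs, abs_of_nonneg (Int.fract_nonneg t)]
        exact (Int.fract_lt_one t).le
  rw [h2] at h1
  rw [h0, h1]
  field_simp

lemma halfplane_open (a : ℝ) : IsOpen {s : ℂ | a < s.re} := isOpen_lt continuous_const continuous_re

lemma zeta_int' {s : ℂ} (hs : 0 < s.re) :
    riemannZeta₁ s = s - s * (s - 1) * mellin frc (-s) := by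
  have hU : IsOpen {s : ℂ | 0 < s.re} := halfplane_open 0
  have hA : AnalyticOnNhd ℂ riemannZeta₁ {s : ℂ | 0 < s.re} :=
    (differentiable_riemannZeta₁.differentiableOn).analyticOnNhd hU
  have hB : AnalyticOnNhd ℂ (fun s => s - s * (s - 1) * mellin frc (-s)) {s : ℂ | 0 < s.re} := by
    apply DifferentiableOn.analyticOnNhd _ hU
    intro s hs
    have h1 : DifferentiableAt ℂ (fun s => mellin frc (-s)) s := by
      have : DifferentiableAt ℂ (mellin frc) (-s) := J_diff (by simpa using hs)
      exact DifferentiableAt.comp (g := mellin frc) (f := fun s => -s) s this (by fun_prop)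
    apply DifferentiableAt.differentiableWithinAt
    fun_prop
  have hC : IsPreconnected {s : ℂ | 0 < s.re} := (convex_halfSpace_re_gt 0).isPreconnected
  have := hA.eqOn_of_preconnected_of_eventuallyEq hB hC (z₀ := 2) (by simp) (by
    filter_upwards [(halfplane_open 1).mem_nhds (show (2:ℂ) ∈ {s : ℂ | 1 < s.re} by simp)] with s hs
    exact zeta_int hs)
  exact this hs

lemma zeta1_bound {s : ℂ} (hs : 0 < s.re) : ‖riemannZeta₁ s‖ ≤ ‖s‖ + ‖s‖ * ‖s - 1‖ / s.re := by
  rw [zeta_int' hs]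
  refine (norm_sub_le _ _).trans ?_
  rw [norm_mul, norm_mul]
  have := J_bound hs
  have h2 : ‖s‖ * ‖s - 1‖ / s.re = ‖s‖ * ‖s - 1‖ * (1 / s.re) := by ring
  rw [h2]
  gcongr

end Cesaro
end

section

open Complex MeasureTheory Set Filter Topology Asymptotics

namespace Cesaro

/-- the (normalised) entire xi function -/
noncomputable def xi (s : ℂ) : ℂ := 1 + s * (s - 1) * completedRiemannZeta₀ s

lemma xi_diff : Differentiable ℂ xi := by
  have := differentiable_completedZeta₀
  unfold xi; fun_prop

lemma xi_one_sub (s : ℂ) : xi (1 - s) = xi s := by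
  unfold xi; rw [completedRiemannZeta₀_one_sub]; ring

lemma xi_one : xi 1 = 1 := by simp [xi]

lemma xi_deriv_one : deriv xi 1 = completedRiemannZeta₀ 1 := by
  have h := (differentiable_completedZeta₀ 1).hasDerivAt
  have h2 : HasDerivAt xi (0 + ((1 * (1 - 1) + 1 * 1) * completedRiemannZeta₀ 1 +
      1 * (1 - 1) * deriv completedRiemannZeta₀ 1)) 1 := by
    have ha : HasDerivAt (fun s : ℂ => s * (s - 1)) (1 * (1 - 1) + 1 * 1) 1 :=
      (hasDerivAt_id (1:ℂ)).mul ((hasDerivAt_id (1:ℂ)).sub_const 1)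
    exact (hasDerivAt_const (1:ℂ) (1:ℂ)).add (ha.mul h)
  rw [h2.deriv]; ring

lemma xi_eq {s : ℂ} (hs : 0 < s.re) : xi s = s * Gammaℝ s * riemannZeta₁ s := by
  rcases eq_or_ne s 1 with rfl | h1
  · simp [xi_one, Gammaℝ_one]
  have h0 : s ≠ 0 := by rintro rfl; simp at hs
  have hG := Gammaℝ_ne_zero_of_re_pos hs
  have h10 : s - 1 ≠ 0 := sub_ne_zero.mpr h1
  have h10' : 1 - s ≠ 0 := sub_ne_zero.mpr h1.symm
  have e : riemannZeta₁ s = (s - 1) * riemannZeta s := by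
    rw [riemannZeta_eq_inv_sub_mul h1]; field_simp
  rw [e, riemannZeta_def_of_ne_zero h0, completedRiemannZeta_eq, xi]
  field_simp
  ring

lemma zeta1_conj (s : ℂ) : riemannZeta₁ ((starRingEnd ℂ) s) = (starRingEnd ℂ) (riemannZeta₁ s) := by
  rcases eq_or_ne s 1 with rfl | h1
  · simp
  have e : ∀ s : ℂ, s ≠ 1 → riemannZeta₁ s = (s - 1) * riemannZeta s := by
    intro s h1
    have h10 : s - 1 ≠ 0 := sub_ne_zero.mpr h1
    rw [riemannZeta_eq_inv_sub_mul h1]; field_simp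
  have h2 : (starRingEnd ℂ) s ≠ 1 := by
    intro h; apply h1; rw [← conj_conj s, h]; simp
  rw [e _ h1, e _ h2, riemannZeta_conj]
  simp

lemma Gammaℝ_conj' (s : ℂ) : Gammaℝ ((starRingEnd ℂ) s) = (starRingEnd ℂ) (Gammaℝ s) := by
  rw [Gammaℝ_def, Gammaℝ_def, map_mul, ← Gamma_conj]
  have h2 : (starRingEnd ℂ) 2 = 2 := map_ofNat _ 2
  congr 1
  · rw [← conj_ofReal Real.pi, ← cpow_conj]
    · simp [h2]
    · rw [arg_ofReal_of_nonneg Real.pi_pos.le]; exact Real.pi_pos.ne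
  · simp [h2]

lemma xi_conj {s : ℂ} (hs : 0 < s.re) : xi ((starRingEnd ℂ) s) = (starRingEnd ℂ) (xi s) := by
  rw [xi_eq hs, xi_eq (by simpa using hs), zeta1_conj, Gammaℝ_conj']
  simp

lemma zeta1_ne_zero (RH : RiemannHypothesis) {s : ℂ} (hs : 1/2 < s.re) : riemannZeta₁ s ≠ 0 := by
  rcases eq_or_ne s 1 with rfl | h1
  · simp
  intro h
  have hz : riemannZeta s = 0 := by rw [riemannZeta_eq_inv_sub_mul h1, h, mul_zero]
  have := RH s hz (by
    rintro ⟨n, hn⟩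
    rw [hn] at hs
    have : (-2 * ((n:ℂ) + 1)).re = -2 * ((n:ℝ) + 1) := by simp
    rw [this] at hs
    have : (0:ℝ) ≤ n := n.cast_nonneg
    linarith) h1
  linarith

lemma xi_ne_zero (RH : RiemannHypothesis) {s : ℂ} (hs : 1/2 < s.re) : xi s ≠ 0 := by
  have h0 : 0 < s.re := by linarith
  rw [xi_eq h0]
  refine mul_ne_zero (mul_ne_zero ?_ (Gammaℝ_ne_zero_of_re_pos h0)) (zeta1_ne_zero RH hs)
  rintro rfl; simp at h0

end Cesaro
end

section

open Complex MeasureTheory Set Filter Topology Asymptotics Metric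

namespace Cesaro

lemma zeta_lower : ∃ D : ℝ, 1 ≤ D ∧ ∀ s : ℂ, 2 ≤ s.re → ‖(riemannZeta s)⁻¹‖ ≤ D := by
  set f : ℕ → ℂ := fun n => ((ArithmeticFunction.moebius n : ℤ) : ℂ) with hf
  have hsum : ∀ s : ℂ, 2 ≤ s.re → LSeriesSummable f s := fun s hs =>
    ArithmeticFunction.LSeriesSummable_moebius_iff.mpr (by linarith)
  refine ⟨max 1 (∑' n, ‖LSeries.term f 2 n‖), le_max_left _ _, fun s hs => ?_⟩
  have h1 : 1 < s.re := by linarith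
  have h := ArithmeticFunction.LSeries_zeta_mul_Lseries_moebius h1
  rw [ArithmeticFunction.LSeries_zeta_eq_riemannZeta h1] at h
  rw [inv_eq_of_mul_eq_one_right h]
  refine le_trans ?_ (le_max_right _ _)
  have hs2 := (hsum s hs).norm
  have h22 := (hsum 2 (by simp)).norm
  refine (norm_tsum_le_tsum_norm hs2).trans ?_
  exact hs2.tsum_le_tsum (fun n => LSeries.norm_term_le_of_re_le_re f (by simpa using hs) n) h22

/-- holomorphic logarithm on a ball, with Borel-Caratheodory -/
lemma log_lower {f : ℂ → ℂ} {c : ℂ} {R M : ℝ} (hR : 0 < R) (hM : 0 < M)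
    (hf : DifferentiableOn ℂ f (ball c R)) (h0 : ∀ z ∈ ball c R, f z ≠ 0)
    (hb : ∀ z ∈ ball c R, ‖f z‖ ≤ Real.exp M * ‖f c‖) {z : ℂ} (hz : z ∈ ball c R) :
    ‖(f z)⁻¹‖ ≤ ‖(f c)⁻¹‖ * Real.exp (2 * M * ‖z - c‖ / (R - ‖z - c‖)) := by
  have hd : DifferentiableOn ℂ (fun z => deriv f z / f z) (ball c R) :=
    ((hf.deriv isOpen_ball).div hf h0)
  obtain ⟨L, hLc, hL⟩ := hd.isExactOn_ball.with_val_at c 0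
  have hcm : c ∈ ball c R := mem_ball_self hR
  have hconst : ∀ z ∈ ball c R, f z * exp (-L z) = f c := by
    have hder : ∀ z ∈ ball c R, HasDerivAt (fun z => f z * exp (-L z)) 0 z := by
      intro z hz
      have h1 := (hf.differentiableAt (isOpen_ball.mem_nhds hz)).hasDerivAt
      have h2 := (hL z hz).neg.cexp
      convert! h1.mul h2 using 1
      have := h0 z hz
      field_simp
      simp
    intro z hz
    have := (convex_ball c R).is_const_of_fderivWithin_eq_zero (𝕜 := ℂ) (f := fun z => f z * exp (-L z))
      (fun z hz => (hder z hz).differentiableAt.differentiableWithinAt)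
      (fun z hz => by
        rw [fderivWithin_of_isOpen isOpen_ball hz]
        have := (hder z hz).hasFDerivAt.fderiv
        rw [this]; ext; simp) hz hcm
    simpa [hLc] using this
  have hf2 : ∀ z ∈ ball c R, f z = f c * exp (L z) := by
    intro z hz
    rw [← hconst z hz, mul_assoc, ← exp_add]; simp
  have hfc := h0 c hcm
  have hre : ∀ z ∈ ball c R, (L z).re ≤ M := by
    intro z hz
    have h1 := hb z hz
    rw [hf2 z hz, norm_mul, norm_exp, mul_comm] at h1
    have h2 := le_of_mul_le_mul_right h1 (norm_pos_iff.mpr hfc)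
    exact Real.exp_le_exp.mp h2
  have hB := borelCaratheodory_zero (f := fun w => L (c + w)) (M := M) (R := R) (z := z - c) hM
    (by
      intro w hw
      have hw' : c + w ∈ ball c R := by simpa using hw
      have := (hL _ hw').differentiableAt
      apply DifferentiableAt.differentiableWithinAt
      exact DifferentiableAt.comp w (g := L) (f := fun w => c + w) this (by fun_prop))
    (by
      intro w hw
      have hw' : c + w ∈ ball c R := by simpa using hw
      exact hre _ hw')
    hR (by simpa [dist_eq_norm] using hz) (by simpa using hLc)
  simp only [add_sub_cancel] at hB
  rw [hf2 z hz, mul_inv, norm_mul, ← exp_neg, norm_exp]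
  gcongr
  refine le_trans ?_ hB
  rw [neg_re]
  exact (neg_le_abs _).trans (abs_re_le_norm _)

lemma zeta1_inv_bound (RH : RiemannHypothesis) {h : ℝ} (h0 : 0 < h) :
    ∃ C : ℝ, 0 ≤ C ∧ ∀ s : ℂ, 1/2 + h ≤ s.re → ‖(riemannZeta₁ s)⁻¹‖ ≤ Real.exp (C * (1 + ‖s‖)) := by
  obtain ⟨D, hD1, hD⟩ := zeta_lower
  have hD0 : 0 < D := by linarith
  have hlogD : 0 ≤ Real.log D := Real.log_nonneg hD1
  have hfar : ∀ s : ℂ, 2 ≤ s.re → ‖(riemannZeta₁ s)⁻¹‖ ≤ D := by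
    intro s hs
    have hs1 : s ≠ 1 := by rintro rfl; norm_num at hs
    have hs10 : s - 1 ≠ 0 := sub_ne_zero.mpr hs1
    have e : riemannZeta₁ s = (s - 1) * riemannZeta s := by
      rw [riemannZeta_eq_inv_sub_mul hs1]; field_simp
    rw [e, mul_inv, norm_mul]
    have h1 : 1 ≤ ‖s - 1‖ := by
      have := re_le_norm (s - 1)
      simp at this; linarith
    have h2 : ‖(s - 1)⁻¹‖ ≤ 1 := by rw [norm_inv]; exact inv_le_one_of_one_le₀ h1
    calc _ ≤ 1 * D := mul_le_mul h2 (hD s hs) (norm_nonneg _) zero_le_one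
      _ = D := one_mul D
  -- constant
  set A := 8 + Real.log D with hA
  have hA8 : 8 ≤ A := by linarith
  refine ⟨Real.log D + 3 / h * (A + 4), by positivity, fun s hs => ?_⟩
  have hn := norm_nonneg s
  by_cases hs2 : 2 ≤ s.re
  · refine (hfar s hs2).trans ?_
    rw [← Real.log_le_iff_le_exp hD0]
    have : 0 ≤ 3 / h * (A + 4) := by positivity
    nlinarith
  push Not at hs2
  set c : ℂ := ⟨2, s.im⟩ with hc
  have hcn : ‖c‖ ≤ ‖s‖ + 2 := by
    have e : c = s + ((2 - s.re : ℝ) : ℂ) := by apply Complex.ext <;> simp [hc]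
    rw [e]
    refine (norm_add_le _ _).trans ?_
    rw [norm_real, Real.norm_eq_abs, abs_of_pos (by linarith)]
    linarith
  have hcs : ‖s - c‖ = 2 - s.re := by
    have e : s - c = ((s.re - 2 : ℝ) : ℂ) := by apply Complex.ext <;> simp [hc]
    rw [e, norm_real, Real.norm_eq_abs, abs_of_neg (by linarith)]; ring
  have hball : ∀ z ∈ ball c (3/2), 1/2 < z.re ∧ ‖z‖ ≤ ‖c‖ + 3/2 := by
    intro z hz
    rw [mem_ball, dist_eq_norm] at hz
    constructor
    · have h1 := (abs_re_le_norm (z - c)).trans_lt hz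
      rw [abs_lt] at h1
      simp [hc] at h1
      linarith [h1.1]
    · have : z = c + (z - c) := by ring
      calc ‖z‖ = ‖c + (z - c)‖ := by rw [← this]
        _ ≤ ‖c‖ + ‖z - c‖ := norm_add_le _ _
        _ ≤ _ := by linarith
  have hcD : ‖(riemannZeta₁ c)⁻¹‖ ≤ D := hfar c (by simp [hc])
  have hc0 : riemannZeta₁ c ≠ 0 := zeta1_ne_zero RH (by simp [hc]; norm_num)
  have hcl : 1 ≤ D * ‖riemannZeta₁ c‖ := by
    rw [norm_inv] at hcD
    have hp := norm_pos_iff.mpr hc0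
    calc (1:ℝ) = ‖riemannZeta₁ c‖⁻¹ * ‖riemannZeta₁ c‖ := by field_simp
      _ ≤ _ := by gcongr
  have hcn0 := norm_nonneg c
  have key := log_lower (f := riemannZeta₁) (c := c) (R := 3/2) (M := A + 2 * ‖c‖) (by norm_num)
    (by positivity) differentiable_riemannZeta₁.differentiableOn
    (fun z hz => zeta1_ne_zero RH (hball z hz).1)
    (by
      intro z hz
      obtain ⟨hz1, hz2⟩ := hball z hz
      have hb := zeta1_bound (s := z) (by linarith)
      have hzn := norm_nonneg z
      have h1 : ‖z - 1‖ ≤ ‖z‖ + 1 := (norm_sub_le _ _).trans (by simp)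
      have h2 : ‖z‖ * ‖z - 1‖ / z.re ≤ 2 * (‖z‖ * (‖z‖ + 1)) := by
        rw [div_le_iff₀ (by linarith)]
        have : ‖z‖ * ‖z - 1‖ ≤ ‖z‖ * (‖z‖ + 1) := by gcongr
        have h3 : 0 ≤ ‖z‖ * (‖z‖ + 1) := by positivity
        nlinarith
      have h3 : ‖riemannZeta₁ z‖ ≤ 2 * (1 + ‖z‖) * (1 + ‖z‖) := by nlinarith
      have h4 : (1 + ‖z‖) ≤ Real.exp ‖z‖ := by linarith [Real.add_one_le_exp ‖z‖]
      have h5 : (2:ℝ) ≤ Real.exp 1 := by linarith [Real.add_one_le_exp (1:ℝ)]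
      have h6 : ‖riemannZeta₁ z‖ ≤ Real.exp 1 * Real.exp ‖z‖ * Real.exp ‖z‖ := by
        refine h3.trans ?_
        gcongr
      rw [← Real.exp_add, ← Real.exp_add] at h6
      calc ‖riemannZeta₁ z‖ ≤ Real.exp (1 + ‖z‖ + ‖z‖) := h6
        _ ≤ Real.exp (8 + 2 * ‖c‖) := by apply Real.exp_le_exp.mpr; linarith
        _ ≤ Real.exp (8 + 2 * ‖c‖) * (D * ‖riemannZeta₁ c‖) := le_mul_of_one_le_right (Real.exp_pos _).le hcl
        _ = Real.exp (A + 2 * ‖c‖) * ‖riemannZeta₁ c‖ := by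
          rw [hA, show 8 + Real.log D + 2 * ‖c‖ = (8 + 2 * ‖c‖) + Real.log D by ring, Real.exp_add (8 + 2 * ‖c‖),
            Real.exp_log hD0]; ring)
    (z := s) (by rw [mem_ball, dist_eq_norm, hcs]; linarith)
  refine key.trans ?_
  have e1 : 2 * (A + 2 * ‖c‖) * ‖s - c‖ / (3/2 - ‖s - c‖) ≤ 3 / h * (A + 4) * (1 + ‖s‖) := by
    rw [hcs, div_le_iff₀ (by linarith)]
    have f1 : h ≤ 3/2 - (2 - s.re) := by linarith
    have f2 : A + 2 * ‖c‖ ≤ (A + 4) * (1 + ‖s‖) := by nlinarith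
    have f3 : 3 / h * (A + 4) * (1 + ‖s‖) * h ≤ 3 / h * (A + 4) * (1 + ‖s‖) * (3/2 - (2 - s.re)) := by gcongr
    have f4 : 3 / h * (A + 4) * (1 + ‖s‖) * h = 3 * ((A + 4) * (1 + ‖s‖)) := by field_simp
    have f5 : 2 * (A + 2 * ‖c‖) * (2 - s.re) ≤ 2 * (A + 2 * ‖c‖) * (3/2) := by
      gcongr; linarith
    linarith
  calc ‖(riemannZeta₁ c)⁻¹‖ * Real.exp (2 * (A + 2 * ‖c‖) * ‖s - c‖ / (3/2 - ‖s - c‖))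
      ≤ D * Real.exp (3 / h * (A + 4) * (1 + ‖s‖)) := by gcongr
    _ = Real.exp (Real.log D + 3 / h * (A + 4) * (1 + ‖s‖)) := by rw [Real.exp_add, Real.exp_log hD0]
    _ ≤ _ := by
      apply Real.exp_le_exp.mpr
      nlinarith

end Cesaro
end

section

open Complex MeasureTheory Set Filter Topology Asymptotics Metric

namespace Cesaro

lemma zeta_upper : ∃ D : ℝ, 1 ≤ D ∧ ∀ s : ℂ, 2 ≤ s.re → ‖riemannZeta s‖ ≤ D := by
  have hsum : ∀ s : ℂ, 2 ≤ s.re → LSeriesSummable 1 s := fun s hs =>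
    LSeriesSummable_one_iff.mpr (by linarith)
  refine ⟨max 1 (∑' n, ‖LSeries.term 1 2 n‖), le_max_left _ _, fun s hs => ?_⟩
  have h1 : 1 < s.re := by linarith
  rw [← LSeries_one_eq_riemannZeta h1]
  refine le_trans ?_ (le_max_right _ _)
  have hs2 := (hsum s hs).norm
  have h22 := (hsum 2 (by simp)).norm
  refine (norm_tsum_le_tsum_norm hs2).trans ?_
  exact hs2.tsum_le_tsum (fun n => LSeries.norm_term_le_of_re_le_re 1 (by simpa using hs) n) h22

lemma beta_bound {h : ℝ} (h0 : 0 < h) : ∃ C : ℝ, 0 ≤ C ∧ ∀ a : ℂ, 1/8 ≤ a.re →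
    ‖betaIntegral a h‖ ≤ C := by
  have hconv := (betaIntegral_convergent (u := ((1/8 : ℝ) : ℂ)) (v := (h:ℂ)) (by simp) (by simpa using h0)).norm
  refine ⟨∫ x in (0:ℝ)..1, ‖(x:ℂ) ^ (((1/8 : ℝ) : ℂ) - 1) * (1 - (x:ℂ)) ^ ((h:ℂ) - 1)‖, ?_, fun a ha => ?_⟩
  · exact intervalIntegral.integral_nonneg zero_le_one (fun _ _ => norm_nonneg _)
  · rw [betaIntegral]
    apply intervalIntegral.norm_integral_le_of_norm_le zero_le_one _ hconv
    filter_upwards with x hx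
    rw [norm_mul, norm_mul]
    apply mul_le_mul_of_nonneg_right _ (norm_nonneg _)
    rw [norm_cpow_eq_rpow_re_of_pos hx.1, norm_cpow_eq_rpow_re_of_pos hx.1]
    apply Real.rpow_le_rpow_of_exponent_ge hx.1 hx.2
    simp only [sub_re, ofReal_re, one_re]; linarith

lemma gammaR_ratio {h : ℝ} (h0 : 0 < h) (h1 : h < 1/4) : ∃ C : ℝ, 0 ≤ C ∧ ∀ s : ℂ, 1/2 ≤ s.re →
    ‖Gammaℝ (s - h) / Gammaℝ (s + h)‖ ≤ C := by
  obtain ⟨C, hC0, hC⟩ := beta_bound h0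
  refine ⟨Real.pi ^ h * (C / ‖Gamma h‖), by positivity, fun s hs => ?_⟩
  have hGh : Gamma h ≠ 0 := Gamma_ne_zero_of_re_pos (by simpa using h0)
  have hare : 1/8 ≤ ((s - h)/2).re := by
    have : ((s - h)/2).re = (s.re - h)/2 := by simp
    rw [this]; linarith
  have hb := Gamma_mul_Gamma_eq_betaIntegral (s := (s - h)/2) (t := h) (by linarith) (by simpa using h0)
  have e1 : (s - h)/2 + h = (s + h)/2 := by ring
  rw [e1] at hb
  have hG2 : Gamma ((s + h)/2) ≠ 0 := Gamma_ne_zero_of_re_pos (by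
    have : ((s + h)/2).re = (s.re + h)/2 := by simp
    rw [this]; linarith)
  have e2 : Gamma ((s - h)/2) / Gamma ((s + h)/2) = betaIntegral ((s - h)/2) h / Gamma h := by
    field_simp; linear_combination hb
  rw [Gammaℝ_def, Gammaℝ_def, mul_div_mul_comm, e2, norm_mul]
  have hpi : (Real.pi : ℂ) ≠ 0 := by exact_mod_cast Real.pi_ne_zero
  rw [← cpow_sub _ _ hpi, norm_cpow_eq_rpow_re_of_pos Real.pi_pos, norm_div]
  have e3 : (-(s - h)/2 - -(s + h)/2).re = h := by simp; ring
  rw [e3]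
  gcongr
  exact hC _ hare

lemma zeta1_exp {w : ℂ} (hw : 1/4 ≤ w.re) : ‖riemannZeta₁ w‖ ≤ Real.exp (2 + 2 * ‖w‖) := by
  have hb := zeta1_bound (s := w) (by linarith)
  have hzn := norm_nonneg w
  have h1 : ‖w - 1‖ ≤ ‖w‖ + 1 := (norm_sub_le _ _).trans (by simp)
  have h2 : ‖w‖ * ‖w - 1‖ / w.re ≤ 4 * (‖w‖ * (‖w‖ + 1)) := by
    rw [div_le_iff₀ (by linarith)]
    have : ‖w‖ * ‖w - 1‖ ≤ ‖w‖ * (‖w‖ + 1) := by gcongr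
    have h3 : 0 ≤ ‖w‖ * (‖w‖ + 1) := by positivity
    nlinarith
  have h3 : ‖riemannZeta₁ w‖ ≤ (2 * (1 + ‖w‖)) * (2 * (1 + ‖w‖)) := by nlinarith
  have h4 : (1 + ‖w‖) ≤ Real.exp ‖w‖ := by linarith [Real.add_one_le_exp ‖w‖]
  have h5 : (2:ℝ) ≤ Real.exp 1 := by linarith [Real.add_one_le_exp (1:ℝ)]
  have h6 : ‖riemannZeta₁ w‖ ≤ (Real.exp 1 * Real.exp ‖w‖) * (Real.exp 1 * Real.exp ‖w‖) := by
    refine h3.trans ?_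
    gcongr
  rw [← Real.exp_add, ← Real.exp_add] at h6
  refine h6.trans_eq ?_
  congr 1; ring

lemma xi_mono (RH : RiemannHypothesis) {h : ℝ} (h0 : 0 < h) (h1 : h < 1/4) {z : ℂ} (hz : 0 ≤ z.re) :
    ‖xi (1/2 + z - h)‖ ≤ ‖xi (1/2 + z + h)‖ := by
  set f : ℂ → ℂ := fun z => xi (1/2 + z - h) / xi (1/2 + z + h) with hf
  obtain ⟨C, hC0, hC⟩ := gammaR_ratio h0 h1
  obtain ⟨K, hK0, hK⟩ := zeta1_inv_bound RH h0
  have half : (1/2 : ℂ).re = 1/2 := by norm_num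
  have hne : ∀ z : ℂ, 0 ≤ z.re → xi (1/2 + z + h) ≠ 0 := by
    intro z hz
    apply xi_ne_zero RH
    simp only [add_re, ofReal_re, half]; linarith
  have hfb : ∀ z : ℂ, 0 ≤ z.re → ‖f z‖ ≤ C * (‖riemannZeta₁ (1/2 + z - h)‖ * ‖(riemannZeta₁ (1/2 + z + h))⁻¹‖) := by
    intro z hz
    have ea : (1/2 + z - h).re = 1/2 + z.re - h := by simp
    have eb : (1/2 + z + h).re = 1/2 + z.re + h := by simp
    have e1 : f z = ((1/2 + z - h)/(1/2 + z + h)) * (Gammaℝ (1/2 + z - h)/ Gammaℝ (1/2 + z + h)) *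
        (riemannZeta₁ (1/2 + z - h) * (riemannZeta₁ (1/2 + z + h))⁻¹) := by
      simp only [hf]
      rw [xi_eq (by rw [ea]; linarith), xi_eq (by rw [eb]; linarith)]
      simp only [div_eq_mul_inv, mul_inv]; ring
    rw [e1, norm_mul, norm_mul, norm_mul (riemannZeta₁ _)]
    apply mul_le_mul_of_nonneg_right _ (by positivity)
    have e2 : ‖(1/2 + z - h)/(1/2 + z + h)‖ ≤ 1 := by
      rw [norm_div]
      apply div_le_one_of_le₀ _ (norm_nonneg _)
      rw [← sq_le_sq₀ (norm_nonneg _) (norm_nonneg _), ← normSq_eq_norm_sq, ← normSq_eq_norm_sq,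
        normSq_apply, normSq_apply, ea, eb]
      simp only [add_im, sub_im, ofReal_im]
      nlinarith
    calc _ ≤ 1 * C := mul_le_mul e2 (hC (1/2 + z) (by simp [hz])) (norm_nonneg _) zero_le_one
      _ = C := one_mul C
  have hnorm : ∀ z : ℂ, ‖1/2 + z - h‖ ≤ ‖z‖ + 1 ∧ ‖1/2 + z + h‖ ≤ ‖z‖ + 1 := by
    intro z
    have a1 : ‖(h:ℂ)‖ = h := by rw [norm_real, Real.norm_eq_abs, abs_of_pos h0]
    have a2 : ‖(1/2:ℂ)‖ = 1/2 := by norm_num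
    constructor
    · calc _ ≤ ‖1/2 + z‖ + ‖(h:ℂ)‖ := norm_sub_le _ _
        _ ≤ ‖(1/2:ℂ)‖ + ‖z‖ + ‖(h:ℂ)‖ := by gcongr; exact norm_add_le _ _
        _ ≤ _ := by rw [a1, a2]; linarith
    · calc _ ≤ ‖1/2 + z‖ + ‖(h:ℂ)‖ := norm_add_le _ _
        _ ≤ ‖(1/2:ℂ)‖ + ‖z‖ + ‖(h:ℂ)‖ := by gcongr; exact norm_add_le _ _
        _ ≤ _ := by rw [a1, a2]; linarith
  have key : ‖f z‖ ≤ 1 := by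
    apply PhragmenLindelof.right_half_plane_of_bounded_on_real (f := f) _ _ _ _ hz
    · apply DifferentiableOn.diffContOnCl
      intro z hz
      rw [Complex.closure_setOfPred_lt_re] at hz
      apply DifferentiableAt.differentiableWithinAt
      have := xi_diff
      exact DifferentiableAt.div (by fun_prop) (by fun_prop) (hne z hz)
    · refine ⟨1, by norm_num, 2 + K, ?_⟩
      apply IsBigO.of_bound (C * Real.exp (4 + 2 * K))
      rw [eventually_inf_principal]
      filter_upwards with z hz
      have hz' : 0 ≤ z.re := le_of_lt hz
      refine (hfb z hz').trans ?_
      rw [Real.norm_eq_abs, Real.abs_exp, Real.rpow_one, mul_assoc, ← Real.exp_add]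
      gcongr
      calc _ ≤ Real.exp (2 + 2 * ‖1/2 + z - h‖) * Real.exp (K * (1 + ‖1/2 + z + h‖)) := by
            gcongr
            · apply zeta1_exp; simp only [sub_re, add_re, half, ofReal_re]; linarith
            · apply hK; simp only [add_re, half, ofReal_re]; linarith
        _ = Real.exp (2 + 2 * ‖1/2 + z - h‖ + K * (1 + ‖1/2 + z + h‖)) := by rw [← Real.exp_add]
        _ ≤ _ := by
          apply Real.exp_le_exp.mpr
          have := (hnorm z).1
          have h2 : K * (1 + ‖1/2 + z + h‖) ≤ K * (1 + (‖z‖ + 1)) := by gcongr; exact (hnorm z).2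
          linarith
    · obtain ⟨D1, hD1, hD⟩ := zeta_lower
      obtain ⟨E1, hE1, hE⟩ := zeta_upper
      refine ⟨C * (E1 * D1), ?_⟩
      rw [eventually_map]
      filter_upwards [eventually_ge_atTop (3:ℝ)] with x hx
      refine (hfb x (by simp; linarith)).trans ?_
      apply mul_le_mul_of_nonneg_left _ hC0
      set u : ℝ := 1/2 + x - h with hu
      set v : ℝ := 1/2 + x + h with hv
      have eu : (1/2 + (x:ℂ) - h) = (u:ℂ) := by simp [hu]
      have ev : (1/2 + (x:ℂ) + h) = (v:ℂ) := by simp [hv]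
      rw [eu, ev]
      have e : ∀ r : ℝ, 2 ≤ r → riemannZeta₁ r = ((r - 1 : ℝ):ℂ) * riemannZeta r := by
        intro r hr
        have h1 : (r:ℂ) ≠ 1 := by norm_cast; linarith
        have h10 : (r:ℂ) - 1 ≠ 0 := sub_ne_zero.mpr h1
        rw [riemannZeta_eq_inv_sub_mul h1]; push_cast; field_simp
      have hu2 : 2 ≤ u := by linarith
      have hv2 : 2 ≤ v := by linarith
      rw [e u hu2, e v hv2, mul_inv, norm_mul, norm_mul, norm_inv, norm_real, norm_real, Real.norm_eq_abs,
        Real.norm_eq_abs, abs_of_pos (by linarith), abs_of_pos (by linarith)]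
      have f1 := hE u (by simpa using hu2)
      have f2 := hD v (by simpa using hv2)
      have f3 : (u - 1) * (v - 1)⁻¹ ≤ 1 := by
        rw [← div_eq_mul_inv]; apply div_le_one_of_le₀ <;> linarith
      calc (u - 1) * ‖riemannZeta u‖ * ((v - 1)⁻¹ * ‖(riemannZeta v)⁻¹‖)
          = ((u - 1) * (v - 1)⁻¹) * (‖riemannZeta u‖ * ‖(riemannZeta v)⁻¹‖) := by ring
        _ ≤ 1 * (E1 * D1) := by gcongr
        _ = _ := one_mul _
    · intro y
      simp only [hf]
      rw [norm_div]
      apply div_le_one_of_le₀ _ (norm_nonneg _)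
      rw [← xi_one_sub]
      have : 1 - (1/2 + y * I - h) = (starRingEnd ℂ) (1/2 + y * I + h) := by
        apply Complex.ext
        · simp; ring
        · simp
      rw [this, xi_conj, norm_conj]
      simp; linarith
  simp only [hf, norm_div] at key
  rwa [div_le_one₀ (norm_pos_iff.mpr (hne z hz))] at key

lemma xi_re_nonneg (RH : RiemannHypothesis) {s : ℂ} (hs : 1/2 < s.re) : 0 ≤ (deriv xi s / xi s).re := by
  set φ : ℝ → ℝ := fun t => ‖xi (s + t)‖ ^ 2 with hφ
  have hd : HasDerivAt (fun t : ℝ => xi (s + t)) (deriv xi s) 0 := by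
    have h1 : HasDerivAt xi (deriv xi s) (s + ((0:ℝ):ℂ)) := by
      simpa using (xi_diff s).hasDerivAt
    have h2 : HasDerivAt (fun t : ℝ => s + (t:ℂ)) 1 0 := by
      simpa using (ofRealCLM.hasDerivAt (x := (0:ℝ))).const_add s
    have h3 := h1.scomp (0:ℝ) h2
    rw [one_smul] at h3
    exact h3
  have hd2 := hd.norm_sq
  simp only [ofReal_zero, add_zero] at hd2
  have hnn : 0 ≤ 2 * inner ℝ (xi s) (deriv xi s) := by
    have ht := hd2.tendsto_slope_zero_right
    apply ge_of_tendsto ht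
    have : ∀ᶠ t : ℝ in 𝓝[>] 0, t < 1/4 := mem_nhdsWithin_of_mem_nhds (Iio_mem_nhds (by norm_num))
    filter_upwards [this, self_mem_nhdsWithin] with t ht1 ht0
    have ht0' : 0 < t := ht0
    have := xi_mono RH (h := t/2) (by positivity) (by linarith) (z := s - 1/2 + t/2) (by
      have : (s - 1/2 + t/2).re = s.re - 1/2 + t/2 := by simp
      rw [this]; linarith)
    have e1 : 1/2 + (s - 1/2 + t/2) - ((t/2 : ℝ):ℂ) = s := by push_cast; ring
    have e2 : 1/2 + (s - 1/2 + t/2) + ((t/2 : ℝ):ℂ) = s + t := by push_cast; ring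
    rw [e1, e2] at this
    simp only [zero_add, smul_eq_mul, ofReal_zero, add_zero]
    apply mul_nonneg (by positivity)
    rw [sub_nonneg]
    gcongr
  rw [Complex.inner] at hnn
  have h0 := xi_ne_zero RH hs
  have e : deriv xi s / xi s = ((normSq (xi s))⁻¹ : ℝ) * (starRingEnd ℂ (xi s) * deriv xi s) := by
    rw [div_eq_mul_inv, inv_def]; push_cast; ring
  rw [e, re_ofReal_mul]
  apply mul_nonneg
  · exact inv_nonneg.mpr (normSq_nonneg _)
  · rw [mul_comm (starRingEnd ℂ _)]; linarith

end Cesaro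
end

section
namespace Cesaro
open Complex MeasureTheory Set Filter Topology Asymptotics Metric

lemma halfplane_bound {F : ℂ → ℂ} (hF : DifferentiableOn ℂ F {z | 0 < z.re})
    (hre : ∀ z : ℂ, 0 < z.re → 0 ≤ (F z).re) :
    ∃ C, 0 ≤ C ∧ ∀ z : ℂ, 0 < z.re → ‖F z‖ ≤ C * ‖z + 1‖ ^ 2 / z.re := by
  refine ⟨1 + ‖F 1‖, by positivity, fun z hz => ?_⟩
  have hz1 : z + 1 ≠ 0 := by
    intro h; have := congrArg re h; simp at this; linarith
  set m : ℂ → ℂ := fun w => (1 + w) / (1 - w) with hm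
  have hw1 : ∀ w ∈ ball (0:ℂ) 1, 1 - w ≠ 0 := by
    intro w hw h
    rw [mem_ball_zero_iff] at hw
    rw [← sub_eq_zero.mp h] at hw; simp at hw
  have hmre : ∀ w ∈ ball (0:ℂ) 1, 0 < (m w).re := by
    intro w hw
    have h1 := hw1 w hw
    rw [mem_ball_zero_iff] at hw
    have e : m w = ((normSq (1 - w))⁻¹ : ℝ) * ((1 + w) * (starRingEnd ℂ) (1 - w)) := by
      simp only [hm]; rw [div_eq_mul_inv, inv_def]; push_cast; ring
    rw [e, re_ofReal_mul]
    apply mul_pos (inv_pos.mpr (normSq_pos.mpr h1))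
    have h2 : w.re * w.re + w.im * w.im < 1 := by
      rw [← normSq_apply, normSq_eq_norm_sq]; nlinarith [norm_nonneg w]
    simp; nlinarith
  set w : ℂ := (z - 1) / (z + 1) with hw
  have hnz : ‖z - 1‖ ^ 2 = ‖z + 1‖ ^ 2 - 4 * z.re := by
    rw [← normSq_eq_norm_sq, ← normSq_eq_norm_sq, normSq_apply, normSq_apply]; simp; ring
  have hp : 0 < ‖z + 1‖ := norm_pos_iff.mpr hz1
  have hwn : ‖w‖ = ‖z - 1‖ / ‖z + 1‖ := norm_div _ _
  have hwlt : ‖w‖ < 1 := by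
    rw [hwn, div_lt_one hp]
    nlinarith [norm_nonneg (z - 1)]
  have hwb : w ∈ ball (0:ℂ) 1 := mem_ball_zero_iff.mpr hwlt
  have hmw : m w = z := by
    have := hw1 w hwb
    simp only [hm]; rw [div_eq_iff this, hw]; field_simp; ring
  have hB := Complex.borelCaratheodory (f := fun w => - F (m w)) (M := 1/2) (R := 1) (z := w) (by norm_num)
    (by
      apply DifferentiableOn.neg
      apply DifferentiableOn.comp hF (t := {z | 0 < z.re})
      · intro w hw
        apply DifferentiableAt.differentiableWithinAt
        exact DifferentiableAt.div (by fun_prop) (by fun_prop) (hw1 w hw)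
      · intro w hw; exact hmre w hw)
    (by
      intro w hw
      have := hre _ (hmre w hw)
      simp; linarith) (by norm_num) hwb
  have hm0 : m 0 = 1 := by simp [hm]
  simp only [norm_neg, hmw, hm0] at hB
  refine hB.trans ?_
  have h1w : 2 * z.re / ‖z + 1‖ ^ 2 ≤ 1 - ‖w‖ := by
    have : (1 - ‖w‖) * (1 + ‖w‖) = 4 * z.re / ‖z + 1‖ ^ 2 := by
      rw [hwn]; field_simp; linarith
    have h3 : 2 * (2 * z.re / ‖z + 1‖ ^ 2) ≤ (1 - ‖w‖) * 2 := by
      calc _ = 4 * z.re / ‖z + 1‖ ^ 2 := by ring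
        _ = (1 - ‖w‖) * (1 + ‖w‖) := this.symm
        _ ≤ (1 - ‖w‖) * 2 := by
          apply mul_le_mul_of_nonneg_left <;> linarith
    linarith
  have hpp : 0 < 2 * z.re / ‖z + 1‖ ^ 2 := by positivity
  calc _ = (‖w‖ + ‖F 1‖ * (1 + ‖w‖)) / (1 - ‖w‖) := by ring
    _ ≤ (1 + ‖F 1‖ * (1 + 1)) / (2 * z.re / ‖z + 1‖ ^ 2) := by gcongr
    _ = (1/2 + ‖F 1‖) * ‖z + 1‖ ^ 2 / z.re := by field_simp; ring
    _ ≤ _ := by gcongr; norm_num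

lemma pick_eps {F : ℂ → ℂ} (hF : DifferentiableOn ℂ F {z | 0 < z.re})
    (hre : ∀ z : ℂ, 0 < z.re → 0 ≤ (F z).re) (him : ∀ x : ℝ, 0 < x → (F x).im = 0)
    {ε : ℝ} (hε : 0 < ε) {z : ℂ} (hz : 0 ≤ z.re) (hz2 : z ≠ 1/2) :
    0 ≤ ((2 * F (1/2 + ε) * z - F (z + ε)) / (z ^ 2 - 1/4)).re := by
  obtain ⟨C, hC0, hC⟩ := halfplane_bound hF hre
  set c : ℂ := 2 * F (1/2 + ε) with hc
  have hcim : c.im = 0 := by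
    have := him (1/2 + ε) (by positivity)
    push_cast at this
    rw [hc, mul_im, this]; simp
  set N : ℂ → ℂ := fun z => c * z - F (z + ε) with hN
  set U : Set ℂ := {z | -ε < z.re} with hU
  have hUo : IsOpen U := halfplane_open (-ε)
  have hNd : DifferentiableOn ℂ N U := by
    apply DifferentiableOn.sub (by fun_prop)
    apply DifferentiableOn.comp hF (t := {z | 0 < z.re}) (by fun_prop)
    intro z hz
    have : -ε < z.re := hz
    change 0 < (z + ε).re
    simp; linarith
  have hhalf : (1/2:ℂ) ∈ U := by
    change -ε < (1/2:ℂ).re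
    have : (1/2:ℂ).re = 1/2 := by norm_num
    rw [this]; linarith
  have hDd : DifferentiableOn ℂ (dslope N (1/2)) U :=
    (differentiableOn_dslope (hUo.mem_nhds hhalf)).mpr hNd
  have hN0 : N (1/2) = 0 := by simp only [hN, hc]; ring
  have hne : ∀ z : ℂ, 0 ≤ z.re → z + 1/2 ≠ 0 := by
    intro z hz h; have := congrArg re h; norm_num at this; linarith
  set G : ℂ → ℂ := fun z => dslope N (1/2) z / (z + 1/2) with hG
  have hGe : ∀ z : ℂ, 0 ≤ z.re → z ≠ 1/2 → G z = N z / (z ^ 2 - 1/4) := by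
    intro z hz hz2
    simp only [hG]
    have h1 := sub_ne_zero.mpr hz2
    rw [dslope_of_ne _ hz2, slope_def_field, hN0, sub_zero, div_div]
    congr 1; ring
  have hGd : ∀ z : ℂ, 0 ≤ z.re → DifferentiableAt ℂ G z := by
    intro z hz
    refine DifferentiableAt.div (c := dslope N (1/2)) (d := fun z => z + 1/2) ?_ (by fun_prop) (hne z hz)
    exact hDd.differentiableAt (hUo.mem_nhds (by change -ε < z.re; linarith))
  have hGb : ∃ M, ∀ z : ℂ, 0 ≤ z.re → 2 ≤ ‖z‖ → ‖G z‖ ≤ M := by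
    refine ⟨2 * (‖c‖ + C * (2 + ε) ^ 2 / ε), fun z hz hz2 => ?_⟩
    have hzn : z ≠ 1/2 := by rintro rfl; norm_num at hz2
    rw [hGe z hz hzn, norm_div]
    have h1 : ‖z‖ ^ 2 / 2 ≤ ‖z ^ 2 - 1/4‖ := by
      have := norm_sub_norm_le (z ^ 2) (1/4)
      rw [norm_pow] at this
      have h14 : ‖(1/4:ℂ)‖ = 1/4 := by norm_num
      rw [h14] at this
      nlinarith
    have h2 : ‖N z‖ ≤ (‖c‖ + C * (2 + ε) ^ 2 / ε) * ‖z‖ ^ 2 := by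
      have hzr : 0 < (z + ε).re := by simp; linarith
      have h3 := hC (z + ε) hzr
      have h4 : ‖z + ε + 1‖ ≤ (2 + ε) * ‖z‖ := by
        calc _ ≤ ‖z‖ + ‖(ε:ℂ)‖ + ‖(1:ℂ)‖ := norm_add₃_le
          _ = ‖z‖ + ε + 1 := by rw [norm_real, Real.norm_of_nonneg hε.le]; simp
          _ ≤ _ := by nlinarith
      have h5 : ε ≤ (z + ε).re := by simp; linarith
      calc ‖N z‖ ≤ ‖c * z‖ + ‖F (z + ε)‖ := norm_sub_le _ _
        _ ≤ ‖c‖ * ‖z‖ + C * ((2 + ε) * ‖z‖) ^ 2 / ε := by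
          rw [norm_mul]
          gcongr
          refine h3.trans ?_
          gcongr
        _ ≤ ‖c‖ * ‖z‖ ^ 2 + C * ((2 + ε) * ‖z‖) ^ 2 / ε := by
          gcongr; nlinarith
        _ = _ := by ring
    have hzp : 0 < ‖z‖ := by linarith
    calc ‖N z‖ / ‖z ^ 2 - 1/4‖ ≤ ((‖c‖ + C * (2 + ε) ^ 2 / ε) * ‖z‖ ^ 2) / (‖z‖ ^ 2 / 2) := by gcongr
      _ = _ := by field_simp
  obtain ⟨M, hM⟩ := hGb
  have key : ‖cexp (- G z)‖ ≤ 1 := by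
    apply PhragmenLindelof.right_half_plane_of_bounded_on_real (f := fun z => cexp (- G z)) _ _ _ _ hz
    · apply DifferentiableOn.diffContOnCl
      intro z hz
      rw [Complex.closure_setOfPred_lt_re] at hz
      exact (hGd z hz).neg.cexp.differentiableWithinAt
    · refine ⟨1, by norm_num, 0, ?_⟩
      apply IsBigO.of_bound (Real.exp M)
      rw [eventually_inf_principal]
      have := tendsto_norm_cobounded_atTop (E := ℂ)
      filter_upwards [this.eventually_ge_atTop 2] with z hz2 hz
      have hz : 0 < z.re := hz
      have := hM z hz.le hz2
      rw [norm_exp]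
      simp only [zero_mul, Real.exp_zero, norm_one, mul_one]
      apply Real.exp_le_exp.mpr
      exact (re_le_norm _).trans (by rwa [norm_neg])
    · refine ⟨Real.exp M, ?_⟩
      rw [eventually_map]
      filter_upwards [eventually_ge_atTop (2:ℝ)] with x hx
      have := hM x (by simp; linarith) (by rw [norm_real]; exact hx.trans (Real.le_norm_self x))
      rw [norm_exp]
      apply Real.exp_le_exp.mpr
      exact (re_le_norm _).trans (by rwa [norm_neg])
    · intro y
      rw [norm_exp, Real.exp_le_one_iff, neg_re, neg_nonpos]
      rw [hGe _ (by simp) (by intro h; have := congrArg re h; norm_num at this)]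
      have e : ((y:ℂ) * I) ^ 2 - 1/4 = ((-(y ^ 2 + 1/4) : ℝ) : ℂ) := by
        rw [mul_pow, I_sq]; push_cast; ring
      rw [e, div_ofReal_re]
      apply div_nonneg_of_nonpos
      · have := hre (y * I + ε) (by simpa using hε)
        simp only [hN, sub_re, mul_re, hcim, ofReal_re, ofReal_im, I_re, I_im]
        simp only [mul_im, ofReal_re, ofReal_im, I_re, I_im]
        linarith
      · nlinarith
  rw [norm_exp, Real.exp_le_one_iff, neg_re, neg_nonpos, hGe z hz hz2] at key
  exact key

/-- the Pick-type transform -/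
noncomputable def pickG (F : ℂ → ℂ) (z : ℂ) : ℂ :=
  dslope (fun z => 2 * F (1/2) * z - F z) (1/2) z / (z + 1/2)

lemma pickG_eq {F : ℂ → ℂ} {z : ℂ} (hz2 : z ≠ 1/2) :
    pickG F z = (2 * F (1/2) * z - F z) / (z ^ 2 - 1/4) := by
  rw [pickG, dslope_of_ne _ hz2, slope_def_field, div_div]
  congr 1 <;> ring

lemma pickG_diff {F : ℂ → ℂ} (hF : DifferentiableOn ℂ F {z | 0 < z.re}) :
    DifferentiableOn ℂ (pickG F) {z | 0 < z.re} := by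
  apply DifferentiableOn.div
  · rw [differentiableOn_dslope]
    · apply DifferentiableOn.sub (by fun_prop) hF
    · apply (halfplane_open 0).mem_nhds; change 0 < (1/2:ℂ).re; norm_num
  · fun_prop
  · intro z hz h
    have hz : 0 < z.re := hz
    have := congrArg re h; norm_num at this; linarith

lemma pickG_re {F : ℂ → ℂ} (hF : DifferentiableOn ℂ F {z | 0 < z.re})
    (hre : ∀ z : ℂ, 0 < z.re → 0 ≤ (F z).re) (him : ∀ x : ℝ, 0 < x → (F x).im = 0)
    {z : ℂ} (hz : 0 < z.re) : 0 ≤ (pickG F z).re := by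
  have hne : ∀ z : ℂ, 0 < z.re → z ≠ 1/2 → 0 ≤ (pickG F z).re := by
    intro z hz hz2
    rw [pickG_eq hz2]
    have hcz : ∀ w : ℂ, 0 < w.re → Tendsto (fun ε : ℝ => F (w + ε)) (𝓝[>] 0) (𝓝 (F w)) := by
      intro w hw
      have h1 : ContinuousAt F w := (hF.differentiableAt ((halfplane_open 0).mem_nhds hw)).continuousAt
      have h2 : Tendsto (fun ε : ℝ => w + (ε:ℂ)) (𝓝[>] 0) (𝓝 w) := by
        apply Tendsto.mono_left _ nhdsWithin_le_nhds
        exact Continuous.tendsto' (by fun_prop) _ _ (by simp)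
      exact h1.tendsto.comp h2
    have ht : Tendsto (fun ε : ℝ => ((2 * F (1/2 + ε) * z - F (z + ε)) / (z ^ 2 - 1/4)).re) (𝓝[>] 0)
        (𝓝 ((2 * F (1/2) * z - F z) / (z ^ 2 - 1/4)).re) := by
      apply (continuous_re.tendsto _).comp
      apply Tendsto.div_const
      exact (((hcz (1/2) (by norm_num)).const_mul 2).mul_const z).sub (hcz z hz)
    apply ge_of_tendsto ht
    filter_upwards [self_mem_nhdsWithin] with ε hε
    exact pick_eps hF hre him hε hz.le hz2
  by_cases hz2 : z = 1/2
  · have hc : ContinuousAt (pickG F) z :=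
      ((pickG_diff hF).differentiableAt ((halfplane_open 0).mem_nhds hz)).continuousAt
    have ht : Tendsto (fun w => (pickG F w).re) (𝓝[≠] z) (𝓝 (pickG F z).re) :=
      ((continuous_re.tendsto _).comp hc.tendsto).mono_left nhdsWithin_le_nhds
    apply ge_of_tendsto ht
    filter_upwards [self_mem_nhdsWithin, mem_nhdsWithin_of_mem_nhds ((halfplane_open 0).mem_nhds hz)] with w hw hw2
    exact hne w hw2 (by rw [← hz2]; exact hw)
  · exact hne z hz hz2

end Cesaro
end

section
namespace Cesaro
open Complex MeasureTheory Set Filter Topology Asymptotics Metric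

/-- iterated divided differences -/
noncomputable def dsl (a : ℂ) (n : ℕ) (G : ℂ → ℂ) : ℂ → ℂ := (Function.swap dslope a)^[n] G

lemma dsl_succ (a : ℂ) (n : ℕ) (G : ℂ → ℂ) : dsl a (n + 1) G = dslope (dsl a n G) a := by
  simp only [dsl, Function.iterate_succ_apply']

lemma dsl_taylor (a : ℂ) (G : ℂ → ℂ) (n : ℕ) (z : ℂ) :
    G z = ∑ k ∈ Finset.range n, (z - a) ^ k * dsl a k G a + (z - a) ^ n * dsl a n G z := by
  induction n with
  | zero => simp [dsl]
  | succ n ih =>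
    rw [Finset.sum_range_succ, dsl_succ]
    have h := sub_smul_dslope (dsl a n G) a z
    rw [smul_eq_mul] at h
    rw [pow_succ, mul_assoc, h]
    rw [ih]; ring

lemma dsl_diff {a : ℂ} (ha : 0 < a.re) {G : ℂ → ℂ} (hG : DifferentiableOn ℂ G {z | 0 < z.re}) (n : ℕ) :
    DifferentiableOn ℂ (dsl a n G) {z | 0 < z.re} := by
  induction n with
  | zero => simpa [dsl] using hG
  | succ n ih =>
    rw [dsl_succ, differentiableOn_dslope ((halfplane_open 0).mem_nhds ha)]
    exact ih

lemma norm_avg_le {f : ℂ → ℂ} {g : ℂ → ℝ} {r : ℝ} (hr : 0 ≤ r) (hg : CircleIntegrable g 0 r)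
    (h : ∀ w ∈ sphere (0:ℂ) r, ‖f w‖ ≤ g w) : ‖Real.circleAverage f 0 r‖ ≤ Real.circleAverage g 0 r := by
  rw [Real.circleAverage_def, Real.circleAverage_def, norm_smul, smul_eq_mul, Real.norm_of_nonneg (by positivity)]
  gcongr
  apply intervalIntegral.norm_integral_le_of_norm_le (by positivity) _ hg
  filter_upwards with t _
  exact h _ (circleMap_mem_sphere _ hr _)

lemma sphere_inv {r : ℝ} (hr : 0 < r) {w : ℂ} (hw : w ∈ sphere (0:ℂ) r) :
    w⁻¹ = (starRingEnd ℂ) (w / r ^ 2) := by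
  have h : ‖w‖ = r := by simpa using hw
  rw [inv_def, normSq_eq_norm_sq, h]
  simp [div_eq_mul_inv]

lemma conj_avg {r : ℝ} (hr : 0 < r) (hr1 : r < 1) {f : ℂ → ℂ} (hf : DifferentiableOn ℂ f (ball 0 1)) (j : ℕ) :
    Real.circleAverage (fun w => (starRingEnd ℂ) (f w) * (w⁻¹ * (w⁻¹ - 1) ^ j)) 0 r = 0 := by
  set p : ℂ → ℂ := fun w => f w * ((w / r ^ 2) * (w / r ^ 2 - 1) ^ j) with hp
  have hpd : DifferentiableOn ℂ p (ball 0 1) := hf.mul (by fun_prop)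
  have hsub : closedBall (0:ℂ) r ⊆ ball 0 1 := closedBall_subset_ball hr1
  have e : Real.circleAverage (fun w => (starRingEnd ℂ) (f w) * (w⁻¹ * (w⁻¹ - 1) ^ j)) 0 r
      = Real.circleAverage (fun w => (conjCLE : ℂ →L[ℝ] ℂ) (p w)) 0 r := by
    apply Real.circleAverage_congr_sphere
    intro w hw
    rw [abs_of_pos hr] at hw
    simp only [sphere_inv hr hw, hp]
    simp
  rw [e]
  have hc : CircleIntegrable p 0 r := by
    apply ContinuousOn.circleIntegrable hr.le
    exact hpd.continuousOn.mono (sphere_subset_closedBall.trans hsub)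
  have := ContinuousLinearMap.circleAverage_comp_comm (conjCLE : ℂ →L[ℝ] ℂ) hc
  change Real.circleAverage ((conjCLE : ℂ →L[ℝ] ℂ) ∘ p) 0 r = 0
  rw [this, DiffContOnCl.circleAverage]
  · simp [hp]
  · rw [abs_of_pos hr]
    apply DifferentiableOn.diffContOnCl
    rw [closure_ball _ hr.ne']
    exact hpd.mono hsub

lemma pick_coeff_r {G : ℂ → ℂ} (hG : DifferentiableOn ℂ G {z | 0 < z.re})
    (hre : ∀ z : ℂ, 0 < z.re → 0 ≤ (G z).re) {a : ℝ} (ha : 0 < a) (m : ℕ) {r : ℝ} (hr : 0 < r) (hr1 : r < 1) :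
    (2 * a) ^ (m + 1) * ‖dsl a (m + 1) G a‖ ≤ 2 * (G a).re * (r⁻¹ * (r⁻¹ + 1) ^ m) := by
  have ha' : 0 < (a:ℂ).re := by simpa using ha
  set Z : ℂ → ℂ := fun w => a * (1 + w) / (1 - w) with hZ
  have hw1 : ∀ w ∈ ball (0:ℂ) 1, 1 - w ≠ 0 := by
    intro w hw h
    rw [mem_ball_zero_iff] at hw
    rw [← sub_eq_zero.mp h] at hw; simp at hw
  have hZre : ∀ w ∈ ball (0:ℂ) 1, 0 < (Z w).re := by
    intro w hw
    have h1 := hw1 w hw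
    rw [mem_ball_zero_iff] at hw
    have e : Z w = ((a * (normSq (1 - w))⁻¹ : ℝ)) * ((1 + w) * (starRingEnd ℂ) (1 - w)) := by
      simp only [hZ]; rw [div_eq_mul_inv, inv_def]; push_cast; ring
    rw [e, re_ofReal_mul]
    apply mul_pos (mul_pos ha (inv_pos.mpr (normSq_pos.mpr h1)))
    have h2 : w.re * w.re + w.im * w.im < 1 := by
      rw [← normSq_apply, normSq_eq_norm_sq]; nlinarith [norm_nonneg w]
    simp; nlinarith
  have hZd : DifferentiableOn ℂ Z (ball 0 1) := by
    intro w hw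
    apply DifferentiableAt.differentiableWithinAt
    exact DifferentiableAt.div (by fun_prop) (by fun_prop) (hw1 w hw)
  have hZm : MapsTo Z (ball 0 1) {z | 0 < z.re} := fun w hw => hZre w hw
  have hZ0 : Z 0 = a := by simp [hZ]
  set H : ℂ → ℂ := fun w => G (Z w) with hH
  have hHd : DifferentiableOn ℂ H (ball 0 1) := hG.comp hZd hZm
  set E : ℂ → ℂ := fun w => (2 * a) ^ (m + 1) * ((1 - w)⁻¹ * dsl a (m + 1) G (Z w)) with hE
  have hEd : DifferentiableOn ℂ E (ball 0 1) := by
    apply DifferentiableOn.const_mul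
    apply DifferentiableOn.mul
    · apply DifferentiableOn.inv (by fun_prop) hw1
    · exact (dsl_diff ha' hG _).comp hZd hZm
  have hsub : closedBall (0:ℂ) r ⊆ ball 0 1 := closedBall_subset_ball hr1
  have hsub' : sphere (0:ℂ) r ⊆ ball 0 1 := sphere_subset_closedBall.trans hsub
  have hs0 : ∀ w ∈ sphere (0:ℂ) r, w ≠ 0 := by
    intro w hw h; rw [h] at hw; simp at hw; linarith
  have hmv : ∀ f : ℂ → ℂ, DifferentiableOn ℂ f (ball 0 1) → Real.circleAverage f 0 r = f 0 := by
    intro f hf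
    apply DiffContOnCl.circleAverage
    rw [abs_of_pos hr]
    apply DifferentiableOn.diffContOnCl
    rw [closure_ball _ hr.ne']
    exact hf.mono hsub
  have hKc : ∀ j : ℕ, ContinuousOn (fun w : ℂ => w⁻¹ * (w⁻¹ - 1) ^ j) (sphere 0 r) := by
    intro j
    have : ContinuousOn (fun w : ℂ => w⁻¹) (sphere 0 r) := continuousOn_id.inv₀ hs0
    fun_prop
  have hHc : ContinuousOn H (sphere 0 r) := hHd.continuousOn.mono hsub'
  have hEc : ContinuousOn E (sphere 0 r) := hEd.continuousOn.mono hsub'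
  have hkey : Real.circleAverage (fun w => H w * (w⁻¹ * (w⁻¹ - 1) ^ m)) 0 r = E 0 := by
    have e1 : Real.circleAverage (fun w => H w * (w⁻¹ * (w⁻¹ - 1) ^ m)) 0 r
      = Real.circleAverage (fun w => ∑ k ∈ Finset.range (m + 1),
          (((2 * a) ^ k * dsl a k G a) • (w⁻¹ * (w⁻¹ - 1) ^ (m - k))) + E w) 0 r := by
      apply Real.circleAverage_congr_sphere
      intro w hw
      rw [abs_of_pos hr] at hw
      have h0 := hs0 w hw
      have h1 := hw1 w (hsub' hw)
      have hd : Z w - a = 2 * a * (w⁻¹ - 1)⁻¹ := by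
        have : w⁻¹ - 1 = (1 - w) / w := by field_simp
        rw [this]
        simp only [hZ]; field_simp; ring
      have hne : w⁻¹ - 1 ≠ 0 := by
        have : w⁻¹ - 1 = (1 - w) / w := by field_simp
        rw [this]; exact div_ne_zero h1 h0
      simp only [hH]
      rw [dsl_taylor a G (m + 1) (Z w), add_mul, Finset.sum_mul]
      congr 1
      · apply Finset.sum_congr rfl
        intro k hk
        have hk' : k ≤ m := by simpa [Nat.lt_succ_iff] using hk
        rw [hd, smul_eq_mul]
        obtain ⟨j, rfl⟩ := Nat.exists_eq_add_of_le hk'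
        rw [Nat.add_sub_cancel_left, mul_pow, pow_add, inv_pow]
        field_simp
      · simp only [hE]
        rw [hd, mul_pow, pow_succ (w⁻¹ - 1)⁻¹, inv_pow]
        have : w⁻¹ * (w⁻¹ - 1)⁻¹ = (1 - w)⁻¹ := by
          rw [← mul_inv]; congr 1; field_simp
        rw [← this]; field_simp
    rw [e1, Real.circleAverage_fun_add, hmv E hEd, Real.circleAverage_fun_sum]
    · rw [Finset.sum_eq_zero, zero_add]
      intro k _
      have h2 := conj_avg hr hr1 (f := fun _ => 1) (by fun_prop) (m - k)
      simp only [map_one, one_mul] at h2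
      simp only [smul_eq_mul]
      have h3 := Real.circleAverage_fun_smul (a := ((2 * (a:ℂ)) ^ k * dsl a k G a)) (c := 0) (R := r)
        (f := fun w : ℂ => (w⁻¹ * (w⁻¹ - 1) ^ (m - k)))
      simp only [smul_eq_mul] at h3
      rw [h3, h2, mul_zero]
    · intro k _
      apply ContinuousOn.circleIntegrable hr.le
      exact (hKc (m - k)).const_smul ((2 * (a:ℂ)) ^ k * dsl a k G a)
    · apply ContinuousOn.circleIntegrable hr.le
      apply continuousOn_finsetSum
      intro k _
      exact (hKc (m - k)).const_smul ((2 * (a:ℂ)) ^ k * dsl a k G a)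
    · exact hEc.circleIntegrable hr.le
  have hconj := conj_avg hr hr1 hHd m
  have hHc' : ContinuousOn (fun w => (starRingEnd ℂ) (H w)) (sphere 0 r) := continuous_conj.comp_continuousOn hHc
  have hsum : Real.circleAverage (fun w => H w * (w⁻¹ * (w⁻¹ - 1) ^ m) +
      (starRingEnd ℂ) (H w) * (w⁻¹ * (w⁻¹ - 1) ^ m)) 0 r = E 0 := by
    rw [Real.circleAverage_fun_add, hkey, hconj, add_zero]
    · exact (hHc.mul (hKc m)).circleIntegrable hr.le
    · exact (hHc'.mul (hKc m)).circleIntegrable hr.le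
  have hE0 : ‖E 0‖ = (2 * a) ^ (m + 1) * ‖dsl a (m + 1) G a‖ := by
    simp only [hE, hZ0]
    simp [abs_of_pos ha]
  rw [← hE0, ← hsum]
  set M : ℝ := r⁻¹ * (r⁻¹ + 1) ^ m with hM
  have hrec : ContinuousOn (fun w => (H w).re) (sphere 0 r) := continuous_re.comp_continuousOn hHc
  have hle := norm_avg_le (f := fun w => H w * (w⁻¹ * (w⁻¹ - 1) ^ m) +
      (starRingEnd ℂ) (H w) * (w⁻¹ * (w⁻¹ - 1) ^ m)) (g := fun w => (2 * M) • (H w).re) hr.le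
      ((hrec.const_smul (2 * M)).circleIntegrable hr.le) (by
    intro w hw
    have hn : ‖w‖ = r := by simpa using hw
    rw [← add_mul, add_conj, norm_mul, norm_real, Real.norm_of_nonneg (by have := hre _ (hZre w (hsub' hw)); positivity)]
    have : ‖w⁻¹ * (w⁻¹ - 1) ^ m‖ ≤ M := by
      rw [norm_mul, norm_pow, norm_inv, hn, hM]
      gcongr
      calc _ ≤ ‖w⁻¹‖ + ‖(1:ℂ)‖ := norm_sub_le _ _
        _ = _ := by rw [norm_inv, hn]; simp
    have h2 : 0 ≤ (H w).re := hre _ (hZre w (hsub' hw))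
    calc _ ≤ 2 * (H w).re * M := by gcongr
      _ = _ := by rw [smul_eq_mul]; ring)
  refine hle.trans (le_of_eq ?_)
  rw [Real.circleAverage_fun_smul]
  have h5 := ContinuousLinearMap.circleAverage_comp_comm (reCLM) (hHc.circleIntegrable hr.le)
  have h6 : Real.circleAverage (fun w => (H w).re) 0 r = (G a).re := by
    change Real.circleAverage (reCLM ∘ H) 0 r = _
    rw [h5, hmv H hHd]; simp [hH, hZ0]
  rw [h6, smul_eq_mul]; ring

lemma pick_coeff {G : ℂ → ℂ} (hG : DifferentiableOn ℂ G {z | 0 < z.re})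
    (hre : ∀ z : ℂ, 0 < z.re → 0 ≤ (G z).re) {a : ℝ} (ha : 0 < a) (m : ℕ) :
    a ^ (m + 1) * ‖dsl a (m + 1) G a‖ ≤ (G a).re := by
  have ht : Tendsto (fun r : ℝ => 2 * (G a).re * (r⁻¹ * (r⁻¹ + 1) ^ m)) (𝓝[<] 1)
      (𝓝 (2 * (G a).re * ((1:ℝ)⁻¹ * ((1:ℝ)⁻¹ + 1) ^ m))) := by
    apply Tendsto.mono_left _ nhdsWithin_le_nhds
    have : ContinuousAt (fun r : ℝ => r⁻¹) 1 := continuousAt_inv₀ one_ne_zero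
    have h2 : ContinuousAt (fun r : ℝ => 2 * (G a).re * (r⁻¹ * (r⁻¹ + 1) ^ m)) 1 := by fun_prop
    exact h2.tendsto
  have h := ge_of_tendsto ht (b := (2 * a) ^ (m + 1) * ‖dsl a (m + 1) G a‖) (by
    filter_upwards [self_mem_nhdsWithin, mem_nhdsWithin_of_mem_nhds (Ioi_mem_nhds (zero_lt_one))] with r hr1 hr
    exact pick_coeff_r hG hre ha m hr hr1)
  have e : 2 * (G a).re * ((1:ℝ)⁻¹ * ((1:ℝ)⁻¹ + 1) ^ m) = 2 ^ (m + 1) * (G a).re := by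
    norm_num; ring
  rw [e, mul_pow, mul_assoc] at h
  exact le_of_mul_le_mul_left h (by positivity)

end Cesaro
end

section
namespace Cesaro
open Complex MeasureTheory Set Filter Topology Asymptotics Metric

lemma moment {n : ℕ} {a : ℝ} (ha : 0 < a) :
    ∫ t in Ioi (0:ℝ), t ^ n * Real.exp (-a * t) = n.factorial / a ^ (n + 1) := by
  have h := Real.integral_rpow_mul_exp_neg_mul_Ioi (a := n + 1) (r := a) (by positivity) ha
  rw [Real.Gamma_nat_eq_factorial] at h
  rw [show ((n:ℝ) + 1) = ((n + 1 : ℕ) : ℝ) by push_cast; ring, Real.rpow_natCast] at h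
  rw [show (n.factorial : ℝ) / a ^ (n + 1) = (1 / a) ^ (n + 1) * n.factorial by
    rw [div_pow, one_pow]; ring, ← h]
  apply setIntegral_congr_fun measurableSet_Ioi
  intro t ht
  simp only
  rw [show (((n + 1 : ℕ) : ℝ) - 1) = (n:ℝ) by push_cast; ring, Real.rpow_natCast, neg_mul]

lemma moment_int {n : ℕ} {a : ℝ} (ha : 0 < a) :
    IntegrableOn (fun t => t ^ n * Real.exp (-a * t)) (Ioi (0:ℝ)) := by
  apply Integrable.of_integral_ne_zero
  rw [moment ha]; positivity

lemma exp_int {a : ℝ} (ha : 0 < a) : IntegrableOn (fun t => Real.exp (-a * t)) (Ioi (0:ℝ)) := by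
  simpa using moment_int (n := 0) ha

lemma lap_int {g : ℝ → ℝ} (hg : Continuous g) {C b : ℝ} (hb : ∀ t, 0 ≤ t → |g t| ≤ C * Real.exp (b * t))
    {a : ℝ} (ha : b < a) : IntegrableOn (fun t => g t * Real.exp (-a * t)) (Ioi (0:ℝ)) := by
  have h := (exp_int (a := a - b) (by linarith)).const_mul C
  apply Integrable.mono' h
  · exact (by fun_prop : Continuous fun t => g t * Real.exp (-a * t)).aestronglyMeasurable
  · rw [ae_restrict_iff' measurableSet_Ioi]
    filter_upwards with t ht
    have ht : 0 < t := ht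
    rw [norm_mul, Real.norm_eq_abs, Real.norm_eq_abs, Real.abs_exp]
    calc _ ≤ C * Real.exp (b * t) * Real.exp (-a * t) := by gcongr; exact hb t ht.le
      _ = _ := by rw [mul_assoc, ← Real.exp_add]; ring_nf

lemma lap_fps {g : ℝ → ℝ} (hg : Continuous g) {C b : ℝ} (hb : ∀ t, 0 ≤ t → |g t| ≤ C * Real.exp (b * t))
    {a : ℝ} (ha : b < a) :
    HasFPowerSeriesAt (fun z : ℂ => ∫ t in Ioi (0:ℝ), (g t : ℂ) * cexp (-z * t))
      (FormalMultilinearSeries.ofScalars ℂ (fun n : ℕ => ∫ t in Ioi (0:ℝ),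
        (g t : ℂ) * ((-t) ^ n / n.factorial * cexp (-a * t)))) (a:ℂ) := by
  rw [hasFPowerSeriesAt_iff]
  have : ∀ᶠ z : ℂ in 𝓝 0, ‖z‖ < a - b := by
    have := ball_mem_nhds (0:ℂ) (show 0 < a - b by linarith)
    filter_upwards [this] with z hz
    simpa using hz
  filter_upwards [this] with z hz
  simp only [FormalMultilinearSeries.coeff_ofScalars, smul_eq_mul]
  have e : ∀ n : ℕ, z ^ n * ∫ t in Ioi (0:ℝ), (g t : ℂ) * ((-t) ^ n / n.factorial * cexp (-a * t))
    = ∫ t in Ioi (0:ℝ), (g t : ℂ) * cexp (-a * t) * ((-z * t) ^ n / n.factorial) := by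
    intro n
    rw [← integral_const_mul]
    congr 1; ext t
    rw [show (-z * (t:ℂ)) = z * (-t) by ring, mul_pow]; ring
  simp only [e]
  apply hasSum_integral_of_dominated_convergence
    (fun n t => |g t| * Real.exp (-a * t) * ((‖z‖ * t) ^ n / n.factorial))
  · intro n
    apply Continuous.aestronglyMeasurable
    have : Continuous fun t => (g t : ℂ) := continuous_ofReal.comp hg
    fun_prop
  · intro n
    rw [ae_restrict_iff' measurableSet_Ioi]
    filter_upwards with t ht
    have ht : 0 < t := ht
    rw [norm_mul, norm_mul, norm_div, norm_pow, norm_mul, norm_neg, norm_real, norm_real, norm_exp]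
    rw [Real.norm_of_nonneg ht.le]
    simp
  · filter_upwards with t
    exact (Real.summable_pow_div_factorial _).mul_left _
  · have h := lap_int (g := fun t => |g t|) hg.abs (C := C) (b := b) (by simpa using hb) (a := a - ‖z‖) (by linarith)
    refine h.congr_fun ?_ measurableSet_Ioi
    intro t _
    simp only
    rw [tsum_mul_left, (NormedSpace.expSeries_div_hasSum_exp (‖z‖ * t)).tsum_eq, ← Real.exp_eq_exp_ℝ,
      mul_assoc, ← Real.exp_add]
    ring_nf
  · filter_upwards with t
    have h1 : HasSum (fun n : ℕ => (-z * t) ^ n / (n.factorial : ℂ)) (cexp (-z * t)) := by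
      have := NormedSpace.expSeries_div_hasSum_exp (-z * (t:ℂ))
      rwa [← Complex.exp_eq_exp_ℂ] at this
    have := h1.mul_left ((g t : ℂ) * cexp (-a * t))
    have e2 : (g t : ℂ) * cexp (-(a + z) * t) = (g t : ℂ) * cexp (-a * t) * cexp (-z * t) := by
      rw [mul_assoc, ← Complex.exp_add]; ring_nf
    rw [e2]; exact this

lemma dsl_lap {g : ℝ → ℝ} (hg : Continuous g) {C b : ℝ} (hb : ∀ t, 0 ≤ t → |g t| ≤ C * Real.exp (b * t))
    {G : ℂ → ℂ} (hG : DifferentiableOn ℂ G {z | 0 < z.re})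
    {x₀ : ℝ} (hL : ∀ x : ℝ, x₀ < x → G x = ((∫ t in Ioi (0:ℝ), g t * Real.exp (-x * t) : ℝ) : ℂ))
    {a : ℝ} (ha : b < a) (ha0 : 0 < a) (hax : x₀ < a) (n : ℕ) :
    dsl a n G a = (((-1) ^ n * ∫ t in Ioi (0:ℝ), g t * (t ^ n / n.factorial * Real.exp (-a * t)) : ℝ) : ℂ) := by
  have h1 := lap_fps hg hb ha
  have hGa : AnalyticAt ℂ G a := by
    apply hG.analyticAt
    apply (halfplane_open 0).mem_nhds
    simpa using ha0
  have hev : G =ᶠ[𝓝 (a:ℂ)] fun z : ℂ => ∫ t in Ioi (0:ℝ), (g t : ℂ) * cexp (-z * t) := by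
    rw [EventuallyEq, ← hGa.frequently_eq_iff_eventually_eq h1.analyticAt]
    have hf : ∃ᶠ x : ℝ in 𝓝[>] a, G x = ∫ t in Ioi (0:ℝ), (g t : ℂ) * cexp (-x * t) := by
      apply Eventually.frequently
      filter_upwards [self_mem_nhdsWithin] with x hx
      rw [hL x (hax.trans hx), ← integral_complex_ofReal]
      congr 1; ext t; push_cast; rfl
    have ht : Tendsto (fun x : ℝ => (x:ℂ)) (𝓝[>] a) (𝓝[≠] (a:ℂ)) := by
      apply tendsto_nhdsWithin_of_tendsto_nhds_of_eventually_within
      · exact (continuous_ofReal.tendsto a).mono_left nhdsWithin_le_nhds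
      · filter_upwards [self_mem_nhdsWithin] with x hx
        have hx : a < x := hx
        simpa using hx.ne'
    exact ht.frequently hf
  have h2 := h1.congr hev.symm
  have h3 := h2.has_fpower_series_iterate_dslope_fslope n
  have h4 := h3.coeff_zero (fun _ => 1)
  rw [dsl, ← h4]
  have h5 : ∀ p : FormalMultilinearSeries ℂ ℂ ℂ, p 0 (fun _ => 1) = p.coeff 0 := fun p => rfl
  rw [h5, FormalMultilinearSeries.coeff_iterate_fslope, FormalMultilinearSeries.coeff_ofScalars, zero_add,
    ← integral_const_mul, ← integral_complex_ofReal]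
  congr 1; ext t
  rw [neg_pow]
  push_cast; ring

lemma lap_ineq {g : ℝ → ℝ} (hg : Continuous g) {C b : ℝ} (hb : ∀ t, 0 ≤ t → |g t| ≤ C * Real.exp (b * t))
    {G : ℂ → ℂ} (hG : DifferentiableOn ℂ G {z | 0 < z.re}) (hre : ∀ z : ℂ, 0 < z.re → 0 ≤ (G z).re)
    {x₀ : ℝ} (hL : ∀ x : ℝ, x₀ < x → G x = ((∫ t in Ioi (0:ℝ), g t * Real.exp (-x * t) : ℝ) : ℂ))
    {a : ℝ} (ha : b < a) (ha0 : 0 < a) (hax : x₀ < a) {n : ℕ} (hn : 1 ≤ n) :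
    a ^ n * ∫ t in Ioi (0:ℝ), g t * (t ^ n / n.factorial * Real.exp (-a * t)) ≤
      ∫ t in Ioi (0:ℝ), g t * Real.exp (-a * t) := by
  obtain ⟨m, rfl⟩ := Nat.exists_eq_add_of_le' hn
  have h := pick_coeff hG hre ha0 m
  rw [dsl_lap hg hb hG hL ha ha0 hax, hL a hax, ofReal_re, norm_real, norm_mul, norm_pow, norm_neg, norm_one, one_pow,
    one_mul] at h
  refine le_trans ?_ h
  gcongr
  exact Real.le_norm_self _

lemma lap_zero {g : ℝ → ℝ} (hg : Continuous g) {C b : ℝ} (hb : ∀ t, 0 ≤ t → |g t| ≤ C * Real.exp (b * t)) :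
    Tendsto (fun a : ℝ => a * ∫ t in Ioi (0:ℝ), g t * Real.exp (-a * t)) atTop (𝓝 (g 0)) := by
  have h1 : ∀ᶠ a : ℝ in atTop, (∫ u in Ioi (0:ℝ), g (a⁻¹ * u) * Real.exp (-u)) = a * ∫ t in Ioi (0:ℝ), g t * Real.exp (-a * t) := by
    filter_upwards [eventually_gt_atTop (0:ℝ)] with a ha
    have h := integral_comp_mul_left_Ioi (fun t => g t * Real.exp (-a * t)) 0 (b := a⁻¹) (by positivity)
    rw [mul_zero, inv_inv, smul_eq_mul] at h
    rw [← h]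
    congr 1; ext u
    rw [show -a * (a⁻¹ * u) = -u by field_simp]
  refine Tendsto.congr' h1 ?_
  have hC : 0 ≤ C := by have := hb 0 le_rfl; simp at this; exact (abs_nonneg _).trans this
  have e0 : g 0 = ∫ u in Ioi (0:ℝ), g 0 * Real.exp (-u) := by
    rw [integral_const_mul, integral_exp_neg_Ioi_zero, mul_one]
  nth_rw 1 [e0]
  apply tendsto_integral_filter_of_dominated_convergence (fun u => C * Real.exp (-(1/2) * u))
  · filter_upwards with a
    exact (by fun_prop : Continuous fun u => g (a⁻¹ * u) * Real.exp (-u)).aestronglyMeasurable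
  · filter_upwards [eventually_ge_atTop (2 * |b| + 1)] with a ha
    rw [ae_restrict_iff' measurableSet_Ioi]
    filter_upwards with u hu
    have hu : 0 < u := hu
    have hb0 := abs_nonneg b
    have ha0 : 0 < a := by linarith
    rw [norm_mul, Real.norm_eq_abs, Real.norm_eq_abs, Real.abs_exp]
    calc _ ≤ C * Real.exp (b * (a⁻¹ * u)) * Real.exp (-u) := by gcongr; exact hb _ (by positivity)
      _ = C * Real.exp (b * (a⁻¹ * u) + -u) := by rw [mul_assoc, ← Real.exp_add]
      _ ≤ _ := by
        gcongr
        have h1 : b * (a⁻¹ * u) ≤ (1/2) * u := by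
          have : b * a⁻¹ ≤ 1/2 := by
            rw [← div_eq_mul_inv, div_le_iff₀ ha0]; linarith [le_abs_self b]
          nlinarith
        linarith
  · exact (exp_int (by norm_num)).const_mul C
  · filter_upwards with u
    apply Tendsto.mul_const
    have : Tendsto (fun a : ℝ => a⁻¹ * u) atTop (𝓝 (0 * u)) := tendsto_inv_atTop_zero.mul_const u
    rw [zero_mul] at this
    exact (hg.tendsto 0).comp this

lemma kernel_mass {t₀ : ℝ} (ht : 0 < t₀) {n : ℕ} (hn : 1 ≤ n) :
    (∫ t in Ioi (0:ℝ), ((n / t₀) ^ (n + 1) / n.factorial) * (t ^ n * Real.exp (-(n / t₀) * t)) * (t - t₀) ^ 2)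
      = t₀ ^ 2 * ((n + 2) / n ^ 2) := by
  have hn0 : (0:ℝ) < n := by exact_mod_cast hn
  have hν : 0 < (n:ℝ) / t₀ := by positivity
  set ν : ℝ := n / t₀ with hνd
  have hA := (moment_int (n := n + 2) hν)
  have hB := (moment_int (n := n + 1) hν)
  have hC := (moment_int (n := n) hν)
  have e : ∀ t : ℝ, (ν ^ (n + 1) / n.factorial) * (t ^ n * Real.exp (-ν * t)) * (t - t₀) ^ 2
    = (ν ^ (n + 1) / n.factorial) * (t ^ (n + 2) * Real.exp (-ν * t)
      - 2 * t₀ * (t ^ (n + 1) * Real.exp (-ν * t)) + t₀ ^ 2 * (t ^ n * Real.exp (-ν * t))) := by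
    intro t; ring
  simp only [e]
  rw [integral_const_mul, integral_add, integral_sub, integral_const_mul, integral_const_mul,
    moment hν, moment hν, moment hν]
  · have hf : (n.factorial : ℝ) ≠ 0 := by positivity
    have f1 : ((n + 1).factorial : ℝ) = (n + 1) * n.factorial := by rw [Nat.factorial_succ]; push_cast; ring
    have f2 : ((n + 2).factorial : ℝ) = (n + 2) * ((n + 1) * n.factorial) := by
      rw [Nat.factorial_succ, Nat.factorial_succ]; push_cast; ring
    have ht0 : t₀ = n / ν := by rw [hνd]; field_simp
    have hν' : ν ≠ 0 := hν.ne'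
    rw [f1, f2, ht0]
    field_simp
    ring
  · exact hA
  · exact hB.const_mul _
  · exact hA.sub (hB.const_mul _)
  · exact hC.const_mul _

theorem lap_pick {g : ℝ → ℝ} (hg : Continuous g) {C b : ℝ} (hb : ∀ t, 0 ≤ t → |g t| ≤ C * Real.exp (b * t))
    {G : ℂ → ℂ} (hG : DifferentiableOn ℂ G {z | 0 < z.re}) (hre : ∀ z : ℂ, 0 < z.re → 0 ≤ (G z).re)
    {x₀ : ℝ} (hL : ∀ x : ℝ, x₀ < x → G x = ((∫ t in Ioi (0:ℝ), g t * Real.exp (-x * t) : ℝ) : ℂ))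
    {t₀ : ℝ} (ht : 0 < t₀) : g t₀ ≤ g 0 := by
  have hC : 0 ≤ C := by have := hb 0 le_rfl; simp at this; exact (abs_nonneg _).trans this
  set β : ℝ := |b| + |x₀| + 1 with hβ
  have hβb : b < β := by linarith [le_abs_self b, abs_nonneg x₀]
  have hβx : x₀ < β := by linarith [le_abs_self x₀, abs_nonneg b]
  have hβ0 : 0 < β := by positivity
  set k : ℝ → ℝ := fun t => g t * Real.exp (-β * t) with hk
  have hkc : Continuous k := by fun_prop
  have hkb : ∀ t, 0 ≤ t → |k t| ≤ C := by
    intro t ht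
    simp only [hk]
    rw [abs_mul, Real.abs_exp]
    calc _ ≤ C * Real.exp (b * t) * Real.exp (-β * t) := by gcongr; exact hb t ht
      _ = C * Real.exp (b * t + -β * t) := by rw [mul_assoc, ← Real.exp_add]
      _ ≤ C * Real.exp 0 := by gcongr; nlinarith
      _ = C := by simp
  set φ : ℕ → ℝ → ℝ := fun n t => ((n / t₀) ^ (n + 1) / n.factorial) * (t ^ n * Real.exp (-(n / t₀) * t)) with hφ
  have hupper : ∀ n : ℕ, 1 ≤ n → ∫ t in Ioi (0:ℝ), φ n t * k t ≤
      ((n / t₀ + β) * ∫ t in Ioi (0:ℝ), g t * Real.exp (-(n / t₀ + β) * t)) * ((1 + (β * t₀) / n) ^ (n + 1))⁻¹ := by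
    intro n hn
    have hn0 : (0:ℝ) < n := by exact_mod_cast hn
    have hν : 0 < (n:ℝ) / t₀ := by positivity
    have h := lap_ineq hg hb hG hre hL (a := n / t₀ + β) (by linarith) (by linarith) (by linarith) hn
    have e : ∫ t in Ioi (0:ℝ), φ n t * k t = (n / t₀) ^ (n + 1) * ∫ t in Ioi (0:ℝ), g t * (t ^ n / n.factorial * Real.exp (-(n / t₀ + β) * t)) := by
      rw [← integral_const_mul]
      congr 1; ext t
      simp only [hφ, hk]
      rw [show -(n / t₀ + β) * t = -(n / t₀) * t + -β * t by ring, Real.exp_add]; ring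
    rw [e]
    have e2 : (1 + (β * t₀) / n) = (n / t₀ + β) / (n / t₀) := by field_simp
    have hp : 0 < (n:ℝ) / t₀ + β := by positivity
    rw [e2, ← inv_pow, inv_div, div_pow (n / t₀ : ℝ) (n / t₀ + β), ← mul_div_assoc, le_div_iff₀ (by positivity)]
    calc _ = (n / t₀) ^ (n + 1) * ((n / t₀ + β) * ((n / t₀ + β) ^ n * ∫ t in Ioi (0:ℝ), g t * (t ^ n / n.factorial * Real.exp (-(n / t₀ + β) * t)))) := by ring
      _ ≤ (n / t₀) ^ (n + 1) * ((n / t₀ + β) * ∫ t in Ioi (0:ℝ), g t * Real.exp (-(n / t₀ + β) * t)) := by gcongr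
      _ = _ := by ring
  have hφm : ∀ n : ℕ, 1 ≤ n → ∫ t in Ioi (0:ℝ), φ n t = 1 := by
    intro n hn
    have hn0 : (0:ℝ) < n := by exact_mod_cast hn
    simp only [hφ]
    rw [integral_const_mul, moment (by positivity)]
    have hf : (n.factorial : ℝ) ≠ 0 := by positivity
    field_simp
  have hφi : ∀ n : ℕ, 1 ≤ n → IntegrableOn (φ n) (Ioi 0) := by
    intro n hn
    have hn0 : (0:ℝ) < n := by exact_mod_cast hn
    exact (moment_int (by positivity)).const_mul _
  have hφ0 : ∀ n : ℕ, ∀ t : ℝ, 0 < t → 0 ≤ φ n t := by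
    intro n t ht; simp only [hφ]; positivity
  have hlow : ∀ ε > 0, ∃ K : ℝ, ∀ n : ℕ, 1 ≤ n → k t₀ - ε - K * (t₀ ^ 2 * ((n + 2) / n ^ 2)) ≤ ∫ t in Ioi (0:ℝ), φ n t * k t := by
    intro ε hε
    obtain ⟨δ, hδ, hδk⟩ := Metric.continuousAt_iff.mp hkc.continuousAt ε hε
    refine ⟨2 * C / δ ^ 2, fun n hn => ?_⟩
    have hpt : ∀ t : ℝ, 0 < t → k t₀ - ε - 2 * C / δ ^ 2 * (t - t₀) ^ 2 ≤ k t := by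
      intro t htp
      by_cases hd : dist t t₀ < δ
      · have := hδk hd
        rw [Real.dist_eq, abs_lt] at this
        have h2 : 0 ≤ 2 * C / δ ^ 2 * (t - t₀) ^ 2 := by positivity
        linarith [this.1]
      · rw [Real.dist_eq, not_lt] at hd
        have h2 : δ ^ 2 ≤ (t - t₀) ^ 2 := by rw [← sq_abs (t - t₀)]; gcongr
        have h3 : 2 * C ≤ 2 * C / δ ^ 2 * (t - t₀) ^ 2 := by
          calc 2 * C = 2 * C / δ ^ 2 * δ ^ 2 := by field_simp
            _ ≤ _ := by gcongr
        have h4 := abs_le.mp (hkb t htp.le)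
        have h5 := abs_le.mp (hkb t₀ ht.le)
        linarith [h4.1, h5.2]
    have hm2 := kernel_mass ht hn
    have hn0 : (0:ℝ) < n := by exact_mod_cast hn
    have hi2 : IntegrableOn (fun t => φ n t * (t - t₀) ^ 2) (Ioi 0) := by
      apply Integrable.of_integral_ne_zero
      simp only [hφ]; rw [hm2]; positivity
    have e : k t₀ - ε - 2 * C / δ ^ 2 * (t₀ ^ 2 * ((n + 2) / n ^ 2))
      = ∫ t in Ioi (0:ℝ), ((k t₀ - ε) * φ n t - 2 * C / δ ^ 2 * (φ n t * (t - t₀) ^ 2)) := by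
      rw [integral_sub, integral_const_mul (k t₀ - ε) (φ n), integral_const_mul (2 * C / δ ^ 2), hφm n hn]
      · simp only [hφ]; rw [hm2]; ring
      · exact (hφi n hn).const_mul _
      · exact hi2.const_mul _
    rw [e]
    apply setIntegral_mono_on
    · exact ((hφi n hn).const_mul _).sub (hi2.const_mul _)
    · apply Integrable.mul_bdd (c := C) (hφi n hn) hkc.aestronglyMeasurable
      rw [ae_restrict_iff' measurableSet_Ioi]
      filter_upwards with t htp
      have htp : 0 < t := htp
      exact hkb t htp.le
    · exact measurableSet_Ioi
    · intro t htp
      have := mul_le_mul_of_nonneg_left (hpt t htp) (hφ0 n t htp)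
      linarith
  have hlim : Tendsto (fun n : ℕ => ((n / t₀ + β) * ∫ t in Ioi (0:ℝ), g t * Real.exp (-(n / t₀ + β) * t)) * ((1 + (β * t₀) / n) ^ (n + 1))⁻¹)
      atTop (𝓝 (g 0 * (Real.exp (β * t₀) * 1)⁻¹)) := by
    apply Tendsto.mul
    · apply (lap_zero hg hb).comp (g := fun a : ℝ => a * ∫ t in Ioi (0:ℝ), g t * Real.exp (-a * t)) (f := fun n : ℕ => (n:ℝ) / t₀ + β)
      apply tendsto_atTop_add_const_right
      exact tendsto_natCast_atTop_atTop.atTop_div_const ht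
    · apply Tendsto.inv₀ _ (by positivity)
      simp only [pow_succ]
      apply Tendsto.mul (Real.tendsto_one_add_div_pow_exp (β * t₀))
      have : Tendsto (fun n : ℕ => 1 + (β * t₀) / (n:ℝ)) atTop (𝓝 (1 + 0)) :=
        (tendsto_const_div_atTop_nhds_zero_nat _).const_add 1
      simpa using this
  have hsm : Tendsto (fun n : ℕ => ((n:ℝ) + 2) / n ^ 2) atTop (𝓝 0) := by
    have h1 : Tendsto (fun n : ℕ => (1:ℝ) / n + 2 / (n:ℝ) * (1 / (n:ℝ))) atTop (𝓝 (0 + 0 * 0)) :=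
      (tendsto_const_div_atTop_nhds_zero_nat 1).add ((tendsto_const_div_atTop_nhds_zero_nat 2).mul (tendsto_const_div_atTop_nhds_zero_nat 1))
    rw [mul_zero, add_zero] at h1
    refine h1.congr' ?_
    filter_upwards [eventually_ge_atTop 1] with n hn
    have hn0 : (0:ℝ) < n := by exact_mod_cast hn
    field_simp
  have hfin : ∀ ε > 0, k t₀ - ε ≤ g 0 * (Real.exp (β * t₀) * 1)⁻¹ := by
    intro ε hε
    obtain ⟨K, hK⟩ := hlow ε hε
    have hl : Tendsto (fun n : ℕ => k t₀ - ε - K * (t₀ ^ 2 * (((n:ℝ) + 2) / n ^ 2))) atTop (𝓝 (k t₀ - ε - K * (t₀ ^ 2 * 0))) :=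
      ((hsm.const_mul _).const_mul _).const_sub _
    rw [mul_zero, mul_zero, sub_zero] at hl
    apply le_of_tendsto_of_tendsto hl hlim
    filter_upwards [eventually_ge_atTop 1] with n hn
    exact (hK n hn).trans (hupper n hn)
  have h := le_of_forall_sub_le hfin
  simp only [hk] at h
  rw [mul_one, ← Real.exp_neg, ← neg_mul] at h
  exact le_of_mul_le_mul_right h (Real.exp_pos _)

end Cesaro
end

section
namespace Cesaro
open Complex MeasureTheory Set Filter Topology Asymptotics Metric

/-- the real digamma function -/
noncomputable def psi (x : ℝ) : ℝ := deriv (Real.log ∘ Real.Gamma) x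

lemma logGamma_diff {x : ℝ} (hx : 0 < x) : DifferentiableAt ℝ (Real.log ∘ Real.Gamma) x := by
  refine ((Real.differentiableAt_Gamma ?_).log (Real.Gamma_ne_zero ?_)) <;>
  exact fun m ↦ ne_of_gt (by have : (0:ℝ) ≤ m := m.cast_nonneg
                             linarith)

lemma psi_eq {x : ℝ} (hx : 0 < x) : psi x = deriv Real.Gamma x / Real.Gamma x := by
  unfold psi
  rw [Function.comp_def, deriv.log]
  · refine Real.differentiableAt_Gamma fun m => ne_of_gt ?_
    have : (0:ℝ) ≤ m := m.cast_nonneg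
    linarith
  · exact (Real.Gamma_pos_of_pos hx).ne'

lemma psi_add_one {x : ℝ} (hx : 0 < x) : psi (x + 1) = psi x + 1 / x := by
  unfold psi
  rw [← deriv_comp_add_const, one_div, ← Real.deriv_log,
      ← deriv_add (logGamma_diff hx) (Real.differentiableAt_log hx.ne')]
  apply EventuallyEq.deriv_eq
  filter_upwards [eventually_gt_nhds hx] with y hy
  simp only [Function.comp_apply, Pi.add_apply,
      Real.Gamma_add_one hy.ne', Real.log_mul hy.ne' (Real.Gamma_pos_of_pos hy).ne', add_comm]

lemma psi_mono {x y : ℝ} (hx : 0 < x) (hxy : x ≤ y) : psi x ≤ psi y :=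
  Real.convexOn_log_Gamma.monotoneOn_deriv (fun _ h => logGamma_diff h) hx (hx.trans_le hxy) hxy

lemma psi_one : psi 1 = -Real.eulerMascheroniConstant := by
  rw [psi_eq one_pos, Real.hasDerivAt_Gamma_one.deriv, Real.Gamma_one, div_one]

lemma psi_half : psi (1/2) = -Real.eulerMascheroniConstant - 2 * Real.log 2 := by
  rw [psi_eq (by norm_num), Real.hasDerivAt_Gamma_one_half.deriv, Real.Gamma_one_half_eq]
  have : √Real.pi ≠ 0 := by positivity
  field_simp
  ring

lemma psi_add_nat {x : ℝ} (hx : 0 < x) (N : ℕ) :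
    psi (x + N) = psi x + ∑ k ∈ Finset.range N, 1 / (x + k) := by
  induction N with
  | zero => simp
  | succ N ih =>
    rw [Finset.sum_range_succ, ← add_assoc, ← ih, ← psi_add_one (by positivity)]
    push_cast
    congr 1; ring

lemma psi_diff_tendsto {x : ℝ} (hx : 0 < x) :
    Tendsto (fun N : ℕ => psi (x + 1 + N) - psi (1 + N)) atTop (𝓝 0) := by
  obtain ⟨M, hM⟩ := exists_nat_ge x
  have hup : Tendsto (fun N : ℕ => (M : ℝ) * (1 / ((N : ℝ) + 1))) atTop (𝓝 0) := by
    simpa using tendsto_one_div_add_atTop_nhds_zero_nat.const_mul (M : ℝ)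
  refine tendsto_of_tendsto_of_tendsto_of_le_of_le tendsto_const_nhds hup ?_ ?_
  · intro N
    have := psi_mono (x := 1 + (N:ℝ)) (y := x + 1 + N) (by positivity) (by linarith)
    simpa using this
  · intro N
    have h1 := psi_mono (x := x + 1 + (N:ℝ)) (y := 1 + N + M) (by positivity) (by linarith)
    have h2 := psi_add_nat (x := 1 + (N:ℝ)) (by positivity) M
    have h3 : ∑ k ∈ Finset.range M, 1 / (1 + (N:ℝ) + k) ≤ M * (1 / ((N:ℝ) + 1)) := by
      have : ∀ k ∈ Finset.range M, 1 / (1 + (N:ℝ) + k) ≤ 1 / ((N:ℝ) + 1) := by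
        intro k _
        apply one_div_le_one_div_of_le (by positivity)
        have : (0:ℝ) ≤ k := k.cast_nonneg
        linarith
      simpa using Finset.sum_le_sum this
    simp only
    linarith

lemma psi_hasSum {x : ℝ} (hx : 0 < x) :
    HasSum (fun k : ℕ => 1 / ((k:ℝ) + 1) - 1 / ((k:ℝ) + 1 + x))
      (psi x + Real.eulerMascheroniConstant + 1 / x) := by
  rw [hasSum_iff_tendsto_nat_of_nonneg]
  · have h := (psi_diff_tendsto hx).const_sub (psi x + Real.eulerMascheroniConstant + 1 / x)
    rw [sub_zero] at h
    refine h.congr fun N => ?_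
    rw [psi_add_nat (by positivity), psi_add_nat (by positivity), psi_add_one hx, psi_one,
      Finset.sum_sub_distrib]
    have e1 : ∀ k : ℕ, 1 / (x + 1 + (k:ℝ)) = 1 / ((k:ℝ) + 1 + x) := fun k => by congr 1; ring
    have e2 : ∀ k : ℕ, 1 / (1 + (k:ℝ)) = 1 / ((k:ℝ) + 1) := fun k => by congr 1; ring
    simp only [e1, e2]
    ring
  · intro k
    rw [sub_nonneg]
    apply one_div_le_one_div_of_le (by positivity)
    linarith

lemma half_hasSum : HasSum (fun k : ℕ => 1 / (2 * ((k:ℝ) + 1) * (2 * ((k:ℝ) + 1) + 1)))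
    (1 - Real.log 2) := by
  have h := (psi_hasSum (x := 1/2) (by norm_num)).mul_left (1/2)
  rw [psi_half] at h
  convert! h using 1
  · funext k
    have h1 : (k:ℝ) + 1 ≠ 0 := by positivity
    have h2 : (k:ℝ) + 1 + 1/2 ≠ 0 := by positivity
    have h3 : 2 * ((k:ℝ) + 1) + 1 ≠ 0 := by positivity
    rw [div_sub_div _ _ h1 h2, div_mul_div_comm, div_eq_div_iff (by positivity) (by positivity)]
    ring
  · norm_num
    ring

lemma triv_hasSum {s : ℝ} (hs : 0 < s) :
    HasSum (fun k : ℕ => s * (s - 1) *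
      (1 / (2 * ((k:ℝ) + 1) * (2 * ((k:ℝ) + 1) + 1)) * (1 / (s + 2 * ((k:ℝ) + 1)))))
    (s * (1 - Real.log 2) - 1/2 * (psi (s/2) + Real.eulerMascheroniConstant + 2 / s)) := by
  have h := (half_hasSum.mul_left s).sub ((psi_hasSum (x := s/2) (by positivity)).mul_left (1/2))
  convert! h using 1
  · funext k
    have h1 : (k:ℝ) + 1 ≠ 0 := by positivity
    have h2 : (k:ℝ) + 1 + s/2 ≠ 0 := by positivity
    have h3 : 2 * ((k:ℝ) + 1) + 1 ≠ 0 := by positivity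
    have h4 : s + 2 * ((k:ℝ) + 1) ≠ 0 := by positivity
    have h5 : (1:ℝ) / ((k:ℝ) + 1 + s/2) = 2 / (s + 2 * ((k:ℝ) + 1)) := by
      rw [div_eq_div_iff h2 h4]; ring
    rw [h5]
    field_simp
    ring
  · rw [one_div_div]

end Cesaro
end

section
namespace Cesaro
open Complex MeasureTheory Set Filter Topology Asymptotics Metric

/-- terms of the prime sum -/
noncomputable def aT (n : ℕ) (t : ℝ) : ℝ :=
  ArithmeticFunction.vonMangoldt n * max (1 / (n:ℝ) - Real.exp (-t)) 0

/-- the prime sum -/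
noncomputable def Sf (t : ℝ) : ℝ := ∑' n : ℕ, aT n t

lemma aT_nonneg (n : ℕ) (t : ℝ) : 0 ≤ aT n t :=
  mul_nonneg ArithmeticFunction.vonMangoldt_nonneg (le_max_right _ _)

lemma aT_cont (n : ℕ) : Continuous (aT n) := by
  unfold aT; fun_prop

lemma aT_zero {n : ℕ} {t : ℝ} (h : Real.exp t ≤ n) : aT n t = 0 := by
  unfold aT
  rw [max_eq_right, mul_zero]
  rw [sub_nonpos, Real.exp_neg, ← one_div]
  exact one_div_le_one_div_of_le (Real.exp_pos _) h

lemma Sf_eq {N : ℕ} {t : ℝ} (h : Real.exp t ≤ N) : Sf t = ∑ n ∈ Finset.range N, aT n t := by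
  unfold Sf
  apply tsum_eq_sum
  intro n hn
  apply aT_zero (h.trans _)
  simpa using hn

lemma aT_le (n : ℕ) (t : ℝ) : aT n t ≤ 1 := by
  unfold aT
  rcases Nat.eq_zero_or_pos n with rfl | hn
  · simp
  have hn' : (0:ℝ) < n := by exact_mod_cast hn
  have h1 : max (1 / (n:ℝ) - Real.exp (-t)) 0 ≤ 1 / n := by
    apply max_le
    · linarith [Real.exp_pos (-t)]
    · positivity
  have h2 : ArithmeticFunction.vonMangoldt n ≤ n :=
    ArithmeticFunction.vonMangoldt_le_log.trans (Real.log_le_self hn'.le)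
  calc _ ≤ (n:ℝ) * (1 / n) := by gcongr
    _ = 1 := by field_simp

lemma Sf_nonneg (t : ℝ) : 0 ≤ Sf t := tsum_nonneg fun n => aT_nonneg n t

lemma Sf_le {t : ℝ} (ht : 0 ≤ t) : Sf t ≤ 2 * Real.exp t := by
  rw [Sf_eq (Nat.le_ceil (Real.exp t))]
  have h : ∑ n ∈ Finset.range ⌈Real.exp t⌉₊, aT n t ≤ ∑ n ∈ Finset.range ⌈Real.exp t⌉₊, (1:ℝ) :=
    Finset.sum_le_sum fun n _ => aT_le n t
  simp only [Finset.sum_const, Finset.card_range, nsmul_eq_mul, mul_one] at h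
  have := Nat.ceil_lt_add_one (Real.exp_pos t).le
  have := Real.one_le_exp ht
  linarith

lemma Sf_cont : Continuous Sf := by
  rw [continuous_iff_continuousAt]
  intro t₀
  have hc : Continuous fun t => ∑ n ∈ Finset.range ⌈Real.exp (t₀ + 1)⌉₊, aT n t :=
    continuous_finsetSum _ fun n _ => aT_cont n
  refine hc.continuousAt.congr ?_
  filter_upwards [eventually_lt_nhds (show t₀ < t₀ + 1 by linarith)] with t ht
  rw [Sf_eq]
  exact (Real.exp_le_exp.mpr ht.le).trans (Nat.le_ceil _)

lemma aT_int {n : ℕ} {σ : ℝ} (hσ : 0 < σ) :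
    IntegrableOn (fun t => aT n t * Real.exp (-σ * t)) (Ioi (0:ℝ)) := by
  apply lap_int (aT_cont n) (C := 1) (b := 0) _ hσ
  intro t _
  rw [abs_of_nonneg (aT_nonneg n t)]
  simpa using aT_le n t

lemma aT_lap {n : ℕ} {σ : ℝ} (hσ : 0 < σ) :
    ∫ t in Ioi (0:ℝ), aT n t * Real.exp (-σ * t) =
      ArithmeticFunction.vonMangoldt n * (n:ℝ) ^ (-(σ + 1)) / ((σ + 1) * σ) := by
  rcases Nat.eq_zero_or_pos n with rfl | hn
  · simp [aT]
  have hn' : (0:ℝ) < n := by exact_mod_cast hn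
  have hn1 : (1:ℝ) ≤ n := by exact_mod_cast hn
  have hl : 0 ≤ Real.log n := Real.log_nonneg hn1
  have h1 : ∫ t in Ioi (0:ℝ), aT n t * Real.exp (-σ * t) =
      ∫ t in Ioi (Real.log n), aT n t * Real.exp (-σ * t) := by
    apply setIntegral_eq_of_subset_of_forall_sdiff_eq_zero measurableSet_Ioi
    · exact Ioi_subset_Ioi hl
    · intro t ht
      have : t ≤ Real.log n := by simpa using ht.2
      rw [aT_zero, zero_mul]
      rwa [← Real.le_log_iff_exp_le hn']
  have h2 : ∫ t in Ioi (Real.log n), aT n t * Real.exp (-σ * t) =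
      ∫ t in Ioi (Real.log n), (ArithmeticFunction.vonMangoldt n * (1 / n) * Real.exp (-σ * t) -
        ArithmeticFunction.vonMangoldt n * Real.exp (-(σ + 1) * t)) := by
    apply setIntegral_congr_fun measurableSet_Ioi
    intro t ht
    have ht : Real.log n < t := ht
    simp only [aT]
    rw [max_eq_left]
    · rw [show -(σ + 1) * t = -t + -σ * t by ring, Real.exp_add]; ring
    · rw [sub_nonneg, Real.exp_neg, ← one_div]
      apply one_div_le_one_div_of_le hn'
      rw [← Real.log_le_iff_le_exp hn']
      exact ht.le
  rw [h1, h2, integral_sub, integral_const_mul, integral_const_mul, integral_exp_mul_Ioi (by linarith),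
    integral_exp_mul_Ioi (by linarith)]
  · have e1 : Real.exp (-(σ + 1) * Real.log n) = (n:ℝ) ^ (-(σ + 1)) := by
      rw [Real.rpow_def_of_pos hn', mul_comm]
    have e2 : 1 / (n:ℝ) * Real.exp (-σ * Real.log n) = (n:ℝ) ^ (-(σ + 1)) := by
      rw [← e1, show -(σ + 1) * Real.log n = -Real.log n + -σ * Real.log n by ring, Real.exp_add,
        Real.exp_neg, Real.exp_log hn', one_div]
    rw [e1]
    calc _ = ArithmeticFunction.vonMangoldt n * ((1 / (n:ℝ) * Real.exp (-σ * Real.log n)) / σ -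
            (n:ℝ) ^ (-(σ + 1)) / (σ + 1)) := by field_simp
      _ = _ := by rw [e2]; field_simp; ring
  · exact (integrableOn_exp_mul_Ioi (by linarith) _).const_mul _
  · exact (integrableOn_exp_mul_Ioi (by linarith) _).const_mul _

lemma vm_term (n : ℕ) (s : ℝ) (hs : s ≠ 0) :
    LSeries.term (fun n => (ArithmeticFunction.vonMangoldt n : ℂ)) s n =
      ((ArithmeticFunction.vonMangoldt n * (n:ℝ) ^ (-s) : ℝ) : ℂ) := by
  rcases Nat.eq_zero_or_pos n with rfl | hn
  · simp
  rw [LSeries.term_of_ne_zero hn.ne']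
  rw [Real.rpow_neg (by positivity)]
  push_cast
  rw [Complex.ofReal_cpow (by positivity), div_eq_mul_inv]
  simp

lemma vm_summable {s : ℝ} (hs : 1 < s) :
    Summable fun n : ℕ => ArithmeticFunction.vonMangoldt n * (n:ℝ) ^ (-s) := by
  have h := ArithmeticFunction.LSeriesSummable_vonMangoldt (s := (s:ℂ)) (by simpa using hs)
  unfold LSeriesSummable at h
  rw [← Complex.summable_ofReal]
  refine h.congr fun n => ?_
  rw [← vm_term n s (by linarith)]

lemma Sf_lap {s : ℝ} (hs : 1 < s) :
    (((s * (s - 1)) * ∫ t in Ioi (0:ℝ), Sf t * Real.exp (-(s - 1) * t) : ℝ) : ℂ) =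
      - deriv riemannZeta s / riemannZeta s := by
  have hσ : 0 < s - 1 := by linarith
  have h := hasSum_integral_of_summable_integral_norm (μ := volume.restrict (Ioi (0:ℝ)))
    (F := fun n t => aT n t * Real.exp (-(s - 1) * t)) (fun n => aT_int hσ) (by
      have : ∀ n t, ‖aT n t * Real.exp (-(s - 1) * t)‖ = aT n t * Real.exp (-(s - 1) * t) :=
        fun n t => by rw [Real.norm_eq_abs, abs_of_nonneg (mul_nonneg (aT_nonneg n t) (Real.exp_pos _).le)]
      simp only [this, aT_lap hσ, sub_add_cancel]
      exact (vm_summable hs).div_const _)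
  have e1 : ∫ t in Ioi (0:ℝ), ∑' n, aT n t * Real.exp (-(s - 1) * t) =
      ∫ t in Ioi (0:ℝ), Sf t * Real.exp (-(s - 1) * t) := by
    congr 1; funext t
    rw [tsum_mul_right]; rfl
  rw [e1] at h
  simp only [aT_lap hσ, sub_add_cancel] at h
  have h2 := h.mul_left (s * (s - 1))
  rw [← ArithmeticFunction.LSeries_vonMangoldt_eq_deriv_riemannZeta_div (by simpa using hs), LSeries,
    ← h2.tsum_eq, Complex.ofReal_tsum]
  congr 1; funext n
  rw [vm_term n s (by linarith)]
  congr 1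
  have : s ≠ 0 := by linarith
  field_simp

/-- trivial zero terms -/
noncomputable def cT (k : ℕ) (t : ℝ) : ℝ :=
  1 / (2 * ((k:ℝ) + 1) * (2 * ((k:ℝ) + 1) + 1)) * Real.exp (-(2 * ((k:ℝ) + 1) + 1) * max t 0)

/-- trivial zero sum -/
noncomputable def Tf (t : ℝ) : ℝ := ∑' k : ℕ, cT k t

lemma cT_nonneg (k : ℕ) (t : ℝ) : 0 ≤ cT k t := by unfold cT; positivity

lemma cT_le (k : ℕ) (t : ℝ) : cT k t ≤ 1 / (2 * ((k:ℝ) + 1) * (2 * ((k:ℝ) + 1) + 1)) := by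
  unfold cT
  apply mul_le_of_le_one_right (by positivity)
  rw [Real.exp_le_one_iff]
  have : 0 ≤ max t 0 := le_max_right _ _
  have : 0 ≤ (2 * ((k:ℝ) + 1) + 1) * max t 0 := by positivity
  linarith

lemma cT_cont (k : ℕ) : Continuous (cT k) := by unfold cT; fun_prop

lemma cT_summable (t : ℝ) : Summable fun k => cT k t :=
  Summable.of_nonneg_of_le (fun k => cT_nonneg k t) (fun k => cT_le k t) half_hasSum.summable

lemma Tf_cont : Continuous Tf := by
  apply continuous_tsum cT_cont half_hasSum.summable
  intro k t
  rw [Real.norm_eq_abs, abs_of_nonneg (cT_nonneg k t)]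
  exact cT_le k t

lemma Tf_nonneg (t : ℝ) : 0 ≤ Tf t := tsum_nonneg fun k => cT_nonneg k t

lemma Tf_le (t : ℝ) : Tf t ≤ 1 - Real.log 2 := by
  rw [← half_hasSum.tsum_eq]
  exact (cT_summable t).tsum_le_tsum (fun k => cT_le k t) half_hasSum.summable

lemma Tf_zero : Tf 0 = 1 - Real.log 2 := by
  rw [← half_hasSum.tsum_eq]
  unfold Tf cT
  simp

lemma Tf_ge {t : ℝ} (ht : 0 ≤ t) : 1 / 6 * Real.exp (-3 * t) ≤ Tf t := by
  have h := (cT_summable t).le_tsum 0 (fun k _ => cT_nonneg k t)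
  refine le_trans (le_of_eq ?_) h
  unfold cT
  rw [max_eq_left ht]
  norm_num

lemma cT_int {k : ℕ} {σ : ℝ} (hσ : 0 < σ) :
    IntegrableOn (fun t => cT k t * Real.exp (-σ * t)) (Ioi (0:ℝ)) := by
  apply lap_int (cT_cont k) (C := 1 / (2 * ((k:ℝ) + 1) * (2 * ((k:ℝ) + 1) + 1))) (b := 0) _ hσ
  intro t _
  rw [abs_of_nonneg (cT_nonneg k t)]
  simpa using cT_le k t

lemma cT_lap {k : ℕ} {s : ℝ} (hs : 1 < s) :
    ∫ t in Ioi (0:ℝ), cT k t * Real.exp (-(s - 1) * t) =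
      1 / (2 * ((k:ℝ) + 1) * (2 * ((k:ℝ) + 1) + 1)) * (1 / (s + 2 * ((k:ℝ) + 1))) := by
  have h1 : ∫ t in Ioi (0:ℝ), cT k t * Real.exp (-(s - 1) * t) =
      ∫ t in Ioi (0:ℝ), 1 / (2 * ((k:ℝ) + 1) * (2 * ((k:ℝ) + 1) + 1)) *
        Real.exp (-(s + 2 * ((k:ℝ) + 1)) * t) := by
    apply setIntegral_congr_fun measurableSet_Ioi
    intro t ht
    have ht : 0 < t := ht
    simp only [cT]
    rw [max_eq_left ht.le, mul_assoc, ← Real.exp_add]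
    ring_nf
  have hs' : 0 < s + 2 * ((k:ℝ) + 1) := by positivity
  rw [h1, integral_const_mul, integral_exp_mul_Ioi (by linarith)]
  rw [mul_zero, Real.exp_zero, neg_div_neg_eq]

lemma Tf_lap {s : ℝ} (hs : 1 < s) :
    (s * (s - 1)) * ∫ t in Ioi (0:ℝ), Tf t * Real.exp (-(s - 1) * t) =
      s * (1 - Real.log 2) - 1/2 * (psi (s/2) + Real.eulerMascheroniConstant + 2 / s) := by
  have hσ : 0 < s - 1 := by linarith
  have hT := triv_hasSum (s := s) (by linarith)
  have hss : s * (s - 1) ≠ 0 := by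
    have : 0 < s * (s - 1) := by have : 0 < s := by linarith
                                 positivity
    exact this.ne'
  have h := hasSum_integral_of_summable_integral_norm (μ := volume.restrict (Ioi (0:ℝ)))
    (F := fun n t => cT n t * Real.exp (-(s - 1) * t)) (fun n => cT_int hσ) (by
      have : ∀ n t, ‖cT n t * Real.exp (-(s - 1) * t)‖ = cT n t * Real.exp (-(s - 1) * t) :=
        fun n t => by rw [Real.norm_eq_abs, abs_of_nonneg (mul_nonneg (cT_nonneg n t) (Real.exp_pos _).le)]
      simp only [this, cT_lap hs]
      exact (summable_mul_left_iff hss).mp hT.summable)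
  have e1 : ∫ t in Ioi (0:ℝ), ∑' n, cT n t * Real.exp (-(s - 1) * t) =
      ∫ t in Ioi (0:ℝ), Tf t * Real.exp (-(s - 1) * t) := by
    congr 1; funext t
    rw [tsum_mul_right]; rfl
  rw [e1] at h
  simp only [cT_lap hs] at h
  exact (h.mul_left (s * (s - 1))).unique hT

end Cesaro
end

section
namespace Cesaro
open Complex MeasureTheory Set Filter Topology Asymptotics Metric

lemma Gamma_deriv_real {x : ℝ} (hx : 0 < x) :
    deriv Complex.Gamma (x:ℂ) = ((deriv Real.Gamma x : ℝ) : ℂ) := by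
  have hne : ∀ m : ℕ, x ≠ -m := fun m => ne_of_gt (by
    have : (0:ℝ) ≤ m := m.cast_nonneg
    linarith)
  have h1 : HasDerivAt (fun y : ℝ => Complex.Gamma y) (deriv Complex.Gamma (x:ℂ)) x := by
    apply HasDerivAt.comp_ofReal
    apply DifferentiableAt.hasDerivAt
    apply Complex.differentiableAt_Gamma
    intro m h
    apply hne m
    exact_mod_cast h
  have h2 := (Real.differentiableAt_Gamma hne).hasDerivAt.ofReal_comp
  simp only [Complex.Gamma_ofReal] at h1
  exact h1.unique h2

lemma Gammaℝ_logDeriv {s : ℝ} (hs : 0 < s) :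
    logDeriv Gammaℝ (s:ℂ) = ((-(Real.log Real.pi) / 2 + psi (s/2) / 2 : ℝ) : ℂ) := by
  have hpi : (Real.pi : ℂ) ≠ 0 := by exact_mod_cast Real.pi_pos.ne'
  have hs2 : (s:ℂ) / 2 = ((s / 2 : ℝ) : ℂ) := by push_cast; rfl
  have hd : DifferentiableAt ℂ Complex.Gamma ((s:ℂ) / 2) := by
    apply Complex.differentiableAt_Gamma
    intro m h
    have h3 : s / 2 = -(m:ℝ) := by rw [hs2] at h; exact_mod_cast h
    have : (0:ℝ) ≤ m := m.cast_nonneg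
    linarith
  have h1 : HasDerivAt (fun z : ℂ => Complex.Gamma (z / 2))
      (deriv Complex.Gamma ((s:ℂ)/2) * (1 / 2)) (s:ℂ) := by
    exact hd.hasDerivAt.comp (s:ℂ) ((hasDerivAt_id (s:ℂ)).div_const 2)
  have h2 : HasDerivAt (fun z : ℂ => (Real.pi:ℂ) ^ (-z / 2))
      ((Real.pi:ℂ) ^ (-(s:ℂ) / 2) * Complex.log Real.pi * (-1 / 2)) (s:ℂ) := by
    exact HasDerivAt.const_cpow (((hasDerivAt_id (s:ℂ)).neg).div_const 2) (Or.inl hpi)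
  have h3 : HasDerivAt Gammaℝ _ (s:ℂ) := h2.mul h1
  have hp : (Real.pi:ℂ) ^ (-(s:ℂ) / 2) ≠ 0 := by
    rw [Ne, Complex.cpow_eq_zero_iff]; tauto
  have hG : (Real.Gamma (s/2) : ℂ) ≠ 0 := by
    exact_mod_cast (Real.Gamma_pos_of_pos (by positivity)).ne'
  rw [logDeriv_apply, h3.deriv, Gammaℝ_def, psi_eq (by positivity), hs2, Gamma_deriv_real (by positivity),
    Complex.Gamma_ofReal]
  rw [← Complex.ofReal_log Real.pi_pos.le]
  push_cast
  field_simp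

lemma xi_logDeriv {s : ℝ} (hs : 1 < s) :
    deriv xi s / xi s = deriv riemannZeta s / riemannZeta s +
      ((1 / s + 1 / (s - 1) - Real.log Real.pi / 2 + psi (s/2) / 2 : ℝ) : ℂ) := by
  have hs0 : (s:ℂ) ≠ 0 := by exact_mod_cast (by linarith : s ≠ 0)
  have hs1 : (s:ℂ) ≠ 1 := by exact_mod_cast (by linarith : s ≠ 1)
  have hs10 : (s:ℂ) - 1 ≠ 0 := sub_ne_zero.mpr hs1
  have hz : riemannZeta s ≠ 0 := riemannZeta_ne_zero_of_one_le_re (by simpa using hs.le)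
  have hGne : Gammaℝ s ≠ 0 := Gammaℝ_ne_zero_of_re_pos (by simp; linarith)
  have hloc : xi =ᶠ[𝓝 (s:ℂ)] fun z => ((z * (z - 1)) * Gammaℝ z) * riemannZeta z := by
    filter_upwards [(halfplane_open 1).mem_nhds (show (1:ℝ) < (s:ℂ).re by simpa using hs)] with z hz
    have hz : 1 < z.re := hz
    have h1 : z ≠ 1 := by rintro rfl; simp at hz
    have h10 : z - 1 ≠ 0 := sub_ne_zero.mpr h1
    rw [xi_eq (by linarith), riemannZeta_eq_inv_sub_mul h1]
    field_simp
  have dG : DifferentiableAt ℂ Gammaℝ s := by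
    have : DifferentiableAt ℂ (fun z => (Gammaℝ z)⁻¹⁻¹) s :=
      (differentiable_Gammaℝ_inv s).inv (inv_ne_zero hGne)
    simpa using! this
  have dz := differentiableAt_riemannZeta hs1
  have d1 : DifferentiableAt ℂ (fun z : ℂ => z) s := differentiableAt_id
  have d2 : DifferentiableAt ℂ (fun z : ℂ => z - 1) s := by fun_prop
  have d12 : DifferentiableAt ℂ (fun z : ℂ => z * (z - 1)) s := by fun_prop
  have dg : DifferentiableAt ℂ (fun z : ℂ => z * (z - 1) * Gammaℝ z) s := d12.mul dG
  have h1 : deriv xi s / xi s = logDeriv (fun z => ((z * (z - 1)) * Gammaℝ z) * riemannZeta z) s := by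
    rw [logDeriv_apply, hloc.deriv_eq, hloc.eq_of_nhds]
  rw [h1, logDeriv_mul (s:ℂ) (by simp [hs0, hs10, hGne]) hz dg dz,
    logDeriv_mul (s:ℂ) (by simp [hs0, hs10]) hGne d12 dG,
    logDeriv_mul (s:ℂ) hs0 hs10 d1 d2, Gammaℝ_logDeriv (by linarith)]
  have e1 : logDeriv (fun z : ℂ => z) (s:ℂ) = 1 / s := by simp [logDeriv_apply]
  have e2 : logDeriv (fun z : ℂ => z - 1) (s:ℂ) = 1 / (s - 1) := by
    rw [logDeriv_apply]; simp
  rw [e1, e2, logDeriv_apply]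
  push_cast
  ring

lemma xi_deriv_im {x : ℝ} (hx : 0 < x) : (deriv xi x).im = 0 ∧ (xi x).im = 0 := by
  have hr : ∀ y : ℝ, 0 < y → xi y = ((xi y).re : ℂ) := by
    intro y hy
    have h := xi_conj (s := (y:ℂ)) (by simpa using hy)
    rw [conj_ofReal] at h
    exact (Complex.conj_eq_iff_re.mp h.symm).symm
  constructor
  · have h0 := (xi_diff (x:ℂ)).hasDerivAt
    have h1 := h0.comp_ofReal
    have h2 := h0.real_of_complex.ofReal_comp
    have h3 : HasDerivAt (fun y : ℝ => xi y) ((deriv xi x).re : ℂ) x := by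
      apply h2.congr_of_eventuallyEq
      filter_upwards [eventually_gt_nhds hx] with y hy using hr y hy
    rw [h1.unique h3, ofReal_im]
  · rw [hr x hx, ofReal_im]

/-- shifted log derivative of xi -/
noncomputable def Xi (z : ℂ) : ℂ := deriv xi (1/2 + z) / xi (1/2 + z)

lemma half_re (z : ℂ) : (1/2 + z).re = 1/2 + z.re := by
  rw [Complex.add_re]
  congr 1
  norm_num

lemma Xi_diff (RH : RiemannHypothesis) : DifferentiableOn ℂ Xi {z | 0 < z.re} := by
  intro z hz
  have hz : 0 < z.re := hz
  apply DifferentiableAt.differentiableWithinAt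
  unfold Xi
  have hd : Differentiable ℂ (deriv xi) := xi_diff.deriv
  have d0 : DifferentiableAt ℂ (fun z : ℂ => 1/2 + z) z := by fun_prop
  apply DifferentiableAt.div (c := fun z => deriv xi (1/2 + z)) (d := fun z => xi (1/2 + z))
  · exact (hd _).comp z d0
  · exact (xi_diff _).comp z d0
  · exact xi_ne_zero RH (by rw [half_re]; linarith)

lemma Xi_re (RH : RiemannHypothesis) (z : ℂ) (hz : 0 < z.re) : 0 ≤ (Xi z).re :=
  xi_re_nonneg RH (by rw [half_re]; linarith)

lemma Xi_im (x : ℝ) (hx : 0 < x) : (Xi x).im = 0 := by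
  unfold Xi
  have e : (1/2 + (x:ℂ)) = ((1/2 + x : ℝ) : ℂ) := by push_cast; ring
  obtain ⟨h1, h2⟩ := xi_deriv_im (x := 1/2 + x) (by positivity)
  rw [e, Complex.div_im, h1, h2]
  simp

lemma Xi_half : 2 * Xi (1/2) =
    ((2 + Real.eulerMascheroniConstant - Real.log (4 * Real.pi) : ℝ) : ℂ) := by
  unfold Xi
  rw [show (1/2 + 1/2 : ℂ) = 1 by norm_num, xi_one, xi_deriv_one, completedRiemannZeta₀_one]
  push_cast
  rw [Complex.ofReal_log (by positivity)]
  push_cast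
  ring

/-- the function whose Laplace transform is the Pick transform -/
noncomputable def gf (t : ℝ) : ℝ := Real.exp (t / 2) *
  (Sf t - t + (1 + Real.eulerMascheroniConstant) - Real.log (2 * Real.pi) * Real.exp (-t) + Tf t)

lemma gf_cont : Continuous gf := by
  have := Sf_cont
  have := Tf_cont
  unfold gf; fun_prop

lemma gf_bound : ∃ C : ℝ, ∀ t, 0 ≤ t → |gf t| ≤ C * Real.exp (3 / 2 * t) := by
  refine ⟨2 + 1 + |1 + Real.eulerMascheroniConstant| + |Real.log (2 * Real.pi)| + 1, fun t ht => ?_⟩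
  have h1 := Real.one_le_exp ht
  have hT : |Tf t| ≤ 1 * Real.exp t := by
    rw [abs_of_nonneg (Tf_nonneg t)]
    have := Tf_le t
    have := Real.log_pos (show (1:ℝ) < 2 by norm_num)
    linarith
  have hS : |Sf t| ≤ 2 * Real.exp t := by
    rw [abs_of_nonneg (Sf_nonneg t)]; exact Sf_le ht
  have ht' : |t| ≤ 1 * Real.exp t := by
    rw [abs_of_nonneg ht]; linarith [Real.add_one_le_exp t]
  have hc : |1 + Real.eulerMascheroniConstant| ≤ |1 + Real.eulerMascheroniConstant| * Real.exp t :=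
    le_mul_of_one_le_right (abs_nonneg _) h1
  have hl : |Real.log (2 * Real.pi) * Real.exp (-t)| ≤ |Real.log (2 * Real.pi)| * Real.exp t := by
    rw [abs_mul, Real.abs_exp]
    gcongr
    linarith
  unfold gf
  rw [abs_mul, Real.abs_exp, show 3 / 2 * t = t / 2 + t by ring, Real.exp_add]
  have : |Sf t - t + (1 + Real.eulerMascheroniConstant) - Real.log (2 * Real.pi) * Real.exp (-t) + Tf t|
      ≤ (2 + 1 + |1 + Real.eulerMascheroniConstant| + |Real.log (2 * Real.pi)| + 1) * Real.exp t := by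
    refine (abs_add_le _ _).trans ?_
    have a1 := abs_sub (Sf t - t + (1 + Real.eulerMascheroniConstant)) (Real.log (2 * Real.pi) * Real.exp (-t))
    have a2 := abs_add_le (Sf t - t) (1 + Real.eulerMascheroniConstant)
    have a3 := abs_sub (Sf t) t
    linarith
  calc _ ≤ Real.exp (t / 2) * ((2 + 1 + |1 + Real.eulerMascheroniConstant| + |Real.log (2 * Real.pi)| + 1) * Real.exp t) := by gcongr
    _ = _ := by ring

lemma gf_lap {s : ℝ} (hs : 2 < s) : ∫ t in Ioi (0:ℝ), gf t * Real.exp (-(s - 1/2) * t) =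
    (∫ t in Ioi (0:ℝ), Sf t * Real.exp (-(s - 1) * t)) - 1 / (s - 1) ^ 2 +
      (1 + Real.eulerMascheroniConstant) * (1 / (s - 1)) - Real.log (2 * Real.pi) * (1 / s) +
      ∫ t in Ioi (0:ℝ), Tf t * Real.exp (-(s - 1) * t) := by
  have hσ : 0 < s - 1 := by linarith
  have e : ∀ t : ℝ, gf t * Real.exp (-(s - 1/2) * t) =
      Sf t * Real.exp (-(s - 1) * t) - t ^ 1 * Real.exp (-(s - 1) * t) +
      (1 + Real.eulerMascheroniConstant) * (t ^ 0 * Real.exp (-(s - 1) * t)) -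
      Real.log (2 * Real.pi) * (t ^ 0 * Real.exp (-s * t)) + Tf t * Real.exp (-(s - 1) * t) := by
    intro t
    unfold gf
    have e1 : Real.exp (-(s - 1) * t) = Real.exp (t / 2) * Real.exp (-(s - 1/2) * t) := by
      rw [← Real.exp_add]; ring_nf
    have e2 : Real.exp (-s * t) = Real.exp (-t) * Real.exp (-(s - 1) * t) := by
      rw [← Real.exp_add]; ring_nf
    rw [e2, e1]; ring
  have iS : IntegrableOn (fun t => Sf t * Real.exp (-(s - 1) * t)) (Ioi (0:ℝ)) :=
    lap_int Sf_cont (C := 2) (b := 1) (fun t ht => by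
      rw [abs_of_nonneg (Sf_nonneg t), one_mul]; exact Sf_le ht) (by linarith)
  have iT : IntegrableOn (fun t => Tf t * Real.exp (-(s - 1) * t)) (Ioi (0:ℝ)) :=
    lap_int Tf_cont (C := 1 - Real.log 2) (b := 0) (fun t ht => by
      rw [abs_of_nonneg (Tf_nonneg t)]; simpa using Tf_le t) (by linarith)
  have i1 := moment_int (n := 1) hσ
  have i2 := (moment_int (n := 0) hσ).const_mul (1 + Real.eulerMascheroniConstant)
  have i3 := (moment_int (n := 0) (show 0 < s by linarith)).const_mul (Real.log (2 * Real.pi))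
  simp_rw [e]
  rw [integral_add _ iT, integral_sub _ i3, integral_add _ i2, integral_sub iS i1, integral_const_mul,
    integral_const_mul, moment hσ, moment hσ, moment (by linarith)]
  · simp
  · exact iS.sub i1
  · exact (iS.sub i1).add i2
  · exact ((iS.sub i1).add i2).sub i3

lemma gf_pick {x : ℝ} (hx : 3/2 < x) :
    pickG Xi x = ((∫ t in Ioi (0:ℝ), gf t * Real.exp (-x * t) : ℝ) : ℂ) := by
  obtain ⟨s, rfl⟩ : ∃ s : ℝ, x = s - 1/2 := ⟨x + 1/2, by ring⟩
  have hs : 2 < s := by linarith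
  have hs0 : s ≠ 0 := by linarith
  have hs10 : s - 1 ≠ 0 := by intro h; linarith
  have hx2 : (((s - 1/2 : ℝ)) : ℂ) ≠ 1/2 := by
    intro h
    have : s - 1/2 = 1/2 := by
      have h' : (((s - 1/2 : ℝ)) : ℂ) = ((1/2 : ℝ) : ℂ) := by rw [h]; push_cast; rfl
      exact_mod_cast h'
    linarith
  have hXi : Xi ((s - 1/2 : ℝ) : ℂ) = deriv xi s / xi s := by
    unfold Xi
    rw [show (1/2 + ((s - 1/2 : ℝ) : ℂ)) = (s:ℂ) by push_cast; ring]
  rw [pickG_eq hx2, Xi_half, hXi, xi_logDeriv (by linarith)]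
  have hden : (((s - 1/2 : ℝ) : ℂ)) ^ 2 - 1/4 = ((s * (s - 1) : ℝ) : ℂ) := by push_cast; ring
  rw [hden, div_eq_iff (by exact_mod_cast mul_ne_zero hs0 hs10), gf_lap hs]
  have hS := Sf_lap (s := s) (by linarith)
  have hT := Tf_lap (s := s) (by linarith)
  set IS := ∫ t in Ioi (0:ℝ), Sf t * Real.exp (-(s - 1) * t)
  set IT := ∫ t in Ioi (0:ℝ), Tf t * Real.exp (-(s - 1) * t)
  have hz : deriv riemannZeta s / riemannZeta s = -((s * (s - 1) * IS : ℝ) : ℂ) := by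
    rw [hS]; ring
  rw [hz, ← ofReal_neg, ← ofReal_add, ← ofReal_mul, ← ofReal_sub, ← ofReal_mul]
  congr 1
  have l1 : Real.log (4 * Real.pi) = 2 * Real.log 2 + Real.log Real.pi := by
    rw [Real.log_mul (by norm_num) Real.pi_pos.ne', show (4:ℝ) = 2 ^ 2 by norm_num, Real.log_pow]
    push_cast; ring
  have l2 : Real.log (2 * Real.pi) = Real.log 2 + Real.log Real.pi :=
    Real.log_mul (by norm_num) Real.pi_pos.ne'
  rw [l1, l2]
  have key : (IS - 1 / (s - 1) ^ 2 + (1 + Real.eulerMascheroniConstant) * (1 / (s - 1)) -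
      (Real.log 2 + Real.log Real.pi) * (1 / s) + IT) * (s * (s - 1)) =
      s * (s - 1) * IS + s * (s - 1) * IT + (- s / (s - 1) + (1 + Real.eulerMascheroniConstant) * s -
        (Real.log 2 + Real.log Real.pi) * (s - 1)) := by
    field_simp
    ring
  rw [key, hT]
  field_simp
  ring

end Cesaro
end

/-- Assuming the Riemann hypothesis, for all real `x > 1`,
`Σ_{n≤x} (Λ(n)/n)(1 − n/x) ≤ log x − (1 + γ) + (log 2π)/x + 2|B|/√x − 1/(6x³)`. -/
theorem sum_vonMangoldt_cesaro_upper (RH : RiemannHypothesis) (x : ℝ) (hx : 1 < x) :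
    ∑ n ∈ Finset.Icc 1 ⌊x⌋₊,
        ArithmeticFunction.vonMangoldt n / n * (1 - n / x)
      ≤ Real.log x - (1 + Real.eulerMascheroniConstant)
        + Real.log (2 * Real.pi) / x + 2 * |Bconst| / Real.sqrt x - 1 / (6 * x ^ 3) := by
  have hx0 : 0 < x := by linarith
  have ht : 0 < Real.log x := Real.log_pos hx
  obtain ⟨C, hC⟩ := Cesaro.gf_bound
  have main := Cesaro.lap_pick Cesaro.gf_cont hC (Cesaro.pickG_diff (Cesaro.Xi_diff RH))
    (fun z hz => Cesaro.pickG_re (Cesaro.Xi_diff RH) (Cesaro.Xi_re RH) Cesaro.Xi_im hz)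
    (fun y hy => Cesaro.gf_pick hy) ht
  have hS : Cesaro.Sf (Real.log x) =
      ∑ n ∈ Finset.Icc 1 ⌊x⌋₊, ArithmeticFunction.vonMangoldt n / n * (1 - n / x) := by
    rw [Cesaro.Sf_eq (N := ⌊x⌋₊ + 1) (by
      rw [Real.exp_log hx0]; push_cast; exact (Nat.lt_floor_add_one x).le)]
    rw [Finset.sum_range_eq_add_Ico _ (by omega)]
    rw [show Finset.Ico 1 (⌊x⌋₊ + 1) = Finset.Icc 1 ⌊x⌋₊ by ext; simp]
    rw [show Cesaro.aT 0 (Real.log x) = 0 by simp [Cesaro.aT], zero_add]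
    apply Finset.sum_congr rfl
    intro n hn
    rw [Finset.mem_Icc] at hn
    have hn0 : (0:ℝ) < n := by exact_mod_cast hn.1
    have hnx : (n:ℝ) ≤ x := (Nat.le_floor_iff hx0.le).mp hn.2
    unfold Cesaro.aT
    rw [Real.exp_neg, Real.exp_log hx0, ← one_div, max_eq_left]
    · field_simp
    · rw [sub_nonneg]; exact one_div_le_one_div_of_le hn0 hnx
  have hS0 : Cesaro.Sf 0 = 0 := by
    rw [Cesaro.Sf_eq (N := 1) (by simp)]
    simp [Cesaro.aT]
  have l1 : Real.log (4 * Real.pi) = 2 * Real.log 2 + Real.log Real.pi := by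
    rw [Real.log_mul (by norm_num) Real.pi_pos.ne', show (4:ℝ) = 2 ^ 2 by norm_num, Real.log_pow]
    push_cast; ring
  have l2 : Real.log (2 * Real.pi) = Real.log 2 + Real.log Real.pi :=
    Real.log_mul (by norm_num) Real.pi_pos.ne'
  have hg0 : Cesaro.gf 0 = -2 * Bconst := by
    unfold Cesaro.gf Bconst
    rw [hS0, Cesaro.Tf_zero, l1, l2]
    simp
    ring
  have hgx : Cesaro.gf (Real.log x) = Real.sqrt x * (Cesaro.Sf (Real.log x) - Real.log x +
      (1 + Real.eulerMascheroniConstant) - Real.log (2 * Real.pi) / x + Cesaro.Tf (Real.log x)) := by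
    unfold Cesaro.gf
    rw [Real.exp_neg, Real.exp_log hx0, Real.exp_half, Real.exp_log hx0, ← div_eq_mul_inv]
  have hT := Cesaro.Tf_ge ht.le
  have hT3 : Real.exp (-3 * Real.log x) = 1 / x ^ 3 := by
    rw [show -3 * Real.log x = -(Real.log (x ^ 3)) by rw [Real.log_pow]; push_cast; ring,
      Real.exp_neg, Real.exp_log (by positivity), one_div]
  rw [hT3] at hT
  rw [hg0, hgx, hS] at main
  have hsq : 0 < Real.sqrt x := Real.sqrt_pos.mpr hx0
  rw [mul_comm, ← le_div_iff₀ hsq] at main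
  have hB : -2 * Bconst / Real.sqrt x ≤ 2 * |Bconst| / Real.sqrt x := by
    apply div_le_div_of_nonneg_right _ hsq.le
    linarith [neg_abs_le Bconst]
  have e6 : 1 / (6 * x ^ 3) = 1 / 6 * (1 / x ^ 3) := by field_simp
  rw [e6]
  linarith
end

section
/- Assume the Riemann hypothesis. Then for all real x ≥ 81 and all real t one has Re Σ_{n ≤ x} Λ(n) n^{−it} ( 1/(n log n) − 1/(x log x) ) ≥ − Σ_{n ≤ x} (Λ(n)/(n log n)) · (log(x/n)/log x) − (1/log x) Σ_{n ≤ x} (Λ(n)/n)(1 − n/x) + log ζ(2) − 0.249/√x − 2/(√x log x). -/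
open Complex


namespace TVM

lemma sin_sq_nat_mul (n : ℕ) (a : ℝ) : Real.sin (n * a) ^ 2 ≤ (n : ℝ) ^ 2 * Real.sin a ^ 2 := by
  have h : |Real.sin (n * a)| ≤ n * |Real.sin a| := by
    induction n with
    | zero => simp
    | succ n ih =>
      have e : ((n + 1 : ℕ) : ℝ) * a = n * a + a := by push_cast; ring
      rw [e, Real.sin_add]
      have h1 : |Real.sin (n * a) * Real.cos a| ≤ |Real.sin (n * a)| := by
        rw [abs_mul]; exact mul_le_of_le_one_right (abs_nonneg _) (Real.abs_cos_le_one _)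
      have h2 : |Real.cos (n * a) * Real.sin a| ≤ |Real.sin a| := by
        rw [abs_mul]; exact mul_le_of_le_one_left (abs_nonneg _) (Real.abs_cos_le_one _)
      have := abs_add_le (Real.sin (n * a) * Real.cos a) (Real.cos (n * a) * Real.sin a)
      push_cast
      linarith
  have := pow_le_pow_left₀ (abs_nonneg _) h 2
  rwa [sq_abs, mul_pow, sq_abs] at this

/-- The difference of cosines, in terms of `sin ^ 2`. -/
lemma cos_diff (k : ℕ) (a : ℝ) :
    Real.cos (k * (2 * a + Real.pi)) - (-1) ^ k = (-1) ^ (k + 1) * (2 * Real.sin (k * a) ^ 2) := by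
  have e : (k : ℝ) * (2 * a + Real.pi) = 2 * (k * a) + k * Real.pi := by ring
  rw [e, Real.cos_add_nat_mul_pi, Real.cos_two_mul, Real.sin_sq]
  ring

/-- Tails of the sum over even `k` of `k * r ^ k`. -/
noncomputable def evenTail (r : ℝ) (k : ℕ) : ℝ :=
  if Even k then r ^ k * (k / (1 - r ^ 2) + 2 * r ^ 2 / (1 - r ^ 2) ^ 2)
  else r ^ (k + 1) * ((k + 1) / (1 - r ^ 2) + 2 * r ^ 2 / (1 - r ^ 2) ^ 2)

lemma evenTail_nonneg {r : ℝ} (h0 : 0 ≤ r) (h1 : r < 1) (k : ℕ) : 0 ≤ evenTail r k := by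
  have : 0 < 1 - r ^ 2 := by nlinarith
  unfold evenTail
  split_ifs <;> positivity

lemma evenTail_step {r : ℝ} (h0 : 0 ≤ r) (h1 : r < 1) (k : ℕ) :
    (if Even k then k * r ^ k else 0) = evenTail r k - evenTail r (k + 1) := by
  have : 0 < 1 - r ^ 2 := by nlinarith
  unfold evenTail
  by_cases h : Even k
  · have h' : ¬ Even (k + 1) := by simpa [Nat.even_add_one] using h
    rw [if_pos h, if_pos h, if_neg h']
    push_cast
    field_simp
    ring
  · have h' : Even (k + 1) := by simpa [Nat.even_add_one] using h
    rw [if_neg h, if_neg h, if_pos h']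
    push_cast
    ring

lemma even_sum_le {r : ℝ} (h0 : 0 ≤ r) (h1 : r < 1) (m n : ℕ) (hmn : m ≤ n) :
    ∑ k ∈ Finset.Ico m n, (if Even k then (k : ℝ) * r ^ k else 0) ≤ evenTail r m := by
  have : ∑ k ∈ Finset.Ico m n, (if Even k then (k : ℝ) * r ^ k else 0)
      = evenTail r m - evenTail r n := by
    induction n, hmn using Nat.le_induction with
    | base => simp
    | succ n hmn ih => rw [Finset.sum_Ico_succ_top hmn, ih, evenTail_step h0 h1]; ring
  linarith [evenTail_nonneg h0 h1 n]

/-- Lower bound for a single term. -/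
lemma term_lower {r c : ℝ} (k : ℕ) (a : ℝ) (hk : 1 ≤ k) (hc0 : 0 ≤ c) (hc : c ≤ r ^ k / k) :
    -((if Even k then (k : ℝ) * r ^ k else 0) * (2 * Real.sin a ^ 2)) ≤
      c * (Real.cos (k * (2 * a + Real.pi)) - (-1) ^ k) := by
  rw [cos_diff]
  have hkp : (0 : ℝ) < k := by exact_mod_cast hk
  by_cases h : Even k
  · rw [if_pos h, pow_succ (-1 : ℝ) k, h.neg_one_pow]
    have h1 := sin_sq_nat_mul k a
    have h2 : c * Real.sin (k * a) ^ 2 ≤ r ^ k / k * ((k : ℝ) ^ 2 * Real.sin a ^ 2) :=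
      mul_le_mul hc h1 (sq_nonneg _) (le_trans hc0 hc)
    have h3 : r ^ k / k * ((k : ℝ) ^ 2 * Real.sin a ^ 2) = k * r ^ k * Real.sin a ^ 2 := by
      field_simp
    nlinarith
  · rw [if_neg h, (Nat.not_even_iff_odd.mp h).add_one.neg_one_pow]
    simp only [zero_mul, neg_zero, one_mul]
    positivity

lemma sin_two_sq (a : ℝ) : Real.sin (2 * a) ^ 2 =
    4 * Real.sin a ^ 2 * (1 - Real.sin a ^ 2) := by
  rw [Real.sin_two_mul, mul_pow, mul_pow, Real.cos_sq']; ring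

lemma sin_three_sq (a : ℝ) : Real.sin (3 * a) ^ 2 =
    Real.sin a ^ 2 * (3 - 4 * Real.sin a ^ 2) ^ 2 := by
  rw [Real.sin_three_mul]; ring

lemma sin_four_sq (a : ℝ) : Real.sin (4 * a) ^ 2 =
    16 * Real.sin a ^ 2 * (1 - Real.sin a ^ 2) * (1 - 2 * Real.sin a ^ 2) ^ 2 := by
  have : 4 * a = 2 * (2 * a) := by ring
  rw [this, sin_two_sq, sin_two_sq]; ring

lemma sin_five_sq (a : ℝ) : Real.sin (5 * a) ^ 2 =
    Real.sin a ^ 2 * (5 - 20 * Real.sin a ^ 2 + 16 * Real.sin a ^ 4) ^ 2 := by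
  have : 5 * a = 2 * a + 3 * a := by ring
  have h : Real.sin (5 * a) = Real.sin a * (5 - 20 * Real.sin a ^ 2 + 16 * Real.sin a ^ 4) := by
    rw [this, Real.sin_add, Real.sin_two_mul, Real.cos_two_mul, Real.cos_three_mul,
      Real.sin_three_mul]
    have hc : Real.cos a ^ 2 = 1 - Real.sin a ^ 2 := Real.cos_sq' a
    have hc4 : Real.cos a ^ 4 = (1 - Real.sin a ^ 2) ^ 2 := by rw [← hc]; ring
    ring_nf
    rw [hc, hc4]; ring
  rw [h, mul_pow]

lemma poly_two {s d : ℝ} (h0 : 0 ≤ s) (h1 : s ≤ 1) (hd0 : 0 ≤ d) (hd : d ≤ 1 / 486) :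
    5 / 36 ≤ (1 / 2 - d) - (1 / 8 - d) * (4 * (1 - s)) + (1 / 24 - d) * (3 - 4 * s) ^ 2
      - (1 / 64 - d) * (16 * (1 - s) * (1 - 2 * s) ^ 2)
      + (1 / 160 - d) * (5 - 20 * s + 16 * s ^ 2) ^ 2 := by
  have key : ∀ s : ℝ, 0 ≤ s → s ≤ 1 → 5 / 36 + 35 / 486 ≤ 1 / 2 - 1 / 8 * (4 * (1 - s))
      + 1 / 24 * (3 - 4 * s) ^ 2 - 1 / 64 * (16 * (1 - s) * (1 - 2 * s) ^ 2)
      + 1 / 160 * (5 - 20 * s + 16 * s ^ 2) ^ 2 := by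
    intro s h0 h1
    nlinarith [sq_nonneg (16 * s ^ 2 - 20 * s + 5), sq_nonneg (s ^ 2 - s * 5 / 4 + 1/5),
      mul_nonneg h0 (sub_nonneg.2 h1), mul_nonneg h0 (sq_nonneg (s - 1/5)),
      mul_nonneg h0 (sq_nonneg (s - 1/2)),
      mul_nonneg (sub_nonneg.2 h1) (sq_nonneg (s - 1/5)), sq_nonneg (s - 1/5), sq_nonneg (s-1/6),
      mul_nonneg h0 (sq_nonneg (s - 1))]
  have k := key s h0 h1
  have b1 : 0 ≤ 4 * (1 - s) := by linarith
  have b2 : 0 ≤ 16 * (1 - s) * (1 - 2 * s) ^ 2 :=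
    mul_nonneg (by linarith) (sq_nonneg _)
  have b3 : (3 - 4 * s) ^ 2 ≤ 9 := by nlinarith
  have b5 : (5 - 20 * s + 16 * s ^ 2) ^ 2 ≤ 25 := by
    have e : (25 : ℝ) = 5 ^ 2 := by norm_num
    rw [e]
    apply sq_le_sq' <;> nlinarith [sq_nonneg (s - 5/8)]
  nlinarith [mul_nonneg hd0 b1, mul_nonneg hd0 b2, mul_nonneg hd0 (sub_nonneg.2 b3),
    mul_nonneg hd0 (sub_nonneg.2 b5)]


lemma coef_nonneg {p : ℕ} (hp : p.Prime) {x : ℝ} (hx : 81 ≤ x) {k : ℕ} (hk : 1 ≤ k)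
    (hkx : (p : ℝ) ^ k ≤ x) : 0 ≤ ((1 / p : ℝ)) ^ k / k - Real.log p / (x * Real.log x) := by
  have hp1 : (1 : ℝ) < p := by exact_mod_cast hp.one_lt
  have hlp : 0 < Real.log p := Real.log_pos hp1
  have hlx : 0 < Real.log x := Real.log_pos (by linarith)
  have hkp : (0 : ℝ) < k := by exact_mod_cast hk
  have h1 : k * Real.log p ≤ Real.log x := by
    rw [← Real.log_pow]; exact Real.log_le_log (by positivity) hkx
  have hpk : (0 : ℝ) < (p : ℝ) ^ k := by positivity
  rw [sub_nonneg, div_pow, one_pow, div_div, div_le_div_iff₀ (by positivity) (by positivity)]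
  have := mul_le_mul hkx h1 (by positivity) (by positivity)
  linarith

lemma prime_ineq {p : ℕ} (hp : p.Prime) {x : ℝ} (hx : 81 ≤ x) (θ : ℝ) (K : ℕ)
    (hK : (p : ℝ) ^ K ≤ x) (h2 : p = 2 → 6 ≤ K) :
    0 ≤ ∑ k ∈ Finset.Ico 1 (K + 1), (((1 / p : ℝ)) ^ k / k - Real.log p / (x * Real.log x)) *
      (Real.cos (k * θ) - (-1) ^ k) := by
  obtain ⟨a, rfl⟩ : ∃ a, θ = 2 * a + Real.pi := ⟨(θ - Real.pi) / 2, by ring⟩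
  have hp1 : (1 : ℝ) < p := by exact_mod_cast hp.one_lt
  have hlp : 0 < Real.log p := Real.log_pos hp1
  have hlx : 0 < Real.log x := Real.log_pos (by linarith)
  set r : ℝ := 1 / p with hr
  have hr0 : 0 < r := by positivity
  have hr1 : r < 1 := by rw [hr, div_lt_one (by linarith)]; exact hp1
  set d := Real.log p / (x * Real.log x) with hd
  have hd0 : 0 < d := by positivity
  set s := Real.sin a ^ 2 with hs
  have hs0 : 0 ≤ s := sq_nonneg _
  have hs1 : s ≤ 1 := Real.sin_sq_le_one a
  have hc : ∀ k, 1 ≤ k → k ≤ K → 0 ≤ r ^ k / k - d := fun k hk hkK =>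
    coef_nonneg hp hx hk (le_trans (pow_le_pow_right₀ hp1.le hkK) hK)
  have tail : ∀ m, 1 ≤ m → m ≤ K + 1 → -(evenTail r m * (2 * s)) ≤
      ∑ k ∈ Finset.Ico m (K + 1), (r ^ k / k - d) *
      (Real.cos (k * (2 * a + Real.pi)) - (-1) ^ k) := by
    intro m hm hmK
    have h1 := even_sum_le hr0.le hr1 m (K + 1) hmK
    have h3 : ∑ k ∈ Finset.Ico m (K + 1),
        -((if Even k then (k : ℝ) * r ^ k else 0) * (2 * s)) ≤
        ∑ k ∈ Finset.Ico m (K + 1), (r ^ k / k - d) *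
          (Real.cos (k * (2 * a + Real.pi)) - (-1) ^ k) := by
      apply Finset.sum_le_sum
      intro k hk
      rw [Finset.mem_Ico] at hk
      exact term_lower k a (by omega) (hc k (by omega) (by omega)) (by linarith)
    rw [Finset.sum_neg_distrib, ← Finset.sum_mul] at h3
    refine le_trans ?_ h3
    apply neg_le_neg
    gcongr
  rcases Nat.lt_or_ge K 2 with hK2 | hK2
  · apply Finset.sum_nonneg
    intro k hk
    rw [Finset.mem_Ico] at hk
    obtain rfl : k = 1 := by omega
    apply mul_nonneg (hc 1 le_rfl (by omega))
    norm_num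
    linarith [Real.cos_le_one (2 * a)]
  have hpx : (p : ℝ) ^ 2 ≤ x := le_trans (pow_le_pow_right₀ hp1.le hK2) hK
  rcases hp.two_le.eq_or_lt with hp2 | hp3
  · have hK6 := h2 hp2.symm
    subst hp2
    have ht := tail 6 (by norm_num) (by omega)
    have hd1 : d ≤ 1 / 486 := by
      have h6 : 6 * Real.log 2 ≤ Real.log x := by
        have : (6 : ℝ) * Real.log 2 = Real.log (2 ^ 6) := by rw [Real.log_pow]; norm_num
        rw [this]
        exact Real.log_le_log (by norm_num) (by linarith)
      rw [hd, div_le_div_iff₀ (by positivity) (by norm_num)]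
      push_cast at hlp ⊢
      nlinarith
    have hpoly := poly_two hs0 hs1 hd0.le hd1
    have split : ∀ f : ℕ → ℝ, ∑ k ∈ Finset.Ico 1 (K + 1), f k =
        f 1 + f 2 + f 3 + f 4 + f 5 + ∑ k ∈ Finset.Ico 6 (K + 1), f k := by
      intro f
      rw [← Finset.sum_Ico_consecutive f (by norm_num : 1 ≤ 6) (by omega : 6 ≤ K + 1)]
      congr 1
      simp [Finset.sum_Ico_eq_sum_range, Finset.sum_range_succ]
    rw [split]
    have hr2 : r = 1 / 2 := by rw [hr]; norm_num
    have hT : evenTail r 6 = 5 / 36 := by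
      rw [evenTail, if_pos (by decide), hr2]; norm_num
    rw [hT] at ht
    have c1 := cos_diff 1 a
    have c2 := cos_diff 2 a
    have c3 := cos_diff 3 a
    have c4 := cos_diff 4 a
    have c5 := cos_diff 5 a
    rw [c1, c2, c3, c4, c5]
    push_cast
    rw [sin_two_sq, sin_three_sq, sin_four_sq, sin_five_sq, one_mul,
      (by ring : Real.sin a ^ 4 = (Real.sin a ^ 2) ^ 2), ← hs, hr2]
    have := mul_nonneg hs0 (sub_nonneg.2 hpoly)
    rw [hr2] at ht
    push_cast at ht
    refine le_trans ?_ (add_le_add_right ht _)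
    norm_num
    nlinarith
  · have hp3' : (3 : ℝ) ≤ p := by exact_mod_cast hp3
    rw [Finset.sum_eq_sum_Ico_succ_bot (by omega)]
    have ht := tail 2 (by norm_num) (by omega)
    have c1 := cos_diff 1 a
    rw [c1]
    refine le_trans ?_ (add_le_add_right ht _)
    simp only [Nat.cast_one, one_mul, pow_one, div_one]
    rw [← hs]
    have hr3 : r ≤ 1 / 3 := by rw [hr]; exact one_div_le_one_div_of_le (by norm_num) hp3'
    have hd1 : d ≤ r / 18 := by
      have hl2 : 2 * Real.log p ≤ Real.log x := by
        have : (2 : ℝ) * Real.log p = Real.log ((p : ℝ) ^ 2) := by rw [Real.log_pow]; norm_num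
        rw [this]
        exact Real.log_le_log (by positivity) hpx
      have h9 : 9 * (p : ℝ) ≤ x := by nlinarith [sq_nonneg ((p : ℝ) - 9)]
      rw [hd, hr, div_div, div_le_div_iff₀ (by positivity) (by positivity)]
      nlinarith [mul_nonneg (sub_nonneg.2 h9) hlx.le]
    have hT : evenTail r 2 ≤ 81 / 32 * r ^ 2 := by
      rw [evenTail, if_pos (by decide)]
      have hq : r ^ 2 ≤ 1 / 9 := by nlinarith
      have e1 : ((2 : ℕ) : ℝ) / (1 - r ^ 2) + 2 * r ^ 2 / (1 - r ^ 2) ^ 2 =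
          2 / (1 - r ^ 2) ^ 2 := by
        have : 1 - r ^ 2 ≠ 0 := by nlinarith
        field_simp
        push_cast
        ring
      rw [e1, mul_comm]
      apply mul_le_mul_of_nonneg_right _ (sq_nonneg r)
      rw [div_le_iff₀ (by nlinarith)]
      nlinarith
    have : 0 ≤ (r - d - evenTail r 2) * (2 * s) := by
      apply mul_nonneg _ (by positivity)
      nlinarith
    norm_num
    linarith

end TVM


namespace TVM
open ArithmeticFunction

lemma sum_by_primes (g : ℕ → ℝ) (N : ℕ) (hg : ∀ n, ¬ IsPrimePow n → g n = 0) :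
    ∑ n ∈ Finset.Icc 1 N, g n =
      ∑ p ∈ (Finset.Icc 1 N).filter Nat.Prime, ∑ k ∈ Finset.Ico 1 (Nat.log p N + 1), g (p ^ k) := by
  rw [Finset.sum_sigma']
  symm
  rcases Nat.eq_zero_or_pos N with rfl | hN
  · simp only [zero_lt_one, Finset.Icc_eq_empty_of_lt, Finset.filter_empty, Finset.sum_empty]
    exact Finset.sum_eq_zero (by simp)
  refine Finset.sum_bij_ne_zero (fun q _ _ => q.1 ^ q.2) ?_ ?_ ?_ ?_
  · rintro ⟨p, k⟩ h _
    simp only [Finset.mem_sigma, Finset.mem_filter, Finset.mem_Icc, Finset.mem_Ico] at h ⊢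
    exact ⟨Nat.one_le_pow _ _ h.1.2.pos, Nat.pow_le_of_le_log (by omega) (by omega)⟩
  · rintro ⟨p, k⟩ h _ ⟨q, l⟩ h' _ he
    simp only [Finset.mem_sigma, Finset.mem_filter, Finset.mem_Icc, Finset.mem_Ico] at h h' he
    obtain ⟨rfl, rfl⟩ := Nat.Prime.pow_inj' h.1.2 h'.1.2 (by omega) (by omega) he
    rfl
  · intro n hn hne
    have hpp : IsPrimePow n := by
      by_contra hc
      exact hne (hg n hc)
    obtain ⟨p, k, hp, hk, rfl⟩ := hpp
    rw [Finset.mem_Icc] at hn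
    have hp' := hp.nat_prime
    refine ⟨⟨p, k⟩, ?_, hne, rfl⟩
    simp only [Finset.mem_sigma, Finset.mem_filter, Finset.mem_Icc, Finset.mem_Ico]
    refine ⟨⟨⟨hp'.pos, le_trans (Nat.le_self_pow hk.ne' p) hn.2⟩, hp'⟩, hk, ?_⟩
    exact Nat.lt_succ_of_le (Nat.le_log_of_pow_le hp'.one_lt hn.2)
  · intros; rfl

lemma twisted_ge_sign (x t : ℝ) (hx : 81 ≤ x) :
    0 ≤ ∑ n ∈ Finset.Icc 1 ⌊x⌋₊, Λ n * (1 / (n * Real.log n) - 1 / (x * Real.log x)) *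
      (Real.cos (t * Real.log n) - (-1) ^ (cardFactors n)) := by
  rw [sum_by_primes]
  · apply Finset.sum_nonneg
    intro p hp
    rw [Finset.mem_filter, Finset.mem_Icc] at hp
    obtain ⟨⟨_, hpN⟩, hp⟩ := hp
    have hN0 : ⌊x⌋₊ ≠ 0 := by have := hp.pos; omega
    have h := prime_ineq hp hx (t * Real.log p) (Nat.log p ⌊x⌋₊)
      (by
        have := Nat.pow_log_le_self p hN0
        have h2 : ((p ^ Nat.log p ⌊x⌋₊ : ℕ) : ℝ) ≤ x :=
          le_trans (by exact_mod_cast this) (Nat.floor_le (by linarith))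
        exact_mod_cast h2)
      (by
        rintro rfl
        apply Nat.le_log_of_pow_le (by norm_num)
        apply Nat.le_floor
        norm_num; linarith)
    refine le_of_le_of_eq h ?_
    apply Finset.sum_congr rfl
    intro k hk
    rw [Finset.mem_Ico] at hk
    have hk0 : k ≠ 0 := by omega
    have hp1 : (1 : ℝ) < p := by exact_mod_cast hp.one_lt
    have hlp : 0 < Real.log p := Real.log_pos hp1
    have hkp : (0 : ℝ) < k := by exact_mod_cast hk.1
    rw [vonMangoldt_apply_pow hk0, vonMangoldt_apply_prime hp, cardFactors_apply_prime_pow hp]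
    push_cast
    rw [Real.log_pow]
    have e1 : t * (k * Real.log p) = k * (t * Real.log p) := by ring
    rw [e1]
    congr 1
    have hpk : (0 : ℝ) < (p : ℝ) ^ k := by positivity
    have hlx : 0 < Real.log x := Real.log_pos (by linarith)
    rw [div_pow, one_pow]
    field_simp
  · intro n hn
    rw [vonMangoldt_eq_zero_iff.2 hn]; simp

lemma even_part (x : ℝ) (hx : 81 ≤ x) :
    ∑ n ∈ Finset.Icc 1 ⌊x⌋₊, Λ n * (1 / (n * Real.log n) - 1 / (x * Real.log x)) *
      (1 + (-1) ^ (cardFactors n)) =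
    ∑ m ∈ Finset.Icc 1 ⌊√x⌋₊, (Λ m / (m ^ 2 * Real.log m) - 2 * Λ m / (x * Real.log x)) := by
  symm
  have hx0 : (0 : ℝ) ≤ x := by linarith
  refine Finset.sum_bij_ne_zero (fun m _ _ => m ^ 2) ?_ ?_ ?_ ?_
  · intro m hm _
    rw [Finset.mem_Icc] at hm ⊢
    refine ⟨Nat.one_le_pow _ _ hm.1, Nat.le_floor ?_⟩
    have := (Nat.le_floor_iff (Real.sqrt_nonneg x)).1 hm.2
    push_cast
    exact (Real.le_sqrt (by positivity) hx0).1 this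
  · intro a _ _ b _ _ h
    exact Nat.pow_left_injective (by norm_num : 2 ≠ 0) h
  · intro n hn hne
    have hpp : IsPrimePow n := by
      by_contra hc
      exact hne (by rw [vonMangoldt_eq_zero_iff.2 hc]; simp)
    obtain ⟨p, k, hp, hk, rfl⟩ := hpp
    rw [cardFactors_apply_prime_pow hp.nat_prime] at hne
    have hev : Even k := by
      by_contra hc
      apply hne
      rw [(Nat.not_even_iff_odd.mp hc).neg_one_pow]; simp
    obtain ⟨j, rfl⟩ := hev
    rw [Finset.mem_Icc] at hn
    have hp' := hp.nat_prime
    have hj0 : j ≠ 0 := by omega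
    have hp1 : (1 : ℝ) < p := by exact_mod_cast hp'.one_lt
    refine ⟨p ^ j, ?_, ?_, by ring⟩
    · rw [Finset.mem_Icc]
      refine ⟨Nat.one_le_pow _ _ hp'.pos, Nat.le_floor ?_⟩
      apply Real.le_sqrt_of_sq_le
      have := (Nat.le_floor_iff hx0).1 hn.2
      push_cast at this ⊢
      rw [← pow_mul, mul_two]; exact this
    · intro hz
      apply hne
      have hlp : 0 < Real.log p := Real.log_pos hp1
      have hkp : (0 : ℝ) < j := by exact_mod_cast Nat.pos_of_ne_zero hj0
      rw [vonMangoldt_apply_pow hj0] at hz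
      rw [vonMangoldt_apply_pow (by omega), ← mul_two, pow_mul]
      push_cast at hz ⊢
      rw [Real.log_pow ]
      simp only [even_two, Even.neg_pow, one_pow, mul_comm j 2, pow_mul]
      rw [← hz, Nat.cast_ofNat]
      ring
  · intro m hm hne
    rw [vonMangoldt_apply_pow (by norm_num)]
    rw [cardFactors_pow, pow_mul]
    push_cast
    rw [Real.log_pow]
    norm_num
    ring

end TVM


namespace TVM
open ArithmeticFunction

/-- The terms of the Dirichlet series of `log ζ` at `2`. -/
noncomputable def aa (m : ℕ) : ℝ := Λ m / (m ^ 2 * Real.log m)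

lemma aa_nonneg (m : ℕ) : 0 ≤ aa m := by
  unfold aa
  have : 0 ≤ Real.log m := Real.log_natCast_nonneg m
  have := @vonMangoldt_nonneg m
  positivity

lemma prime_q (p : Nat.Primes) : 0 < ((p : ℝ) ^ 2)⁻¹ ∧ ((p : ℝ) ^ 2)⁻¹ ≤ 1 / 4 := by
  have : (2 : ℝ) ≤ p := by exact_mod_cast p.2.two_le
  refine ⟨by positivity, ?_⟩
  rw [inv_eq_one_div]
  apply one_div_le_one_div_of_le (by norm_num)
  nlinarith

lemma summable_primes_log :
    Summable (fun p : Nat.Primes => -Real.log (1 - ((p : ℝ) ^ 2)⁻¹)) := by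
  have h1 : Summable (fun n : ℕ => ((n : ℝ) ^ 2)⁻¹) := Real.summable_nat_pow_inv.2 (by norm_num)
  have h2 : Summable (fun p : Nat.Primes => 2 * ((p : ℝ) ^ 2)⁻¹) :=
    (h1.comp_injective Nat.Primes.coe_nat_injective).mul_left 2
  refine Summable.of_nonneg_of_le ?_ ?_ h2
  · intro p
    obtain ⟨h0, h4⟩ := prime_q p
    exact neg_nonneg.2 (Real.log_nonpos (by linarith) (by linarith))
  · intro p
    obtain ⟨h0, h4⟩ := prime_q p
    have := Real.one_sub_inv_le_log_of_pos (x := 1 - ((p : ℝ) ^ 2)⁻¹) (by linarith)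
    have h5 : (1 - ((p : ℝ) ^ 2)⁻¹)⁻¹ ≤ 1 + 2 * ((p : ℝ) ^ 2)⁻¹ := by
      rw [inv_le_iff_one_le_mul₀ (by linarith)]
      nlinarith
    linarith

lemma tsum_primes_log :
    ∑' p : Nat.Primes, -Real.log (1 - ((p : ℝ) ^ 2)⁻¹) = Real.log (Real.pi ^ 2 / 6) := by
  have h := riemannZeta_eulerProduct_exp_log (s := 2) (by norm_num)
  rw [riemannZeta_two] at h
  have e : ∀ p : Nat.Primes, -Complex.log (1 - (p : ℂ) ^ (-(2 : ℂ))) =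
      ((-Real.log (1 - ((p : ℝ) ^ 2)⁻¹) : ℝ) : ℂ) := by
    intro p
    obtain ⟨h0, h4⟩ := prime_q p
    rw [Complex.ofReal_neg, Complex.ofReal_log (by linarith), Complex.cpow_neg]
    push_cast
    norm_num
  simp_rw [e] at h
  rw [← Complex.ofReal_tsum, ← Complex.ofReal_exp] at h
  have h' : Real.exp (∑' p : Nat.Primes, -Real.log (1 - ((p : ℝ) ^ 2)⁻¹)) = Real.pi ^ 2 / 6 := by
    exact_mod_cast h
  rw [← h', Real.log_exp]

lemma hasSum_aa : HasSum aa (Real.log (Real.pi ^ 2 / 6)) := by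
  set F : Nat.Primes × ℕ → ℝ := fun q => (((q.1 : ℝ) ^ 2)⁻¹) ^ (q.2 + 1) / (q.2 + 1) with hF
  have hfib : ∀ p : Nat.Primes, HasSum (fun k => F (p, k)) (-Real.log (1 - ((p : ℝ) ^ 2)⁻¹)) := by
    intro p
    obtain ⟨h0, h4⟩ := prime_q p
    have h1 : |((p : ℝ) ^ 2)⁻¹| < 1 := by rw [abs_of_pos h0]; linarith
    have h2 := Real.hasSum_pow_div_log_of_abs_lt_one h1
    simp only [hF]
    exact h2
  have hFnn : 0 ≤ F := by
    intro q
    simp only [hF, Pi.zero_apply]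
    positivity
  have hsF : Summable F := by
    rw [summable_prod_of_nonneg hFnn]
    refine ⟨fun p => (hfib p).summable, ?_⟩
    simp_rw [fun p => (hfib p).tsum_eq]
    exact summable_primes_log
  have hF1 : HasSum F (Real.log (Real.pi ^ 2 / 6)) := by
    rw [← tsum_primes_log]
    convert hsF.hasSum using 1
    rw [hsF.tsum_prod' (fun p => (hfib p).summable)]
    simp_rw [fun p => (hfib p).tsum_eq]
  have hcomp : F = (aa ∘ Subtype.val) ∘ Nat.Primes.prodNatEquiv := by
    funext ⟨p, k⟩
    have hp1 : (1 : ℝ) < p := by exact_mod_cast p.2.one_lt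
    have hlp : 0 < Real.log p := Real.log_pos hp1
    simp only [hF, Function.comp, Nat.Primes.prodNatEquiv_apply, aa]
    rw [vonMangoldt_apply_pow (by omega), vonMangoldt_apply_prime p.2]
    push_cast
    rw [Real.log_pow]
    push_cast
    rw [inv_pow, ← pow_mul, ← pow_mul, mul_comm 2 (k + 1)]
    field_simp
  rw [hcomp, Equiv.hasSum_iff] at hF1
  refine (hasSum_subtype_iff_of_support_subset (s := {n | IsPrimePow n}) ?_).1 hF1
  intro n hn
  by_contra hc
  apply hn
  have hc' : ¬ IsPrimePow n := hc
  rw [aa, vonMangoldt_eq_zero_iff.2 hc', zero_div]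

/-- `R n`: the tail of the series. -/
noncomputable def RR (n : ℕ) : ℝ := Real.log (Real.pi ^ 2 / 6) - ∑ m ∈ Finset.Icc 1 n, aa m

lemma RR_succ (n : ℕ) : RR (n + 1) = RR n - aa (n + 1) := by
  unfold RR
  rw [Finset.sum_Icc_succ_top (by omega)]; ring

/-- The weight. -/
noncomputable def ff (y : ℝ) : ℝ := 1 / (y ^ 2 * Real.log y)

lemma ff_anti {a b : ℝ} (ha : 1 < a) (hab : a ≤ b) : ff b ≤ ff a := by
  unfold ff
  have h1 : 0 < Real.log a := Real.log_pos ha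
  have h2 : Real.log a ≤ Real.log b := Real.log_le_log (by linarith) hab
  gcongr

lemma psi_succ (n : ℕ) : Chebyshev.psi ((n + 1 : ℕ) : ℝ) = Chebyshev.psi n + Λ (n + 1) := by
  unfold Chebyshev.psi
  rw [Nat.floor_natCast, Nat.floor_natCast, Finset.sum_Ioc_succ_top (by omega)]

lemma aa_eq (m : ℕ) : aa m = Λ m * ff m := by unfold aa ff; ring

lemma partial_tail {c : ℝ} (hc : 0 ≤ c) (n : ℕ) (hn : 2 ≤ n)
    (hpsi : ∀ m : ℕ, n ≤ m → Chebyshev.psi m ≤ c * m) (M : ℕ) (hM : n ≤ M) :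
    ∑ m ∈ Finset.Ioc n M, aa m + Chebyshev.psi n * ff n + (c * M - Chebyshev.psi M) * ff M ≤
      c * (n * ff n + (1 / (n * Real.log n) - 1 / (M * Real.log M))) := by
  induction M, hM using Nat.le_induction with
  | base => simp; ring_nf; exact le_rfl
  | succ M hM ih =>
    rw [Finset.sum_Ioc_succ_top hM, psi_succ, aa_eq]
    have hM1 : (1 : ℝ) < M := by exact_mod_cast (by omega : 1 < M)
    have hanti : ff ((M + 1 : ℕ) : ℝ) ≤ ff M := ff_anti hM1 (by push_cast; linarith)
    have hp := hpsi M hM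
    have hf : ff ((M + 1 : ℕ) : ℝ) ≤
        1 / (M * Real.log M) - 1 / (((M + 1 : ℕ) : ℝ) * Real.log ((M + 1 : ℕ) : ℝ)) := by
      unfold ff
      have h1 : 0 < Real.log M := Real.log_pos hM1
      have h2 : Real.log M ≤ Real.log ((M + 1 : ℕ) : ℝ) :=
        Real.log_le_log (by linarith) (by push_cast; linarith)
      have h3 : 1 / (M * Real.log ((M + 1 : ℕ) : ℝ)) ≤ 1 / (M * Real.log M) := by
        apply one_div_le_one_div_of_le (by positivity)
        gcongr
      refine le_trans ?_ (sub_le_sub_right h3 _)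
      set l := Real.log ((M + 1 : ℕ) : ℝ)
      have hl : 0 < l := by linarith
      push_cast
      have e : 1 / (M * l) - 1 / ((M + 1 : ℝ) * l) = 1 / (M * (M + 1) * l) := by
        field_simp; ring
      rw [e]
      apply one_div_le_one_div_of_le (by positivity)
      apply mul_le_mul_of_nonneg_right _ hl.le
      nlinarith
    have h1 := mul_nonneg (sub_nonneg.2 hp) (sub_nonneg.2 hanti)
    have h2 := mul_le_mul_of_nonneg_left hf hc
    push_cast at *
    nlinarith

lemma loss_le {c : ℝ} (hc : 0 ≤ c) (n : ℕ) (hn : 2 ≤ n)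
    (hpsi : ∀ m : ℕ, n ≤ m → Chebyshev.psi m ≤ c * m) :
    RR n + Chebyshev.psi n * ff n ≤ 2 * c / (n * Real.log n) := by
  have hn1 : (1 : ℝ) < n := by exact_mod_cast (by omega : 1 < n)
  have hb : ∀ M : ℕ, n + 1 ≤ M → ∑ m ∈ Finset.range M, aa m ≤
      ∑ m ∈ Finset.Icc 1 n, aa m + (2 * c / (n * Real.log n) - Chebyshev.psi n * ff n) := by
    intro M hM
    obtain ⟨M, rfl⟩ : ∃ M', M = M' + 1 := ⟨M - 1, by omega⟩
    have h := partial_tail hc n hn hpsi M (by omega)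
    have hM1 : (1 : ℝ) < M := by exact_mod_cast (by omega : 1 < M)
    have hlM := Real.log_pos hM1
    have e1 : ∑ m ∈ Finset.range (M + 1), aa m =
        ∑ m ∈ Finset.Icc 1 n, aa m + ∑ m ∈ Finset.Ioc n M, aa m := by
      have h0 : aa 0 = 0 := by simp [aa]
      have i1 : Finset.Icc 1 n = Finset.Ico 1 (n + 1) := by ext; simp only [Finset.mem_Icc, Finset.mem_Ioc, Finset.mem_Ico]; omega
      have i2 : Finset.Ioc n M = Finset.Ico (n + 1) (M + 1) := by ext; simp only [Finset.mem_Icc, Finset.mem_Ioc, Finset.mem_Ico]; omega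
      rw [i1, i2, Finset.sum_Ico_consecutive _ (by omega) (by omega),
        ← Finset.sum_range_add_sum_Ico _ (by omega : 1 ≤ M + 1)]
      simp [h0]
    rw [e1]
    have h3 : 0 ≤ (c * M - Chebyshev.psi M) * ff M := by
      apply mul_nonneg (sub_nonneg.2 (hpsi M (by omega)))
      unfold ff; positivity
    have h4 : 0 ≤ c * (1 / (M * Real.log M)) := by positivity
    have h5 : (n : ℝ) * ff n = 1 / (n * Real.log n) := by
      unfold ff; field_simp
    rw [h5] at h
    have h6 : 2 * c / (n * Real.log n) = 2 * (c * (1 / (n * Real.log n))) := by ring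
    rw [h6]
    linarith
  have hlim := hasSum_aa.tendsto_sum_nat
  have := le_of_tendsto hlim (Filter.eventually_atTop.2 ⟨n + 1, hb⟩)
  unfold RR
  linarith

lemma psi_bound (u : ℝ) (hu : 4096 ≤ u) : Chebyshev.psi u ≤ 1.513 * u := by
  have hu0 : (0 : ℝ) < u := by linarith
  have h1 := Chebyshev.psi_sub_theta_le_psi_add_psi_add_psi u
  have h2 := Chebyshev.theta_le_log4_mul_x hu0.le
  have hpw : ∀ e : ℝ, Chebyshev.psi (u ^ e) ≤ (Real.log 4 + 4) * u ^ e := fun e =>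
    Chebyshev.psi_le_const_mul_self (Real.rpow_nonneg hu0.le e)
  have hl4 : Real.log 4 ≤ 1.3863 := by
    have : Real.log 4 = 2 * Real.log 2 := by
      rw [show (4 : ℝ) = 2 ^ 2 by norm_num, Real.log_pow]; norm_num
    linarith [Real.log_two_lt_d9]
  have hl40 : 0 ≤ Real.log 4 := Real.log_nonneg (by norm_num)
  have hb : ∀ (e b : ℝ), e ≤ 1 → (4096 : ℝ) ^ (e - 1) ≤ b → u ^ e ≤ b * u := by
    intro e b he hb
    have : u ^ e = u ^ (e - 1) * u := by
      rw [← Real.rpow_add_one hu0.ne']; ring_nf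
    rw [this]
    apply mul_le_mul_of_nonneg_right _ hu0.le
    exact le_trans (Real.rpow_le_rpow_of_nonpos (by norm_num) hu (by linarith)) hb
  have e4096 : (4096 : ℝ) = 2 ^ (12 : ℝ) := by norm_num
  have b2 : u ^ (2 : ℝ)⁻¹ ≤ 1 / 64 * u := by
    apply hb _ _ (by norm_num)
    rw [e4096, ← Real.rpow_mul (by norm_num)]
    norm_num [Real.rpow_neg]
  have b3 : u ^ (3 : ℝ)⁻¹ ≤ 1 / 256 * u := by
    apply hb _ _ (by norm_num)
    rw [e4096, ← Real.rpow_mul (by norm_num)]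
    norm_num [Real.rpow_neg]
  have b5 : u ^ (5 : ℝ)⁻¹ ≤ 1 / 256 * u :=
    le_trans (Real.rpow_le_rpow_of_exponent_le (by linarith) (by norm_num)) b3
  have g2 := le_trans (hpw (2 : ℝ)⁻¹) (mul_le_mul_of_nonneg_left b2 (by linarith))
  have g3 := le_trans (hpw (3 : ℝ)⁻¹) (mul_le_mul_of_nonneg_left b3 (by linarith))
  have g5 := le_trans (hpw (5 : ℝ)⁻¹) (mul_le_mul_of_nonneg_left b5 (by linarith))
  have : Real.log 4 * u ≤ 1.3863 * u := mul_le_mul_of_nonneg_right hl4 hu0.le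
  linarith

/-- The loss function. -/
noncomputable def LL (y : ℝ) : ℝ := RR ⌊y⌋₊ + Chebyshev.psi y * ff y

lemma LL_large (y : ℝ) (hy : 4096 ≤ y) : LL y ≤ 0.249 / y + 1 / (y * Real.log y) := by
  have hn : 4096 ≤ ⌊y⌋₊ := Nat.le_floor (by exact_mod_cast hy)
  set n := ⌊y⌋₊ with hnd
  have hn' : (4096 : ℝ) ≤ n := by exact_mod_cast hn
  have h := loss_le (c := 1.513) (by norm_num) n (by omega)
    (fun m hm => psi_bound m (by exact_mod_cast le_trans hn hm))
  have hny : (n : ℝ) ≤ y := Nat.floor_le (by linarith)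
  have hyn : y < n + 1 := Nat.lt_floor_add_one y
  have hpsi : Chebyshev.psi y = Chebyshev.psi n := Chebyshev.psi_eq_psi_coe_floor y
  have hff : ff y ≤ ff n := ff_anti (by linarith) hny
  have h1 : LL y ≤ RR n + Chebyshev.psi n * ff n := by
    unfold LL
    rw [hpsi, ← hnd]
    have := mul_le_mul_of_nonneg_left hff (Chebyshev.psi_nonneg n)
    linarith
  refine le_trans h1 (le_trans h ?_)
  have hl0 : 8.3 ≤ Real.log n := by
    have : Real.log 4096 ≤ Real.log n := Real.log_le_log (by norm_num) hn'
    have e : Real.log 4096 = 12 * Real.log 2 := by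
      rw [show (4096 : ℝ) = 2 ^ 12 by norm_num, Real.log_pow]; norm_num
    linarith [Real.log_two_gt_d9]
  have hly : Real.log y ≤ 1.001 * Real.log n := by
    have : Real.log y = Real.log n + Real.log (y / n) := by
      rw [Real.log_div (by linarith) (by linarith)]; ring
    have h3 := Real.log_le_sub_one_of_pos (x := y / n) (by positivity)
    have h4 : y / n ≤ 1.001 := by rw [div_le_iff₀ (by linarith)]; linarith
    linarith
  have hly0 : 0 < Real.log y := Real.log_pos (by linarith)
  have e1 : 0.249 / y + 1 / (y * Real.log y) = (0.249 + 1 / Real.log y) / y := by field_simp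
  rw [e1, div_le_div_iff₀ (by positivity) (by linarith)]
  have h5 : 1 / (1.001 * Real.log n) ≤ 1 / Real.log y := one_div_le_one_div_of_le hly0 hly
  have h6 : (0.249 + 1 / (1.001 * Real.log n)) * (n * Real.log n) =
      (0.249 * Real.log n + 1 / 1.001) * n := by field_simp
  have h7 : (0.249 + 1 / (1.001 * Real.log n)) * (n * Real.log n) ≤
      (0.249 + 1 / Real.log y) * (n * Real.log n) := by gcongr
  refine le_trans ?_ h7
  rw [h6]
  nlinarith

end TVM


namespace TVM
open ArithmeticFunction

lemma log_zeta_two_le : Real.log (Real.pi ^ 2 / 6) ≤ 0.497700303 := by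
  rw [Real.log_le_iff_le_exp (by positivity)]
  have h := Real.sum_le_exp_of_nonneg (x := 0.497700303) (by norm_num) 12
  refine le_trans ?_ h
  have hp := Real.pi_lt_d20
  have hp0 := Real.pi_pos
  have : Real.pi ^ 2 ≤ 3.14159265358979323847 ^ 2 := by gcongr
  refine le_trans (div_le_div_of_nonneg_right this (by norm_num)) ?_
  simp only [Finset.sum_range_succ, Finset.sum_range_zero, Nat.factorial]
  norm_num

/-- `LL` at `y` is bounded through the data at any earlier integer `a`. -/
lemma LL_le_of_le (a : ℕ) (ha : 2 ≤ a) (y : ℝ) (hay : (a : ℝ) ≤ y) :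
    LL y ≤ RR a + Chebyshev.psi a * ff y := by
  have ha1 : (1 : ℝ) < a := by exact_mod_cast (by omega : 1 < a)
  have key : ∀ n : ℕ, a ≤ n → (n : ℝ) ≤ y →
      RR n + Chebyshev.psi n * ff y ≤ RR a + Chebyshev.psi a * ff y := by
    intro n hn
    induction n, hn using Nat.le_induction with
    | base => intro _; exact le_rfl
    | succ n hn ih =>
      intro hny
      have h1 := ih (le_trans (by push_cast; linarith) hny)
      have hn1 : (1 : ℝ) < ((n + 1 : ℕ) : ℝ) := by exact_mod_cast (by omega : 1 < n + 1)
      have h2 := ff_anti hn1 hny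
      have h3 := mul_le_mul_of_nonneg_left h2 (@vonMangoldt_nonneg (n + 1))
      rw [RR_succ, psi_succ, aa_eq]
      linarith
  have hf : a ≤ ⌊y⌋₊ := Nat.le_floor hay
  have := key ⌊y⌋₊ hf (Nat.floor_le (by linarith))
  unfold LL
  rw [Chebyshev.psi_eq_psi_coe_floor y]
  exact this

lemma concave_G {R p a b : ℝ} (ha : 1 < a) (hR : 0.249 ≤ 3 * R * a) :
    ConcaveOn ℝ (Set.Icc a b)
      (fun y => y - p + Real.log y * (0.249 * y - R * y ^ 2)) := by
  have hR0 : 0 < R := by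
    by_contra hc
    push Not at hc
    nlinarith
  refine concaveOn_of_hasDerivWithinAt2_nonpos (convex_Icc a b)
    (f' := fun y => 1 + ((0.249 - R * y) + Real.log y * (0.249 - 2 * R * y)))
    (f'' := fun y => -R + ((0.249 - 2 * R * y) / y + Real.log y * (-(2 * R)))) ?_ ?_ ?_ ?_
  · apply ContinuousOn.add (by fun_prop)
    apply ContinuousOn.mul _ (by fun_prop)
    apply Real.continuousOn_log.mono
    intro y hy
    have := hy.1
    simp only [Set.mem_compl_iff, Set.mem_singleton_iff]
    linarith
  · intro y hy
    rw [interior_Icc] at hy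
    have hy0 : y ≠ 0 := by linarith [hy.1]
    apply HasDerivAt.hasDerivWithinAt
    have h1 := (Real.hasDerivAt_log hy0).mul
      (((hasDerivAt_id y).const_mul 0.249).sub (((hasDerivAt_id y).pow 2).const_mul R))
    have h2 := ((hasDerivAt_id y).sub_const p).add h1
    have h3 : HasDerivAt (fun y => y - p + Real.log y * (0.249 * y - R * y ^ 2)) _ y := h2
    refine h3.congr_deriv ?_
    simp only [id, Pi.sub_apply, Pi.mul_apply, Pi.pow_apply]
    field_simp
    ring
  · intro y hy
    rw [interior_Icc] at hy
    have hy0 : y ≠ 0 := by linarith [hy.1]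
    apply HasDerivAt.hasDerivWithinAt
    have h1 := (Real.hasDerivAt_log hy0).mul
      ((hasDerivAt_const y (0.249 : ℝ)).sub ((hasDerivAt_id y).const_mul (2 * R)))
    have h2 := (((hasDerivAt_const y (0.249 : ℝ)).sub ((hasDerivAt_id y).const_mul R)).add
      h1).const_add 1
    have h3 : HasDerivAt
      (fun y => 1 + ((0.249 - R * y) + Real.log y * (0.249 - 2 * R * y))) _ y := h2
    refine h3.congr_deriv ?_
    simp only [id, Pi.sub_apply, Pi.mul_apply, Pi.pow_apply]
    field_simp
    ring
  · intro y hy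
    rw [interior_Icc] at hy
    have hy1 : 1 < y := by linarith [hy.1]
    have hl : 0 < Real.log y := Real.log_pos hy1
    have : (0.249 - 2 * R * y) / y ≤ R := by
      rw [div_le_iff₀ (by linarith)]
      nlinarith [hy.1]
    nlinarith

lemma interval_bound {R p a b y : ℝ} (ha : 1 < a) (hR : 0.249 ≤ 3 * R * a)
    (hGa : 0 ≤ a - p + Real.log a * (0.249 * a - R * a ^ 2))
    (hGb : 0 ≤ b - p + Real.log b * (0.249 * b - R * b ^ 2))
    (hay : a ≤ y) (hyb : y ≤ b) :
    R + p * ff y ≤ 0.249 / y + 1 / (y * Real.log y) := by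
  have h := (concave_G (p := p) (b := b) ha hR).min_le_of_mem_Icc
    (Set.left_mem_Icc.2 (hay.trans hyb)) (Set.right_mem_Icc.2 (hay.trans hyb)) ⟨hay, hyb⟩
  have h2 := le_trans (le_min hGa hGb) h
  have hl : 0 < Real.log y := Real.log_pos (by linarith)
  have hy0 : 0 < y := by linarith
  unfold ff
  have e : 0.249 / y + 1 / (y * Real.log y) - (R + p * (1 / (y ^ 2 * Real.log y))) =
      (y - p + Real.log y * (0.249 * y - R * y ^ 2)) / (y ^ 2 * Real.log y) := by
    field_simp
    ring
  have : 0 ≤ (y - p + Real.log y * (0.249 * y - R * y ^ 2)) / (y ^ 2 * Real.log y) := by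
    positivity
  linarith

/-! ### The verified computation on `[9, 4096]` -/

/-- The largest `k ≤ f` with `g ^ k = n`, or `0`. -/
def expo (g n f : ℕ) : ℕ :=
  Nat.rec 0 (fun f ih => bif Nat.beq (g ^ (f + 1)) n then f + 1 else ih) f

lemma expo_spec (g n f : ℕ) (h : expo g n f ≠ 0) : g ^ (expo g n f) = n := by
  induction f with
  | zero => exact absurd rfl h
  | succ f ih =>
    have e : expo g n (f + 1) = bif Nat.beq (g ^ (f + 1)) n then f + 1 else expo g n f := rfl
    rw [e] at h ⊢
    cases hb : Nat.beq (g ^ (f + 1)) n with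
    | true => rw [cond_true]; exact Nat.eq_of_beq_eq_true hb
    | false => rw [hb, cond_false] at h; rw [cond_false]; exact ih h

/-- Evaluate the argument before passing it on. -/
def force (n : ℕ) (f : ℕ → Bool) : Bool := Nat.rec (f 0) (fun k _ => f (Nat.succ k)) n

lemma force_eq (n : ℕ) (f : ℕ → Bool) : force n f = f n := by cases n <;> rfl

/-- The new value of the bound for `RR` (scaled by `10 ^ 12`). -/
def newQ (g n Q : ℕ) : ℕ :=
  bif Nat.beq g 1 then Q else Q - 1000000000000 / (expo g n 12 * (n * n))

/-- Advance `cnt` steps. -/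
def advance (cnt : ℕ) : ℕ → ℕ → ℕ → (ℕ → ℕ → ℕ → Bool) → Bool :=
  Nat.rec (fun m N Q k => k m N Q)
    (fun _ ih m N Q k =>
      force (m + 1) fun m' => force (m' / Nat.gcd m' N) fun g =>
        force (N * g) fun N' => force (newQ g m' Q) fun Q' => ih m' N' Q' k) cnt

/-- The invariant of the computation. -/
def Inv (m N Q : ℕ) : Prop := N = Nat.lcmUpto m ∧ RR m ≤ Q / 1000000000000

lemma lcmUpto_succ (m : ℕ) : Nat.lcmUpto (m + 1) =
    Nat.lcmUpto m * ((m + 1) / Nat.gcd (m + 1) (Nat.lcmUpto m)) := by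
  unfold Nat.lcmUpto
  rw [← Finset.insert_Icc_right_eq_Icc_add_one (by omega), Finset.lcm_insert]
  simp only [id]
  change Nat.lcm _ _ = _
  rw [Nat.lcm, Nat.mul_comm, Nat.mul_div_assoc _ (Nat.gcd_dvd_left _ _)]

lemma Inv_succ {m N Q : ℕ} (hm : 1 ≤ m) (h : Inv m N Q) :
    Inv (m + 1) (N * ((m + 1) / Nat.gcd (m + 1) N))
      (newQ ((m + 1) / Nat.gcd (m + 1) N) (m + 1) Q) := by
  obtain ⟨rfl, hQ⟩ := h
  refine ⟨(lcmUpto_succ m).symm, ?_⟩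
  have hl := lcmUpto_succ m
  set N := Nat.lcmUpto m with hN
  set g := (m + 1) / Nat.gcd (m + 1) N with hg
  have hN0 : (N : ℝ) ≠ 0 := by exact_mod_cast Nat.lcmUpto_ne_zero m
  have hNg : N * g ≠ 0 := by rw [← hl]; exact Nat.lcmUpto_ne_zero _
  have hg0 : g ≠ 0 := right_ne_zero_of_mul hNg
  have hL : Λ (m + 1) = Real.log g := by
    have h1 := psi_succ m
    rw [Chebyshev.psi_eq_log_lcmUpto, Chebyshev.psi_eq_log_lcmUpto, hl, Nat.cast_mul,
      Real.log_mul hN0 (by exact_mod_cast hg0)] at h1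
    linarith
  rw [RR_succ]
  unfold newQ
  cases hb : Nat.beq g 1 with
  | true =>
    rw [cond_true]
    linarith [aa_nonneg (m + 1)]
  | false =>
    rw [cond_false]
    have hg1 : g ≠ 1 := fun h => by rw [h] at hb; exact absurd hb (by decide)
    set k := expo g (m + 1) 12 with hk
    rcases Nat.eq_zero_or_pos k with hk0 | hkp
    · rw [hk0]
      simp only [Nat.zero_mul, Nat.div_zero, Nat.sub_zero]
      linarith [aa_nonneg (m + 1)]
    have hpow := expo_spec g (m + 1) 12 hkp.ne'
    rw [← hk] at hpow
    have hgr : (1 : ℝ) < g := by exact_mod_cast lt_of_le_of_ne (Nat.pos_of_ne_zero hg0) (Ne.symm hg1)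
    have hlg : 0 < Real.log g := Real.log_pos hgr
    have hkr : (0 : ℝ) < k := by exact_mod_cast hkp
    have haa : aa (m + 1) = 1 / (k * (((m + 1 : ℕ) : ℝ) * ((m + 1 : ℕ) : ℝ))) := by
      have hlog : Real.log ((m + 1 : ℕ) : ℝ) = k * Real.log g := by
        rw [← hpow, Nat.cast_pow, Real.log_pow]
      unfold aa
      rw [hL, hlog]
      field_simp
    have hd : ((1000000000000 / (k * ((m + 1) * (m + 1))) : ℕ) : ℝ) ≤
        1000000000000 * aa (m + 1) := by
      refine le_trans Nat.cast_div_le ?_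
      rw [haa]
      push_cast
      rw [mul_one_div]
    have hs : (Q : ℝ) - ((1000000000000 / (k * ((m + 1) * (m + 1))) : ℕ) : ℝ) ≤
        ((Q - 1000000000000 / (k * ((m + 1) * (m + 1))) : ℕ) : ℝ) := by
      have : Q ≤ (Q - 1000000000000 / (k * ((m + 1) * (m + 1)))) +
        1000000000000 / (k * ((m + 1) * (m + 1))) := by omega
      have h2 : (Q : ℝ) ≤ ((Q - 1000000000000 / (k * ((m + 1) * (m + 1))) : ℕ) : ℝ) +
        ((1000000000000 / (k * ((m + 1) * (m + 1))) : ℕ) : ℝ) := by exact_mod_cast this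
      linarith
    rw [le_div_iff₀ (by norm_num)] at hQ ⊢
    linarith

lemma advance_sound (cnt : ℕ) : ∀ (m N Q : ℕ) (k : ℕ → ℕ → ℕ → Bool), 1 ≤ m → Inv m N Q →
    advance cnt m N Q k = true → ∃ N' Q', Inv (m + cnt) N' Q' ∧ k (m + cnt) N' Q' = true := by
  induction cnt with
  | zero => intro m N Q k _ hI h; exact ⟨N, Q, hI, h⟩
  | succ c ih =>
    intro m N Q k hm hI h
    have e : advance (c + 1) m N Q k =
      force (m + 1) fun m' => force (m' / Nat.gcd m' N) fun g =>
        force (N * g) fun N' => force (newQ g m' Q) fun Q' => advance c m' N' Q' k := rfl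
    rw [e] at h
    simp only [force_eq] at h
    have := ih _ _ _ k (by omega) (Inv_succ hm hI) h
    rwa [show m + 1 + c = m + (c + 1) by omega] at this

/-- Check `l / 10 ^ 4 ≤ log n ≤ (l + 1) / 10 ^ 4`. -/
def logOK (n l : ℕ) : Bool :=
  Nat.ble (27182818286 ^ l) (n ^ 10000 * 10000000000 ^ l) &&
  Nat.ble (n ^ 10000 * 10000000000 ^ (l + 1)) (27182818283 ^ (l + 1))

lemma log_le_of_pow {n D r : ℕ} (hn : 0 < n) (hD : 0 < D)
    (h : n ^ D * 10000000000 ^ r ≤ 27182818283 ^ r) : Real.log n ≤ r / D := by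
  have hDr : (0 : ℝ) < D := by exact_mod_cast hD
  have hnr : (0 : ℝ) < n := by exact_mod_cast hn
  rw [le_div_iff₀ hDr, mul_comm, ← Real.log_pow, Real.log_le_iff_le_exp (by positivity)]
  have h1 : (n : ℝ) ^ D * 10000000000 ^ r ≤ 27182818283 ^ r := by exact_mod_cast h
  have h2 : (n : ℝ) ^ D ≤ 2.7182818283 ^ r := by
    rw [← le_div_iff₀ (by positivity), ← div_pow] at h1
    norm_num at h1 ⊢
    exact h1
  refine le_trans h2 ?_
  rw [← Real.exp_one_pow]
  have := Real.exp_one_gt_d9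
  gcongr

lemma le_log_of_pow {n D r : ℕ} (hn : 0 < n) (hD : 0 < D)
    (h : 27182818286 ^ r ≤ n ^ D * 10000000000 ^ r) : (r : ℝ) / D ≤ Real.log n := by
  have hDr : (0 : ℝ) < D := by exact_mod_cast hD
  have hnr : (0 : ℝ) < n := by exact_mod_cast hn
  rw [div_le_iff₀ hDr, mul_comm, ← Real.log_pow, Real.le_log_iff_exp_le (by positivity)]
  have h1 : (27182818286 : ℝ) ^ r ≤ (n : ℝ) ^ D * 10000000000 ^ r := by exact_mod_cast h
  have h2 : (2.7182818286 : ℝ) ^ r ≤ (n : ℝ) ^ D := by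
    rw [← div_le_iff₀ (by positivity), ← div_pow] at h1
    norm_num at h1 ⊢
    exact h1
  refine le_trans ?_ h2
  rw [← Real.exp_one_pow]
  have := Real.exp_one_lt_d9
  gcongr

lemma logOK_sound {n l : ℕ} (hn : 0 < n) (h : logOK n l = true) :
    (l : ℝ) / 10000 ≤ Real.log n ∧ Real.log n ≤ (l + 1) / 10000 := by
  unfold logOK at h
  rw [Bool.and_eq_true] at h
  have h1 := le_log_of_pow hn (by norm_num) (Nat.le_of_ble_eq_true h.1)
  have h2 := log_le_of_pow hn (by norm_num) (Nat.le_of_ble_eq_true h.2)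
  push_cast at h1 h2
  exact ⟨h1, h2⟩

/-- Check that the concave function is nonnegative at `y`, for the logarithm replaced by
`l / 10 ^ 4`. -/
def gOK (y l D r Q : ℕ) : Bool :=
  Nat.ble (r * 10000000000000000 + D * l * Q * (y * y))
    (D * y * (10000000000000000 + l * 249000000000))

lemma gOK_sound {y l D r Q : ℕ} (hD : 0 < D) (h : gOK y l D r Q = true) :
    0 ≤ (y : ℝ) - r / D + (l / 10000 : ℝ) *
      (0.249 * y - (Q / 1000000000000 : ℝ) * (y : ℝ) ^ 2) := by
  have h1 := Nat.le_of_ble_eq_true h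
  have hDr : (0 : ℝ) < D := by exact_mod_cast hD
  have h2 : (r : ℝ) * 10000000000000000 + D * l * Q * (y * y) ≤
    D * y * (10000000000000000 + l * 249000000000) := by exact_mod_cast h1
  have e : (y : ℝ) - r / D + (l / 10000 : ℝ) *
      (0.249 * y - (Q / 1000000000000 : ℝ) * (y : ℝ) ^ 2) =
      (D * y * (10000000000000000 + l * 249000000000) -
        (r * 10000000000000000 + D * l * Q * (y * y))) / (D * 10000000000000000) := by
    field_simp
    ring
  rw [e]
  apply div_nonneg (by linarith) (by positivity)

lemma gOK_pair {y l D r Q : ℕ} (hy : 0 < y) (hD : 0 < D) (hl : logOK y l = true)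
    (h : gOK y l D r Q = true) (h' : gOK y (l + 1) D r Q = true) :
    0 ≤ (y : ℝ) - r / D + Real.log y *
      (0.249 * y - (Q / 1000000000000 : ℝ) * (y : ℝ) ^ 2) := by
  obtain ⟨h1, h2⟩ := logOK_sound hy hl
  have g1 := gOK_sound hD h
  have g2 := gOK_sound hD h'
  push_cast at g2
  set w := 0.249 * (y : ℝ) - (Q / 1000000000000 : ℝ) * (y : ℝ) ^ 2
  rcases le_total 0 w with hw | hw
  · have := mul_le_mul_of_nonneg_right h1 hw
    linarith
  · have := mul_le_mul_of_nonpos_right h2 hw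
    linarith

/-- The checker: a list of data `(b, D, r, l)`. -/
def go (L : List (ℕ × ℕ × ℕ × ℕ)) : ℕ → ℕ → ℕ → ℕ → Bool :=
  List.rec (fun m _ _ _ => Nat.ble 4096 m)
    (fun s _ ih m N Q l =>
      Nat.ble m s.1 && Nat.ble 1 s.2.1 &&
      Nat.ble (N ^ s.2.1 * 10000000000 ^ s.2.2.1) (27182818283 ^ s.2.2.1) &&
      Nat.ble 249000000000 (3 * Q * m) &&
      gOK m l s.2.1 s.2.2.1 Q && gOK m (l + 1) s.2.1 s.2.2.1 Q &&
      logOK s.1 s.2.2.2 &&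
      gOK s.1 s.2.2.2 s.2.1 s.2.2.1 Q && gOK s.1 (s.2.2.2 + 1) s.2.1 s.2.2.1 Q &&
      advance (s.1 - m) m N Q (fun m' N' Q' => ih m' N' Q' s.2.2.2)) L

lemma go_sound (L : List (ℕ × ℕ × ℕ × ℕ)) : ∀ (m N Q l : ℕ), 2 ≤ m → Inv m N Q →
    logOK m l = true → go L m N Q l = true →
    ∀ y : ℝ, (m : ℝ) ≤ y → y < 4096 → LL y ≤ 0.249 / y + 1 / (y * Real.log y) := by
  induction L with
  | nil =>
    intro m N Q l hm hI hl h y hy hy2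
    have h1 : 4096 ≤ m := Nat.le_of_ble_eq_true h
    have : (4096 : ℝ) ≤ m := by exact_mod_cast h1
    linarith
  | cons s t ih =>
    intro m N Q l hm hI hl h y hy hy2
    obtain ⟨b, D, r, l'⟩ := s
    have e : go ((b, D, r, l') :: t) m N Q l = (
      Nat.ble m b && Nat.ble 1 D &&
      Nat.ble (N ^ D * 10000000000 ^ r) (27182818283 ^ r) &&
      Nat.ble 249000000000 (3 * Q * m) &&
      gOK m l D r Q && gOK m (l + 1) D r Q &&
      logOK b l' &&
      gOK b l' D r Q && gOK b (l' + 1) D r Q &&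
      advance (b - m) m N Q (fun m' N' Q' => go t m' N' Q' l')) := rfl
    rw [e] at h
    simp only [Bool.and_eq_true] at h
    obtain ⟨⟨⟨⟨⟨⟨⟨⟨⟨hmb, hD⟩, hpsi⟩, hc⟩, ga⟩, ga'⟩, hlb⟩, gb⟩, gb'⟩, hadv⟩ := h
    have hmb := Nat.le_of_ble_eq_true hmb
    have hD := Nat.le_of_ble_eq_true hD
    have hc := Nat.le_of_ble_eq_true hc
    have hpsi := Nat.le_of_ble_eq_true hpsi
    rcases le_total y b with hyb | hyb
    · have hm1 : (1 : ℝ) < m := by exact_mod_cast (by omega : 1 < m)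
      have h1 := LL_le_of_le m hm y hy
      obtain ⟨hN, hQ⟩ := hI
      have hN0 : 0 < N := by rw [hN]; exact Nat.lcmUpto_pos m
      have hp : Chebyshev.psi m ≤ r / D := by
        rw [Chebyshev.psi_eq_log_lcmUpto, ← hN]
        exact log_le_of_pow hN0 hD hpsi
      have hff : 0 ≤ ff y := by
        have : 0 < Real.log y := Real.log_pos (by linarith)
        unfold ff; positivity
      have h2 := interval_bound (R := (Q / 1000000000000 : ℝ)) (p := (r / D : ℝ)) hm1
        (by
          have : (249000000000 : ℝ) ≤ 3 * Q * m := by exact_mod_cast hc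
          linarith)
        (gOK_pair (by omega) hD hl ga ga') (gOK_pair (by omega) hD hlb gb gb') hy hyb
      have h3 := mul_le_mul_of_nonneg_right hp hff
      linarith
    · obtain ⟨N', Q', hI', hk⟩ := advance_sound _ m N Q _ (by omega) hI hadv
      rw [show m + (b - m) = b by omega] at hI' hk
      exact ih b N' Q' l' (by omega) hI' hlb hk y hyb hy2

/-- Data for the checker. -/
def specs : List (ℕ × ℕ × ℕ × ℕ) :=
  [(11, 1000, 7833, 23978), (13, 1000, 10230, 25649), (18, 1000, 12795, 28903),
   (22, 1000, 16322, 30910), (28, 1000, 19266, 33322), (37, 1000, 25110, 36109),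
   (58, 1000, 36215, 40604), (92, 1000, 53456, 45217), (167, 100, 8948, 51179),
   (339, 100, 16696, 58260), (748, 10, 3339, 66174), (1844, 10, 7462, 75196),
   (4096, 10, 18320, 83177)]

lemma compute : advance 8 1 1 497700303000 (fun m N Q => go specs m N Q 21972) = true := by
  decide +kernel

lemma logOK_nine : logOK 9 21972 = true := by decide +kernel

lemma LL_small (y : ℝ) (hy : 9 ≤ y) (hy2 : y < 4096) :
    LL y ≤ 0.249 / y + 1 / (y * Real.log y) := by
  have hI : Inv 1 1 497700303000 := by
    refine ⟨by simp [Nat.lcmUpto], ?_⟩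
    have : RR 1 = Real.log (Real.pi ^ 2 / 6) := by simp [RR, aa]
    rw [this]
    refine le_trans log_zeta_two_le ?_
    norm_num
  obtain ⟨N, Q, hI', hk⟩ := advance_sound 8 1 1 _ _ le_rfl hI compute
  exact go_sound specs 9 N Q 21972 (by norm_num) hI' logOK_nine hk y (by exact_mod_cast hy) hy2

lemma loss_bound (y : ℝ) (hy : 9 ≤ y) :
    Real.log (Real.pi ^ 2 / 6) - ∑ m ∈ Finset.Icc 1 ⌊y⌋₊, Λ m / (m ^ 2 * Real.log m)
      + Chebyshev.psi y / (y ^ 2 * Real.log y) ≤ 0.249 / y + 1 / (y * Real.log y) := by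
  have h : LL y ≤ 0.249 / y + 1 / (y * Real.log y) := by
    rcases lt_or_ge y 4096 with h | h
    · exact LL_small y hy h
    · exact LL_large y h
  unfold LL RR aa ff at h
  rwa [mul_one_div] at h

end TVM


namespace TVM
open ArithmeticFunction

lemma re_term (n : ℕ) (hn : 1 ≤ n) (t l c : ℝ) :
    ((l : ℂ) * (n : ℂ) ^ (-(t : ℂ) * I) * (c : ℂ)).re = l * c * Real.cos (t * Real.log n) := by
  have hn0 : (n : ℂ) ≠ 0 := by exact_mod_cast (by omega : n ≠ 0)
  have e : (n : ℂ) ^ (-(t : ℂ) * I) = Complex.exp (((-(t * Real.log n) : ℝ) : ℂ) * I) := by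
    rw [Complex.cpow_def_of_ne_zero hn0, ← Complex.natCast_log]
    congr 1
    push_cast
    ring
  have e2 : (l : ℂ) * (n : ℂ) ^ (-(t : ℂ) * I) * (c : ℂ) =
      ((l * c : ℝ) : ℂ) * Complex.exp (((-(t * Real.log n) : ℝ) : ℂ) * I) := by
    rw [e]; push_cast; ring
  rw [e2, Complex.re_ofReal_mul, Complex.exp_ofReal_mul_I_re, Real.cos_neg]

end TVM

theorem twisted_vonMangoldt_sum_lower (RH : RiemannHypothesis) (x t : ℝ) (hx : 81 ≤ x) :
    (∑ n ∈ Finset.Icc 1 ⌊x⌋₊,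
        (ArithmeticFunction.vonMangoldt n : ℂ) * (n : ℂ) ^ (-(t : ℂ) * I) *
          ((1 / (n * Real.log n) - 1 / (x * Real.log x) : ℝ) : ℂ)).re
      ≥ -(∑ n ∈ Finset.Icc 1 ⌊x⌋₊,
            ArithmeticFunction.vonMangoldt n / (n * Real.log n) *
              (Real.log (x / n) / Real.log x))
        - (1 / Real.log x) *
            ∑ n ∈ Finset.Icc 1 ⌊x⌋₊, ArithmeticFunction.vonMangoldt n / n * (1 - n / x)
        + Real.log (Real.pi ^ 2 / 6) - 0.249 / Real.sqrt x
        - 2 / (Real.sqrt x * Real.log x) := by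
  have hx0 : (0 : ℝ) < x := by linarith
  have hlx : 0 < Real.log x := Real.log_pos (by linarith)
  have hy : (9 : ℝ) ≤ √x := Real.le_sqrt_of_sq_le (by linarith)
  have hloss := TVM.loss_bound (√x) hy
  have hA := TVM.twisted_ge_sign x t hx
  have hB := TVM.even_part x hx
  have hlog : Real.log x = 2 * Real.log (√x) := by
    rw [Real.log_sqrt hx0.le]; ring
  have hsq : √x ^ 2 = x := Real.sq_sqrt hx0.le
  have hly : 0 < Real.log (√x) := Real.log_pos (by linarith)
  have hpsi : ∑ m ∈ Finset.Icc 1 ⌊√x⌋₊, 2 * ArithmeticFunction.vonMangoldt m / (x * Real.log x) =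
      Chebyshev.psi (√x) / (√x ^ 2 * Real.log (√x)) := by
    rw [← Finset.sum_div, ← Finset.mul_sum, hsq, hlog, Chebyshev.psi]
    have : Finset.Icc 1 ⌊√x⌋₊ = Finset.Ioc 0 ⌊√x⌋₊ := by ext; simp [Nat.succ_le_iff]
    rw [this]
    field_simp
  rw [Finset.sum_sub_distrib, hpsi] at hB
  have hre : (∑ n ∈ Finset.Icc 1 ⌊x⌋₊,
        (ArithmeticFunction.vonMangoldt n : ℂ) * (n : ℂ) ^ (-(t : ℂ) * I) *
          ((1 / (n * Real.log n) - 1 / (x * Real.log x) : ℝ) : ℂ)).re =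
      ∑ n ∈ Finset.Icc 1 ⌊x⌋₊, ArithmeticFunction.vonMangoldt n *
        (1 / (n * Real.log n) - 1 / (x * Real.log x)) * Real.cos (t * Real.log n) := by
    rw [Complex.re_sum]
    apply Finset.sum_congr rfl
    intro n hn
    rw [Finset.mem_Icc] at hn
    exact TVM.re_term n hn.1 _ _ _
  have hrhs : (∑ n ∈ Finset.Icc 1 ⌊x⌋₊,
            ArithmeticFunction.vonMangoldt n / (n * Real.log n) *
              (Real.log (x / n) / Real.log x)) + (1 / Real.log x) *
            ∑ n ∈ Finset.Icc 1 ⌊x⌋₊, ArithmeticFunction.vonMangoldt n / n * (1 - n / x) =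
      ∑ n ∈ Finset.Icc 1 ⌊x⌋₊, ArithmeticFunction.vonMangoldt n *
        (1 / (n * Real.log n) - 1 / (x * Real.log x)) := by
    rw [Finset.mul_sum, ← Finset.sum_add_distrib]
    apply Finset.sum_congr rfl
    intro n hn
    rw [Finset.mem_Icc] at hn
    rcases hn.1.eq_or_lt with h1 | h1
    · rw [← h1]; simp
    · have hn1 : (1 : ℝ) < n := by exact_mod_cast h1
      have hln : 0 < Real.log n := Real.log_pos hn1
      rw [Real.log_div hx0.ne' (by linarith)]
      field_simp
      ring
  have hsum : ∑ n ∈ Finset.Icc 1 ⌊x⌋₊, ArithmeticFunction.vonMangoldt n *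
        (1 / (n * Real.log n) - 1 / (x * Real.log x)) * Real.cos (t * Real.log n) =
      (∑ n ∈ Finset.Icc 1 ⌊x⌋₊, ArithmeticFunction.vonMangoldt n *
        (1 / (n * Real.log n) - 1 / (x * Real.log x)) *
          (Real.cos (t * Real.log n) - (-1) ^ (ArithmeticFunction.cardFactors n))) +
      (∑ n ∈ Finset.Icc 1 ⌊x⌋₊, ArithmeticFunction.vonMangoldt n *
        (1 / (n * Real.log n) - 1 / (x * Real.log x)) *
          (1 + (-1) ^ (ArithmeticFunction.cardFactors n))) -
      ∑ n ∈ Finset.Icc 1 ⌊x⌋₊, ArithmeticFunction.vonMangoldt n *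
        (1 / (n * Real.log n) - 1 / (x * Real.log x)) := by
    rw [← Finset.sum_add_distrib, ← Finset.sum_sub_distrib]
    apply Finset.sum_congr rfl
    intro n _
    ring
  have h2 : 2 / (√x * Real.log x) = 1 / (√x * Real.log (√x)) := by
    rw [hlog]; field_simp
  rw [hre, hsum, hB, h2]
  linarith
end
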